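/- arXiv:math/0404192 — 2 statements merged into one kernel-verified Lean document; each statement's English description precedes it below -/
import Mathlib

section
/- Let F be a class of real-valued functions on the n-point set {1,…,n}. Then E(F) ≤ C·∫₀^∞ √(v(F,t)) dt, where C is an absolute constant; moreover, the lower limit 0 of the integral can be replaced by c·n^{−1/2}·E(F) for an absolute constant c > 0. -/
open MeasureTheory Filter
open scoped ENNReal NNReal Pointwise BigOperators

/-- A finite subset `σ` of `Ω` is `t`-shattered by the class `F`: there is a level function `h`
such that for every partition of `σ` (given by the subset `τ = σ₊`) some `f ∈ F` lies below `h`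
on `σ₋ = σ \ τ` and above `h + t` on `σ₊ = τ`. -/
def Shatters {Ω : Type*} (F : Set (Ω → ℝ)) (t : ℝ) (σ : Finset Ω) : Prop :=
  ∃ h : Ω → ℝ, ∀ τ : Finset Ω, τ ⊆ σ →
    ∃ f ∈ F, (∀ x ∈ σ, x ∉ τ → f x ≤ h x) ∧ (∀ x ∈ τ, h x + t ≤ f x)

/-- The combinatorial dimension `v(F,t)`: the maximal cardinality of a `t`-shattered set. -/
noncomputable def combDim {Ω : Type*} (F : Set (Ω → ℝ)) (t : ℝ) : ℝ≥0∞ :=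
  ⨆ (σ : Finset Ω) (_ : Shatters F t σ), (σ.card : ℝ≥0∞)

/-- There are `m` functions in `F` that are pairwise `t`-separated in `L₂(μ)` for some
probability measure `μ` supported on a finite subset of `Ω` (given by weights `w` on `s`). -/
def KPSeparated {Ω : Type*} (F : Set (Ω → ℝ)) (t : ℝ) (m : ℕ) : Prop :=
  ∃ (s : Finset Ω) (w : Ω → ℝ) (f : Fin m → Ω → ℝ),
    (∀ x, 0 ≤ w x) ∧ (∑ x ∈ s, w x = 1) ∧ (∀ i, f i ∈ F) ∧
    ∀ i j : Fin m, i < j → t ^ 2 ≤ ∑ x ∈ s, w x * (f i x - f j x) ^ 2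

/-- The Koltchinskii–Pollard entropy `D(F,t) = log sup { m : KPSeparated F t m }`. -/
noncomputable def KPentropy {Ω : Type*} (F : Set (Ω → ℝ)) (t : ℝ) : ℝ≥0∞ :=
  ⨆ (m : ℕ) (_ : KPSeparated F t m), ENNReal.ofReal (Real.log m)

/-- The law of `n` i.i.d. standard Gaussian random variables. -/
noncomputable def gaussPi (n : ℕ) : Measure (Fin n → ℝ) :=
  Measure.pi fun _ => ProbabilityTheory.gaussianReal 0 1

/-- The normalized Gaussian average `E(F) = n^{-1/2}·𝔼 sup_{f ∈ F} Σᵢ gᵢ f(i)`. -/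
noncomputable def gaussE (n : ℕ) (F : Set (Fin n → ℝ)) : ℝ :=
  (n : ℝ) ^ (-(1 / 2 : ℝ)) *
    ∫ g : Fin n → ℝ, sSup ((fun f => ∑ i, g i * f i) '' F) ∂(gaussPi n)

section ode
open Finset Classical

def Shat {α Θ : Type*} (lo hi : Θ → α → Prop) (B : Finset α) (S : Finset Θ) : Prop :=
  ∀ T ⊆ S, ∃ f ∈ B, (∀ θ ∈ S, θ ∉ T → lo θ f) ∧ ∀ θ ∈ T, hi θ f

noncomputable def spoly {α Θ : Type*} (lo hi : Θ → α → Prop) (U : Finset Θ) (w : Θ → ℝ)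
    (B : Finset α) (x : ℝ) : ℝ :=
  ∑ S ∈ U.powerset.filter (Shat lo hi B), (∏ θ ∈ S, w θ) * x ^ S.card

noncomputable def sinter {α Θ : Type*} (lo hi : Θ → α → Prop) (U : Finset Θ) (w : Θ → ℝ)
    (B C : Finset α) (x : ℝ) : ℝ :=
  ∑ S ∈ U.powerset.filter (fun S => Shat lo hi B S ∧ Shat lo hi C S),
    (∏ θ ∈ S, w θ) * x ^ S.card

theorem Shat.mono {α Θ : Type*} {lo hi : Θ → α → Prop} {B C : Finset α} {S : Finset Θ}
    (h : Shat lo hi B S) (hBC : B ⊆ C) : Shat lo hi C S := by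
  intro T hT
  obtain ⟨f, hf, h1, h2⟩ := h T hT
  exact ⟨f, hBC hf, h1, h2⟩

theorem spoly_add_le {α Θ : Type*} {lo hi : Θ → α → Prop} {U : Finset Θ} {w : Θ → ℝ}
    (hw : ∀ θ, 0 ≤ w θ) {A B C : Finset α} (hB : B ⊆ A) (hC : C ⊆ A) {x : ℝ} (hx : 0 ≤ x) :
    spoly lo hi U w B x + spoly lo hi U w C x ≤
      spoly lo hi U w A x + sinter lo hi U w B C x := by
  unfold spoly sinter
  rw [filter_and, ← sum_union_inter]
  refine add_le_add_left (sum_le_sum_of_subset_of_nonneg ?_ ?_) _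
  · intro S hS
    simp only [mem_union, mem_filter] at hS ⊢
    rcases hS with h | h
    · exact ⟨h.1, h.2.mono hB⟩
    · exact ⟨h.1, h.2.mono hC⟩
  · intro S _ _
    have : 0 ≤ ∏ θ ∈ S, w θ := prod_nonneg fun θ _ => hw θ
    positivity

theorem one_le_spoly {α Θ : Type*} {lo hi : Θ → α → Prop} {U : Finset Θ} {w : Θ → ℝ}
    (hw : ∀ θ, 0 ≤ w θ) {A : Finset α} (hA : A.Nonempty) {x : ℝ} (hx : 0 ≤ x) :
    1 ≤ spoly lo hi U w A x := by
  unfold spoly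
  have hm : (∅ : Finset Θ) ∈ U.powerset.filter (Shat lo hi A) := by
    simp only [mem_filter, empty_mem_powerset, true_and]
    intro T hT
    obtain ⟨f, hf⟩ := hA
    have : T = ∅ := subset_empty.1 hT
    subst this
    exact ⟨f, hf, by simp, by simp⟩
  have := single_le_sum (f := fun S : Finset Θ => (∏ θ ∈ S, w θ) * x ^ S.card)
    (fun S _ => by
      have : 0 ≤ ∏ θ ∈ S, w θ := prod_nonneg fun θ _ => hw θ
      positivity) hm
  simpa using this

theorem spoly_hasDeriv {α Θ : Type*} (lo hi : Θ → α → Prop) (U : Finset Θ) (w : Θ → ℝ)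
    (A : Finset α) (x : ℝ) : HasDerivAt (spoly lo hi U w A)
      (∑ S ∈ U.powerset.filter (Shat lo hi A), (∏ θ ∈ S, w θ) * (S.card * x ^ (S.card - 1))) x := by
  unfold spoly
  apply HasDerivAt.fun_sum
  intro S _
  exact (hasDerivAt_pow _ _).const_mul _

theorem le_deriv {α Θ : Type*} {lo hi : Θ → α → Prop} (hd : ∀ θ f, lo θ f → hi θ f → False)
    {U : Finset Θ} {w : Θ → ℝ}
    (hw : ∀ θ, 0 ≤ w θ) {A : Finset α} {x : ℝ} (hx : 0 ≤ x) :
    ∑ θ ∈ U, w θ * sinter lo hi U w (A.filter (lo θ)) (A.filter (hi θ)) x ≤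
    ∑ S ∈ U.powerset.filter (Shat lo hi A), (∏ θ ∈ S, w θ) * (S.card * x ^ (S.card - 1)) := by
  have e : ∀ S : Finset Θ, (∏ θ ∈ S, w θ) * (S.card * x ^ (S.card - 1)) =
      ∑ θ ∈ S, w θ * ((∏ θ ∈ S.erase θ, w θ) * x ^ (S.erase θ).card) := by
    intro S
    rw [sum_congr rfl (g := fun _ => (∏ θ ∈ S, w θ) * x ^ (S.card - 1))]
    · simp; ring
    · intro θ hθ
      rw [card_erase_of_mem hθ, ← mul_prod_erase S w hθ]; ring
  simp only [e]
  unfold sinter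
  simp only [mul_sum]
  rw [sum_sigma', sum_sigma']
  have hnot : ∀ θ S, Shat lo hi (A.filter (lo θ)) S → θ ∉ S := by
    intro θ S hS hθ
    obtain ⟨f, hf, _, h2⟩ := hS {θ} (singleton_subset_iff.2 hθ)
    exact hd θ f (mem_filter.1 hf).2 (h2 θ (mem_singleton_self _))
  set F : (Σ _ : Finset Θ, Θ) → ℝ :=
    fun p => w p.2 * ((∏ θ ∈ p.1.erase p.2, w θ) * x ^ (p.1.erase p.2).card) with hF
  set G : (Σ _ : Θ, Finset Θ) → (Σ _ : Finset Θ, Θ) := fun p => ⟨insert p.1 p.2, p.1⟩ with hG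
  have hinj : Set.InjOn G
    (U.sigma fun θ => U.powerset.filter
      (fun S => Shat lo hi (A.filter (lo θ)) S ∧ Shat lo hi (A.filter (hi θ)) S)) := by
    rintro ⟨θ, S⟩ hp ⟨θ', S'⟩ hp' he
    simp only [coe_sigma, Set.mem_sigma_iff, mem_coe, mem_filter] at hp hp'
    simp only [hG, Sigma.mk.injEq, heq_eq_eq] at he
    obtain ⟨h1, rfl⟩ := he
    have a := hnot _ _ hp.2.2.1
    have b := hnot _ _ hp'.2.2.1
    have : S = S' := by rw [← erase_insert a, ← erase_insert b, h1]
    rw [this]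
  rw [sum_congr rfl (g := fun p => F (G p)), ← sum_image hinj]
  · apply sum_le_sum_of_subset_of_nonneg
    · intro q hq
      obtain ⟨⟨θ, S⟩, hp, rfl⟩ := mem_image.1 hq
      simp only [mem_sigma, mem_filter, mem_powerset] at hp
      simp only [hG, mem_sigma, mem_filter, mem_powerset, mem_insert_self, and_true]
      refine ⟨insert_subset hp.1 hp.2.1, ?_⟩
      have hθ := hnot _ _ hp.2.2.1
      intro T hT
      by_cases hθT : θ ∈ T
      · obtain ⟨f, hf, h1, h2⟩ := hp.2.2.2 (T.erase θ) (by
          intro a ha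
          have := hT (mem_of_mem_erase ha)
          rcases mem_insert.1 this with h | h
          · exact absurd h (ne_of_mem_erase ha)
          · exact h)
        refine ⟨f, (mem_filter.1 hf).1, ?_, ?_⟩
        · intro a ha haT
          rcases mem_insert.1 ha with h | h
          · subst h; exact absurd hθT haT
          · exact h1 a h (fun h' => haT (mem_of_mem_erase h'))
        · intro a ha
          by_cases h : a = θ
          · subst h; exact (mem_filter.1 hf).2
          · exact h2 a (mem_erase.2 ⟨h, ha⟩)
      · obtain ⟨f, hf, h1, h2⟩ := hp.2.2.1 T (by
          intro a ha
          rcases mem_insert.1 (hT ha) with h | h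
          · subst h; exact absurd ha hθT
          · exact h)
        refine ⟨f, (mem_filter.1 hf).1, ?_, h2⟩
        intro a ha haT
        rcases mem_insert.1 ha with h | h
        · subst h; exact (mem_filter.1 hf).2
        · exact h1 a h haT
    · intro q _ _
      have : 0 ≤ ∏ θ ∈ q.1.erase q.2, w θ := prod_nonneg fun θ _ => hw θ
      have := hw q.2
      positivity
  · rintro ⟨θ, S⟩ hp
    simp only [mem_sigma, mem_filter] at hp
    simp only [hF, hG]
    rw [erase_insert (hnot _ _ hp.2.2.1)]

theorem barrier {φ φ' : ℝ → ℝ} {L : ℝ} (hφ : ∀ x, HasDerivAt φ (φ' x) x) (h0 : 0 ≤ φ 0)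
    (h : ∀ x, 0 ≤ x → x ≤ L → φ x < 0 → 0 ≤ φ' x) : ∀ x, 0 ≤ x → x ≤ L → 0 ≤ φ x := by
  intro x hx hxL
  by_contra! hneg
  have hc : Continuous φ := continuous_iff_continuousAt.2 fun x => (hφ x).continuousAt
  set s := {y | y ∈ Set.Icc 0 x ∧ 0 ≤ φ y} with hs
  have hcl : IsCompact s := by
    apply IsCompact.inter_right isCompact_Icc
    exact isClosed_le continuous_const hc
  have hne : s.Nonempty := ⟨0, ⟨le_refl _, hx⟩, h0⟩
  have hmem := hcl.sSup_mem hne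
  set y := sSup s
  have hyx : y ≤ x := hmem.1.2
  have hlt : ∀ z, y < z → z ≤ x → φ z < 0 := by
    intro z hz hzx
    by_contra! h'
    have : z ≤ y := le_csSup hcl.bddAbove ⟨⟨hmem.1.1.trans hz.le, hzx⟩, h'⟩
    linarith
  have hm : MonotoneOn φ (Set.Icc y x) := by
    apply monotoneOn_of_deriv_nonneg (convex_Icc y x) hc.continuousOn
    · intro z _; exact (hφ z).differentiableAt.differentiableWithinAt
    · intro z hz
      rw [interior_Icc] at hz
      rw [(hφ z).deriv]
      exact h z (hmem.1.1.trans hz.1.le) (hz.2.le.trans hxL) (hlt z hz.1 hz.2.le)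
  have := hm ⟨le_refl _, hyx⟩ ⟨hyx, le_refl _⟩ hyx
  linarith [hmem.2]


theorem growth {α Θ : Type*} {lo hi : Θ → α → Prop} (hd : ∀ θ f, lo θ f → hi θ f → False)
    {U : Finset Θ} {w : Θ → ℝ} (hw : ∀ θ, 0 ≤ w θ) {A : Finset α} {δ D : ℝ} (hδ : 0 < δ)
    (hD : 0 < D) (hlog : Real.log A.card ≤ D)
    (hgain : ∀ B ⊆ A, 2 ≤ B.card → δ ≤ ∑ θ ∈ U, w θ *
      max 0 (√((B.filter (lo θ)).card / B.card) + √((B.filter (hi θ)).card / B.card) - 1)) :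
    ∀ N : ℕ, ∀ B ⊆ A, B.card = N → B.Nonempty → ∀ x, 0 ≤ x → x ≤ D / (2 * δ) →
      (B.card : ℝ) ^ (δ * x / D) ≤ spoly lo hi U w B x := by
  intro N
  induction N using Nat.strong_induction_on with
  | _ N ih =>
  intro B hBA hBN hB x hx0 hxL
  rcases Nat.lt_or_ge B.card 2 with h1 | h2
  · have : B.card = 1 := by have := hB.card_pos; omega
    rw [this]; simpa using one_le_spoly hw hB hx0
  have hNpos : (0 : ℝ) < B.card := by exact_mod_cast hB.card_pos
  set N' : ℝ := (B.card : ℝ) with hN'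
  have hder : ∀ y, HasDerivAt (fun y => spoly lo hi U w B y - N' ^ (δ * y / D)) 
      ((∑ S ∈ U.powerset.filter (Shat lo hi B), (∏ θ ∈ S, w θ) * (S.card * y ^ (S.card - 1)))
        - Real.log N' * (δ / D) * N' ^ (δ * y / D)) y := by
    intro y
    apply (spoly_hasDeriv lo hi U w B y).sub
    have : HasDerivAt (fun y : ℝ => δ * y / D) (δ / D) y := by
      simpa using ((hasDerivAt_id y).const_mul δ).div_const D
    exact this.const_rpow hNpos
  suffices h : 0 ≤ spoly lo hi U w B x - N' ^ (δ * x / D) by linarith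
  refine barrier (L := D / (2 * δ)) hder ?_ ?_ x hx0 hxL
  · simpa using one_le_spoly hw hB le_rfl
  intro y hy0 hyL hneg
  set p := δ * y / D with hp
  have hp0 : 0 ≤ p := by positivity
  have hp1 : p ≤ 1 / 2 := by
    rw [hp, div_le_iff₀ hD]
    rw [le_div_iff₀ (by positivity)] at hyL
    linarith
  have hNp : 0 < N' ^ p := Real.rpow_pos_of_pos hNpos p
  have hlogN : Real.log N' ≤ D := by
    refine le_trans (Real.log_le_log hNpos ?_) hlog
    rw [hN']; exact_mod_cast card_le_card hBA
  have key := le_deriv hd hw (A := B) (U := U) hy0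
  have hterm : ∀ θ ∈ U, w θ * (N' ^ p * max 0 (√((B.filter (lo θ)).card / N') +
      √((B.filter (hi θ)).card / N') - 1)) ≤
      w θ * sinter lo hi U w (B.filter (lo θ)) (B.filter (hi θ)) y := by
    intro θ _
    apply mul_le_mul_of_nonneg_left _ (hw θ)
    have hs0 : 0 ≤ sinter lo hi U w (B.filter (lo θ)) (B.filter (hi θ)) y := by
      unfold sinter
      apply sum_nonneg
      intro S _
      have : 0 ≤ ∏ θ ∈ S, w θ := prod_nonneg fun θ _ => hw θ
      positivity
    rcases le_total (√((B.filter (lo θ)).card / N') + √((B.filter (hi θ)).card / N') - 1) 0 with h | h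
    · rw [max_eq_left h]; simpa using hs0
    rw [max_eq_right h]
    have hle1 : ∀ P : α → Prop, ((B.filter P).card : ℝ) / N' ≤ 1 := by
      intro P
      rw [div_le_one hNpos]
      rw [hN']; exact_mod_cast card_filter_le _ _
    by_cases he1 : (B.filter (lo θ)).Nonempty
    swap
    · rw [not_nonempty_iff_eq_empty.1 he1] at h ⊢
      have : √((B.filter (hi θ)).card / N') ≤ 1 := Real.sqrt_le_one.2 (hle1 _)
      simp only [card_empty, Nat.cast_zero, zero_div, Real.sqrt_zero] at h ⊢
      have h' : 0 + √((B.filter (hi θ)).card / N') - 1 = 0 := by linarith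
      rw [h', mul_zero]
      unfold sinter
      apply sum_nonneg
      intro S _
      have : 0 ≤ ∏ θ ∈ S, w θ := prod_nonneg fun θ _ => hw θ
      positivity
    by_cases he2 : (B.filter (hi θ)).Nonempty
    swap
    · rw [not_nonempty_iff_eq_empty.1 he2] at h ⊢
      have : √((B.filter (lo θ)).card / N') ≤ 1 := Real.sqrt_le_one.2 (hle1 _)
      simp only [card_empty, Nat.cast_zero, zero_div, Real.sqrt_zero] at h ⊢
      have h' : √((B.filter (lo θ)).card / N') + 0 - 1 = 0 := by linarith
      rw [h', mul_zero]
      unfold sinter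
      apply sum_nonneg
      intro S _
      have : 0 ≤ ∏ θ ∈ S, w θ := prod_nonneg fun θ _ => hw θ
      positivity
    have hlt1 : (B.filter (lo θ)).card < N := by
      rw [← hBN]
      apply card_lt_card
      rw [filter_ssubset]
      obtain ⟨f, hf⟩ := he2
      exact ⟨f, (mem_filter.1 hf).1, fun h' => hd θ f h' (mem_filter.1 hf).2⟩
    have hlt2 : (B.filter (hi θ)).card < N := by
      rw [← hBN]
      apply card_lt_card
      rw [filter_ssubset]
      obtain ⟨f, hf⟩ := he1
      exact ⟨f, (mem_filter.1 hf).1, fun h' => hd θ f (mem_filter.1 hf).2 h'⟩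
    have i1 := ih _ hlt1 _ ((filter_subset _ _).trans hBA) rfl he1 y hy0 hyL
    have i2 := ih _ hlt2 _ ((filter_subset _ _).trans hBA) rfl he2 y hy0 hyL
    have i3 := spoly_add_le (lo := lo) (hi := hi) (U := U) hw (filter_subset (lo θ) B)
      (filter_subset (hi θ) B) hy0
    have cmp : ∀ P : α → Prop, (B.filter P).Nonempty →
        N' ^ p * √((B.filter P).card / N') ≤ ((B.filter P).card : ℝ) ^ p := by
      intro P hP
      have hpos : (0 : ℝ) < (B.filter P).card := by exact_mod_cast hP.card_pos
      have e : ((B.filter P).card : ℝ) ^ p = N' ^ p * (((B.filter P).card : ℝ) / N') ^ p := by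
        rw [← Real.mul_rpow hNpos.le (by positivity), mul_div_cancel₀ _ hNpos.ne']
      rw [e, Real.sqrt_eq_rpow]
      exact mul_le_mul_of_nonneg_left
        (Real.rpow_le_rpow_of_exponent_ge (by positivity) (hle1 P) hp1) hNp.le
    have c1 := cmp _ he1
    have c2 := cmp _ he2
    have : spoly lo hi U w B y < N' ^ p := by linarith
    have i1' : ((B.filter (lo θ)).card : ℝ) ^ p ≤ _ := i1
    have i2' : ((B.filter (hi θ)).card : ℝ) ^ p ≤ _ := i2
    linarith
  have hsum := sum_le_sum hterm
  have hg := hgain B hBA h2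
  have e2 : ∑ θ ∈ U, w θ * (N' ^ p * max 0 (√((B.filter (lo θ)).card / N') +
      √((B.filter (hi θ)).card / N') - 1)) = N' ^ p * ∑ θ ∈ U, w θ * max 0 (√((B.filter (lo θ)).card / N') +
      √((B.filter (hi θ)).card / N') - 1) := by
    rw [mul_sum]; apply sum_congr rfl; intros; ring
  rw [e2] at hsum
  have h5 : N' ^ p * δ ≤ N' ^ p * ∑ θ ∈ U, w θ * max 0 (√((B.filter (lo θ)).card / N') +
      √((B.filter (hi θ)).card / N') - 1) := mul_le_mul_of_nonneg_left hg hNp.le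
  have h6 : Real.log N' * (δ / D) * N' ^ p ≤ N' ^ p * δ := by
    have : Real.log N' * (δ / D) ≤ δ := by
      rw [mul_div_assoc', div_le_iff₀ hD]
      nlinarith
    nlinarith
  linarith

end ode

section onedim
open Finset Classical

noncomputable def pr {α : Type*} (B : Finset α) (P : α → Prop) : ℝ :=
  ((B.filter P).card : ℝ) / B.card

theorem pr_nonneg {α : Type*} (B : Finset α) (P : α → Prop) : 0 ≤ pr B P := by
  unfold pr; positivity

theorem pr_mono {α : Type*} (B : Finset α) {P Q : α → Prop} (h : ∀ f ∈ B, P f → Q f) :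
    pr B P ≤ pr B Q := by
  unfold pr
  refine div_le_div_of_nonneg_right ?_ (Nat.cast_nonneg _)
  norm_cast
  apply card_le_card
  intro f hf
  rw [mem_filter] at hf ⊢
  exact ⟨hf.1, h f hf.1 hf.2⟩

theorem pr_compl {α : Type*} {B : Finset α} (hB : B.Nonempty) (P : α → Prop) :
    pr B P + pr B (fun f => ¬ P f) = 1 := by
  unfold pr
  have : (0 : ℝ) < B.card := by exact_mod_cast hB.card_pos
  rw [← add_div, div_eq_one_iff_eq this.ne']
  norm_cast
  convert card_filter_add_card_filter_not (s := B) P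

theorem pr_mul {α : Type*} {B : Finset α} (hB : B.Nonempty) (P : α → Prop) :
    ∑ f ∈ B, (if P f then (1 : ℝ) else 0) = pr B P * B.card := by
  unfold pr
  have : (0 : ℝ) < B.card := by exact_mod_cast hB.card_pos
  rw [div_mul_cancel₀ _ this.ne']
  simp

theorem sqrt_step {q r η : ℝ} (c d : ℝ) (hr : 0 ≤ r) (h : √(1 - q) + √r ≤ 1 + η)
    (_hc0 : 0 ≤ c) (hc : c ^ 2 ≤ 1 - q) (hd : (1 + η - c) ^ 2 ≤ d) : r ≤ d := by
  have h1 : c ≤ √(1 - q) := Real.le_sqrt_of_sq_le hc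
  have h2 := Real.sqrt_nonneg r
  have h3 : √r ≤ 1 + η - c := by linarith
  have h4 := Real.sq_sqrt hr
  nlinarith

theorem tail_dyadic (K : ℕ) (y : ℝ) (hy : 32 < y) (hK : y ≤ 32 * 2 ^ K) :
    y ^ 2 ≤ ∑ k ∈ range K, 4096 * 4 ^ k * (if 32 * 2 ^ k < y then (1 : ℝ) else 0) := by
  induction K with
  | zero => norm_num at hK; linarith
  | succ K ih =>
    rw [sum_range_succ]
    rcases le_or_gt y (32 * 2 ^ K) with h | h
    · have := ih h
      rw [if_neg (not_lt.2 h)]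
      linarith
    · rw [if_pos h]
      have h1 : 0 ≤ ∑ k ∈ range K, 4096 * 4 ^ k * (if 32 * 2 ^ k < y then (1 : ℝ) else 0) := by
        apply sum_nonneg; intro k _; split_ifs <;> positivity
      have h2 : y ^ 2 ≤ (32 * 2 ^ (K + 1)) ^ 2 := by
        apply pow_le_pow_left₀ (by linarith) hK
      have h3 : (32 * 2 ^ (K + 1) : ℝ) ^ 2 = 4096 * 4 ^ K := by
        have : (4 : ℝ) ^ K = (2 ^ K) ^ 2 := by rw [← pow_mul, mul_comm, pow_mul]; norm_num
        rw [this]; ring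
      linarith

theorem side {α : Type*} {B : Finset α} (hB : B.Nonempty) (Y : α → ℝ)
    (hyp : ∀ (k : ℕ) (h : ℤ), |h| ≤ 2100 →
      √(pr B (fun f => Y f ≤ 1 / 64 * h * 2 ^ k)) + √(pr B (fun f => 1 / 64 * (h + 1) * 2 ^ k ≤ Y f))
        ≤ 1 + (1 / 10 ^ 9) / 8 ^ k)
    (h0 : ℤ) (hh : |h0| ≤ 1100) (hmed : pr B (fun f => 1 / 64 * h0 < Y f) ≤ 1 / 2) :
    ∑ f ∈ B, (max 0 (Y f - 1 / 64 * (h0 + 4))) ^ 2 ≤ (1 / 1000) * B.card := by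
  have hN : (0 : ℝ) < B.card := by exact_mod_cast hB.card_pos
  have compl : ∀ z : ℝ, pr B (fun f => Y f ≤ z) = 1 - pr B (fun f => z < Y f) := by
    intro z
    have := pr_compl hB (fun f => Y f ≤ z)
    simp only [not_le] at this
    linarith
  have step : ∀ h : ℤ, |h| ≤ 2100 →
      √(1 - pr B (fun f => 1 / 64 * (h : ℝ) < Y f)) + √(pr B (fun f => 1 / 64 * ((h + 1 : ℤ) : ℝ) < Y f))
      ≤ 1 + 1 / 10 ^ 9 := by
    intro h hh
    have := hyp 0 h hh
    simp only [pow_zero, mul_one, div_one] at this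
    rw [compl] at this
    have h2 : √(pr B (fun f => 1 / 64 * ((h + 1 : ℤ) : ℝ) < Y f)) ≤
      √(pr B (fun f => 1 / 64 * ((h : ℝ) + 1) ≤ Y f)) := by
      apply Real.sqrt_le_sqrt
      apply pr_mono
      intro f _ hf
      push_cast at hf
      exact hf.le
    linarith
  rw [abs_le] at hh
  have q1 : pr B (fun f => 1 / 64 * ((h0 + 1 : ℤ) : ℝ) < Y f) ≤ 0.0859 :=
    sqrt_step 0.7071 0.0859 (pr_nonneg _ _) (step h0 (abs_le.2 (by omega))) (by norm_num)
      (by norm_num; linarith) (by norm_num)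
  have q2 : pr B (fun f => 1 / 64 * ((h0 + 1 + 1 : ℤ) : ℝ) < Y f) ≤ 0.00195 :=
    sqrt_step 0.956 0.00195 (pr_nonneg _ _) (step (h0 + 1) (abs_le.2 (by omega))) (by norm_num)
      (by norm_num at q1 ⊢; linarith) (by norm_num)
  have q3 : pr B (fun f => 1 / 64 * ((h0 + 1 + 1 + 1 : ℤ) : ℝ) < Y f) ≤ 0.0000041 :=
    sqrt_step 0.998 0.0000041 (pr_nonneg _ _) (step (h0 + 1 + 1) (abs_le.2 (by omega))) (by norm_num)
      (by norm_num at q2 ⊢; linarith) (by norm_num)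
  have q4 : pr B (fun f => 1 / 64 * ((h0 + 1 + 1 + 1 + 1 : ℤ) : ℝ) < Y f) ≤ 1 / 10 ^ 8 :=
    sqrt_step 0.99999 (1 / 10 ^ 8) (pr_nonneg _ _) (step (h0 + 1 + 1 + 1) (abs_le.2 (by omega)))
      (by norm_num) (by norm_num at q3 ⊢; linarith) (by norm_num)
  have hh' : (-1100 : ℝ) ≤ h0 ∧ (h0 : ℝ) ≤ 1100 := by
    constructor
    · exact_mod_cast hh.1
    · exact_mod_cast hh.2
  have hQ : ∀ k : ℕ, pr B (fun f => 32 * 2 ^ k < Y f) ≤ (1 / 10 ^ 8) / 8 ^ k := by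
    intro k
    induction k with
    | zero =>
      refine le_trans (pr_mono B ?_) (by simpa using q4)
      intro f _ hf
      push_cast
      norm_num at hf
      linarith
    | succ k ih =>
      have h1 := hyp k 2048 (by norm_num)
      have e : (1 / 64 * ((2048 : ℤ) : ℝ) * 2 ^ k) = 32 * 2 ^ k := by push_cast; ring
      rw [e, compl] at h1
      have h2 : √(pr B (fun f => 32 * 2 ^ (k + 1) < Y f)) ≤
        √(pr B (fun f => 1 / 64 * (((2048 : ℤ) : ℝ) + 1) * 2 ^ k ≤ Y f)) := by
        apply Real.sqrt_le_sqrt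
        apply pr_mono
        intro f _ hf
        have : (0 : ℝ) < 2 ^ k := by positivity
        rw [pow_succ] at hf
        push_cast
        linarith
      have h8 : (1 : ℝ) ≤ 8 ^ k := one_le_pow₀ (by norm_num)
      have hinv : (0 : ℝ) < 1 / 8 ^ k := by positivity
      have hinv1 : (1 : ℝ) / 8 ^ k ≤ 1 := by rw [div_le_one (by positivity)]; exact h8
      set v : ℝ := 1 / 8 ^ k with hv
      have ih' : pr B (fun f => 32 * 2 ^ k < Y f) ≤ (1 / 10 ^ 8) * v := by
        rw [hv]; convert ih using 1; ring
      have e3 : (1 / 10 ^ 9 : ℝ) / 8 ^ k = (1 / 10 ^ 9) * v := by rw [hv]; ring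
      have e4 : (1 / 10 ^ 8 : ℝ) / 8 ^ (k + 1) = (1 / 10 ^ 8) * v / 8 := by
        rw [hv, pow_succ]; field_simp; try ring
      rw [e3] at h1
      rw [e4]
      have h0' := pr_nonneg B (fun f => 32 * 2 ^ k < Y f)
      refine sqrt_step (1 - (1 / 10 ^ 8) * v) _ (pr_nonneg _ _) (le_trans (add_le_add_right h2 _) h1)
        ?_ ?_ ?_
      · nlinarith
      · nlinarith
      · nlinarith
  obtain ⟨K, hK⟩ : ∃ K : ℕ, ∀ f ∈ B, Y f ≤ 32 * 2 ^ K := by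
    obtain ⟨K, hK⟩ := pow_unbounded_of_one_lt (∑ f ∈ B, |Y f|) (one_lt_two)
    refine ⟨K, fun f hf => ?_⟩
    have h1 : |Y f| ≤ ∑ f ∈ B, |Y f| := single_le_sum (f := fun f => |Y f|)
      (fun _ _ => abs_nonneg _) hf
    have h2 := le_abs_self (Y f)
    have : (0 : ℝ) < 2 ^ K := by positivity
    linarith
  have point : ∀ f ∈ B, (max 0 (Y f - 1 / 64 * (h0 + 4))) ^ 2 ≤
      2500 * (if 1 / 64 * ((h0 : ℝ) + 4) < Y f then (1 : ℝ) else 0) +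
      2.5 * ∑ k ∈ range K, 4096 * 4 ^ k * (if 32 * 2 ^ k < Y f then (1 : ℝ) else 0) := by
    intro f hf
    have hs : 0 ≤ ∑ k ∈ range K, 4096 * 4 ^ k * (if 32 * 2 ^ k < Y f then (1 : ℝ) else 0) := by
      apply sum_nonneg; intro k _; split_ifs <;> positivity
    rcases le_or_gt (Y f) (1 / 64 * (h0 + 4)) with h | h
    · rw [max_eq_left (by linarith), if_neg (not_lt.2 h)]
      linarith
    · rw [max_eq_right (by linarith), if_pos h]
      rcases le_or_gt (Y f) 32 with h' | h'
      · nlinarith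
      · have := tail_dyadic K (Y f) h' (hK f hf)
        nlinarith
  refine (sum_le_sum point).trans ?_
  rw [sum_add_distrib, ← mul_sum, ← mul_sum, pr_mul hB, sum_comm]
  have e5 : ∑ k ∈ range K, ∑ f ∈ B, 4096 * 4 ^ k * (if 32 * 2 ^ k < Y f then (1 : ℝ) else 0) ≤
      8192 / 10 ^ 8 * B.card := by
    have : ∀ k ∈ range K, ∑ f ∈ B, 4096 * 4 ^ k * (if 32 * 2 ^ k < Y f then (1 : ℝ) else 0) ≤
        (4096 / 10 ^ 8 * B.card) * (1 / 2) ^ k := by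
      intro k _
      rw [← mul_sum, pr_mul hB]
      have := hQ k
      have e6 : (4096 / 10 ^ 8 * (B.card : ℝ)) * (1 / 2) ^ k =
          4096 * 4 ^ k * ((1 / 10 ^ 8) / 8 ^ k * B.card) := by
        have : (8 : ℝ) ^ k = 4 ^ k * 2 ^ k := by rw [← mul_pow]; norm_num
        rw [this, one_div, inv_pow]; field_simp
      rw [e6]
      gcongr
    refine (sum_le_sum this).trans ?_
    rw [← mul_sum]
    have h2 : ∑ k ∈ range K, (1 / 2 : ℝ) ^ k ≤ 2 := sum_geometric_two_le K
    nlinarith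
  have q4' : pr B (fun f => 1 / 64 * ((h0 : ℝ) + 4) < Y f) ≤ 1 / 10 ^ 8 := by
    refine le_trans (pr_mono B ?_) q4
    intro f _ hf
    push_cast
    linarith
  nlinarith

theorem unit_gain {α : Type*} {B : Finset α} (hB : B.Nonempty) (Y : α → ℝ)
    (h2 : ∑ f ∈ B, Y f ^ 2 ≤ 16 * B.card)
    (hW : (B.card : ℝ) ^ 2 / 8 ≤ ∑ f ∈ B, ∑ g ∈ B, (Y f - Y g) ^ 2) :
    ∃ (k : ℕ) (h : ℤ), |h| ≤ 3000 ∧ (1 / 10 ^ 9) / 8 ^ k <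
      √(pr B (fun f => Y f ≤ 1 / 64 * h * 2 ^ k)) + √(pr B (fun f => 1 / 64 * (h + 1) * 2 ^ k ≤ Y f))
        - 1 := by
  by_contra! hyp
  have hN : (0 : ℝ) < B.card := by exact_mod_cast hB.card_pos
  have cheb : pr B (fun f => 16 ≤ |Y f|) ≤ 1 / 16 := by
    have : ∑ f ∈ B, 256 * (if 16 ≤ |Y f| then (1 : ℝ) else 0) ≤ ∑ f ∈ B, Y f ^ 2 := by
      apply sum_le_sum
      intro f _
      split_ifs with h
      · rw [← sq_abs]; nlinarith
      · rw [mul_zero]; positivity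
    rw [← mul_sum, pr_mul hB] at this
    nlinarith
  obtain ⟨h0, hh0, hmin⟩ := Int.exists_least_of_bdd
    (P := fun h : ℤ => 1 / 2 ≤ pr B (fun f => Y f ≤ 1 / 64 * h)) ⟨-1025, by
      intro z hz
      by_contra! hlt
      have : pr B (fun f => Y f ≤ 1 / 64 * z) ≤ pr B (fun f => 16 ≤ |Y f|) := by
        apply pr_mono
        intro f _ hf
        have : (z : ℝ) ≤ -1025 := by exact_mod_cast hlt.le
        rw [le_abs]; right; linarith
      linarith⟩ ⟨1024, by
      have h1 := pr_compl hB (fun f => Y f ≤ 1 / 64 * (1024 : ℤ))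
      have h3 : pr B (fun f => ¬ (Y f ≤ 1 / 64 * (1024 : ℤ))) ≤ pr B (fun f => 16 ≤ |Y f|) := by
        apply pr_mono
        intro f _ hf
        rw [not_le] at hf
        norm_num at hf
        rw [le_abs]; left; linarith
      linarith⟩
  have hle : h0 ≤ 1024 := by
    apply hmin
    have h1 := pr_compl hB (fun f => Y f ≤ 1 / 64 * (1024 : ℤ))
    have h3 : pr B (fun f => ¬ (Y f ≤ 1 / 64 * (1024 : ℤ))) ≤ pr B (fun f => 16 ≤ |Y f|) := by
      apply pr_mono
      intro f _ hf
      rw [not_le] at hf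
      norm_num at hf
      rw [le_abs]; left; linarith
    linarith
  have hge : -1025 ≤ h0 := by
    by_contra! hlt
    have : pr B (fun f => Y f ≤ 1 / 64 * h0) ≤ pr B (fun f => 16 ≤ |Y f|) := by
      apply pr_mono
      intro f _ hf
      have : (h0 : ℝ) ≤ -1025 := by exact_mod_cast hlt.le
      rw [le_abs]; right; linarith
    linarith
  have s1 := side hB Y (fun k h hh => by have := hyp k h (by omega); linarith) h0
    (abs_le.2 (by omega)) (by
      have h1 := pr_compl hB (fun f => Y f ≤ 1 / 64 * h0)
      simp only [not_le] at h1
      linarith)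
  have s2 := side hB (fun f => - Y f) (fun k h hh => by
      have := hyp k (-h - 1) (by rw [abs_le] at hh ⊢; omega)
      have e1 : pr B (fun f => -Y f ≤ 1 / 64 * h * 2 ^ k) =
          pr B (fun f => 1 / 64 * (((-h - 1 : ℤ) : ℝ) + 1) * 2 ^ k ≤ Y f) := by
        apply le_antisymm <;> apply pr_mono <;> intro f _ hf <;> push_cast at * <;> linarith
      have e2 : pr B (fun f => 1 / 64 * (h + 1) * 2 ^ k ≤ -Y f) =
          pr B (fun f => Y f ≤ 1 / 64 * ((-h - 1 : ℤ) : ℝ) * 2 ^ k) := by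
        apply le_antisymm <;> apply pr_mono <;> intro f _ hf <;> push_cast at * <;> linarith
      rw [e1, e2]
      linarith) (-h0 + 1)
    (abs_le.2 (by omega)) (by
      by_contra! hcon
      have : h0 ≤ h0 - 1 := by
        apply hmin
        refine hcon.le.trans (pr_mono B ?_)
        intro f _ hf
        push_cast at *
        linarith
      omega)
  have point : ∀ f ∈ B, (Y f - 1 / 64 * h0) ^ 2 ≤ 75 / 4096 +
      3 * (max 0 (Y f - 1 / 64 * (h0 + 4))) ^ 2 +
      3 * (max 0 (-Y f - 1 / 64 * (((-h0 + 1 : ℤ) : ℝ) + 4))) ^ 2 := by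
    intro f _
    push_cast
    rcases le_total (Y f - 1 / 64 * (h0 + 4)) 0 with ha | ha <;>
    rcases le_total (-Y f - 1 / 64 * (-(h0 : ℝ) + 1 + 4)) 0 with hb | hb
    · rw [max_eq_left ha, max_eq_left hb]; nlinarith
    · rw [max_eq_left ha, max_eq_right hb]
      nlinarith [sq_nonneg (-Y f - 1 / 64 * (-(h0 : ℝ) + 1 + 4) - 5 / 64)]
    · rw [max_eq_right ha, max_eq_left hb]
      nlinarith [sq_nonneg (Y f - 1 / 64 * (h0 + 4) - 5 / 64)]
    · linarith
  have hs := sum_le_sum point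
  rw [sum_add_distrib, sum_add_distrib, ← mul_sum, ← mul_sum, sum_const, nsmul_eq_mul] at hs
  have hpair : ∑ f ∈ B, ∑ g ∈ B, (Y f - Y g) ^ 2 ≤
      4 * B.card * ∑ f ∈ B, (Y f - 1 / 64 * h0) ^ 2 := by
    have : ∀ f ∈ B, ∀ g ∈ B, (Y f - Y g) ^ 2 ≤
      2 * (Y f - 1 / 64 * h0) ^ 2 + 2 * (Y g - 1 / 64 * h0) ^ 2 := by
      intro f _ g _
      nlinarith [sq_nonneg ((Y f - 1 / 64 * h0) + (Y g - 1 / 64 * h0))]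
    refine (sum_le_sum fun f hf => sum_le_sum (this f hf)).trans ?_
    simp only [sum_add_distrib, ← mul_sum, sum_const, nsmul_eq_mul]
    linarith
  set M := ∑ f ∈ B, (Y f - 1 / 64 * h0) ^ 2
  have hM : M ≤ 0.0245 * B.card := by norm_num at s1 s2 hs ⊢; linarith
  nlinarith

end onedim

section core
open Finset Classical

theorem scaled_gain {α : Type*} {B : Finset α} (hB : B.Nonempty) (X : α → ℝ) (K : ℕ)
    (hK : ∀ f ∈ B, 2 * |X f| < 1 / 64 * 2 ^ K) :
    (1 / 10 ^ 9) * ((∑ f ∈ B, ∑ g ∈ B, (X f - X g) ^ 2) / (B.card : ℝ) ^ 2 - 1 / 8 -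
      (∑ f ∈ B, X f ^ 2) / B.card / 32) ≤
    ∑ k ∈ range K, ∑ h ∈ Icc (-3000 : ℤ) 3000, 8 ^ k * max 0
      (√(pr B (fun f => X f ≤ 1 / 64 * h * 2 ^ k)) +
        √(pr B (fun f => 1 / 64 * (h + 1) * 2 ^ k ≤ X f)) - 1) := by
  have hN : (0 : ℝ) < B.card := by exact_mod_cast hB.card_pos
  have hnn : ∀ k ∈ range K, 0 ≤ ∑ h ∈ Icc (-3000 : ℤ) 3000, (8 : ℝ) ^ k * max 0
      (√(pr B (fun f => X f ≤ 1 / 64 * h * 2 ^ k)) +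
        √(pr B (fun f => 1 / 64 * (h + 1) * 2 ^ k ≤ X f)) - 1) :=
    fun k _ => sum_nonneg fun h _ => mul_nonneg (pow_nonneg (by norm_num) _) (le_max_left _ _)
  set W := (∑ f ∈ B, ∑ g ∈ B, (X f - X g) ^ 2) / (B.card : ℝ) ^ 2 with hW
  set H := (∑ f ∈ B, X f ^ 2) / B.card with hH
  have hH0 : 0 ≤ H := by positivity
  rcases le_total (W - 1 / 8 - H / 32) 0 with hneg | hpos
  · refine le_trans ?_ (sum_nonneg hnn)
    nlinarith
  have hW1 : 1 ≤ 8 * W := by linarith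
  obtain ⟨j, hj1, hj2⟩ := exists_nat_pow_near hW1 (by norm_num : (1 : ℝ) < 4)
  have e4 : (4 : ℝ) ^ j = (2 ^ j) ^ 2 := by rw [← pow_mul, mul_comm, pow_mul]; norm_num
  have h2j : (0 : ℝ) < 2 ^ j := by positivity
  rw [pow_succ] at hj2
  have hWe : (∑ f ∈ B, ∑ g ∈ B, (X f - X g) ^ 2) = W * (B.card : ℝ) ^ 2 := by
    rw [hW]; field_simp
  have hHe : (∑ f ∈ B, X f ^ 2) = H * B.card := by rw [hH, div_mul_cancel₀ _ hN.ne']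
  obtain ⟨k, h, hh, hg⟩ := unit_gain hB (fun f => X f / 2 ^ j) (by
      simp only [div_pow]
      rw [← sum_div, hHe, ← e4, div_le_iff₀ (by positivity)]
      have : H ≤ 16 * 4 ^ j := by linarith
      nlinarith) (by
      simp only [← sub_div, div_pow]
      simp only [← sum_div]
      rw [hWe, ← e4, le_div_iff₀ (by positivity)]
      have : 0 < (B.card : ℝ) ^ 2 := pow_pos hN 2
      nlinarith)
  have ea : pr B (fun f => X f / 2 ^ j ≤ 1 / 64 * h * 2 ^ k) =
      pr B (fun f => X f ≤ 1 / 64 * h * 2 ^ (k + j)) := by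
    congr 1; ext f; rw [div_le_iff₀ h2j, pow_add, mul_assoc _ (2 ^ k)]
  have eb : pr B (fun f => 1 / 64 * (h + 1) * 2 ^ k ≤ X f / 2 ^ j) =
      pr B (fun f => 1 / 64 * (h + 1) * 2 ^ (k + j) ≤ X f) := by
    congr 1; ext f; rw [le_div_iff₀ h2j, pow_add, mul_assoc _ (2 ^ k)]
  rw [ea, eb] at hg
  have pr1 : ∀ P : α → Prop, √(pr B P) ≤ 1 := by
    intro P
    rw [Real.sqrt_le_one]
    have := pr_compl hB P
    have := pr_nonneg B (fun f => ¬ P f)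
    linarith
  have hd0 : (0 : ℝ) < (1 / 10 ^ 9) / 8 ^ k := by positivity
  have hkK : k + j < K := by
    by_contra! hcon
    have hp : (2 : ℝ) ^ K ≤ 2 ^ (k + j) := pow_le_pow_right₀ (by norm_num) hcon
    by_cases hex : ∃ f ∈ B, X f ≤ 1 / 64 * h * 2 ^ (k + j)
    · obtain ⟨f, hf, hfx⟩ := hex
      have : pr B (fun f => 1 / 64 * (h + 1) * 2 ^ (k + j) ≤ X f) = 0 := by
        unfold pr
        rw [div_eq_zero_iff]; left
        rw [Nat.cast_eq_zero, card_eq_zero, filter_eq_empty_iff]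
        intro f' hf' h'
        have := hK f hf
        have := hK f' hf'
        have := le_abs_self (X f')
        have := neg_abs_le (X f)
        linarith
      rw [this, Real.sqrt_zero] at hg
      have := pr1 (fun f => X f ≤ 1 / 64 * h * 2 ^ (k + j))
      linarith
    · push Not at hex
      have : pr B (fun f => X f ≤ 1 / 64 * h * 2 ^ (k + j)) = 0 := by
        unfold pr
        rw [div_eq_zero_iff]; left
        rw [Nat.cast_eq_zero, card_eq_zero, filter_eq_empty_iff]
        intro f' hf'
        exact not_le.2 (hex f' hf')
      rw [this, Real.sqrt_zero] at hg
      have := pr1 (fun f => 1 / 64 * (h + 1) * 2 ^ (k + j) ≤ X f)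
      linarith
  have l1 := single_le_sum hnn (mem_range.2 hkK)
  have l2 := single_le_sum (f := fun h : ℤ => (8 : ℝ) ^ (k + j) * max 0
      (√(pr B (fun f => X f ≤ 1 / 64 * h * 2 ^ (k + j))) +
        √(pr B (fun f => 1 / 64 * (h + 1) * 2 ^ (k + j) ≤ X f)) - 1))
      (fun h _ => mul_nonneg (pow_nonneg (by norm_num) _) (le_max_left _ _))
      (mem_Icc.2 (abs_le.1 hh))
  refine le_trans ?_ (l2.trans l1)
  have l3 := hg.le.trans (le_max_right 0 _)
  have l4 : (1 / 10 ^ 9 : ℝ) * 8 ^ j ≤ 8 ^ (k + j) * max 0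
      (√(pr B (fun f => X f ≤ 1 / 64 * h * 2 ^ (k + j))) +
        √(pr B (fun f => 1 / 64 * (h + 1) * 2 ^ (k + j) ≤ X f)) - 1) := by
    refine le_trans (le_of_eq ?_) (mul_le_mul_of_nonneg_left l3 (by positivity))
    rw [pow_add]; field_simp
  refine le_trans ?_ l4
  have : (4 : ℝ) ^ j ≤ 8 ^ j := by gcongr; norm_num
  apply mul_le_mul_of_nonneg_left _ (by norm_num)
  linarith

noncomputable def Bc : ℝ := 48008 * (4 * 10 ^ 9)

theorem Bc_ge : 16 ≤ Bc := by unfold Bc; norm_num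

theorem logBc_pos : 0 < Real.log Bc := Real.log_pos (by linarith [Bc_ge])

theorem sum_kk (K : ℕ) : ∑ k ∈ range K, ((k : ℝ) + 1) * (1 / 2) ^ k ≤ 4 := by
  have : ∑ k ∈ range K, ((k : ℝ) + 1) * (1 / 2) ^ k = 4 - (2 * K + 4) * (1 / 2) ^ K := by
    induction K with
    | zero => norm_num
    | succ K ih => rw [sum_range_succ, ih, pow_succ]; push_cast; ring
  rw [this]
  have : 0 ≤ (2 * (K : ℝ) + 4) * (1 / 2) ^ K := by positivity
  linarith

def loT {n : ℕ} (θ : Fin n × ℕ × ℤ) (f : Fin n → ℝ) : Prop := f θ.1 ≤ 1 / 64 * θ.2.2 * 2 ^ θ.2.1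
def hiT {n : ℕ} (θ : Fin n × ℕ × ℤ) (f : Fin n → ℝ) : Prop :=
  1 / 64 * (θ.2.2 + 1) * 2 ^ θ.2.1 ≤ f θ.1

theorem loT_hiT {n : ℕ} (θ : Fin n × ℕ × ℤ) (f : Fin n → ℝ) (h1 : loT θ f) (h2 : hiT θ f) :
    False := by
  unfold loT hiT at *
  have : (0 : ℝ) < 2 ^ θ.2.1 := by positivity
  nlinarith

theorem shat_shatters {n : ℕ} {A : Finset (Fin n → ℝ)} {S : Finset (Fin n × ℕ × ℤ)}
    (h : Shat loT hiT A S) (k : ℕ) :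
    ∃ σ : Finset (Fin n), Shatters (A : Set (Fin n → ℝ)) (1 / 64 * 2 ^ k) σ ∧
      (S.filter (fun θ => θ.2.1 = k)).card = σ.card := by
  have hlt : ∀ θ ∈ S, ∀ θ' ∈ S, θ ≠ θ' → θ.1 = θ'.1 →
      (1 / 64 * (θ.2.2 : ℝ) * 2 ^ θ.2.1 ≤ 1 / 64 * θ'.2.2 * 2 ^ θ'.2.1) → False := by
    intro θ hθ θ' hθ' hne hx hle
    obtain ⟨f, _, h1, h2⟩ := h {θ'} (singleton_subset_iff.2 hθ')
    have a := h1 θ hθ (by simpa using hne)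
    have b := h2 θ' (mem_singleton_self _)
    unfold loT at a
    unfold hiT at b
    rw [hx] at a
    have : (0 : ℝ) < 2 ^ θ'.2.1 := by positivity
    nlinarith
  have hinj : ∀ θ ∈ S, ∀ θ' ∈ S, θ.1 = θ'.1 → θ = θ' := by
    intro θ hθ θ' hθ' hx
    by_contra hne
    rcases le_total (1 / 64 * (θ.2.2 : ℝ) * 2 ^ θ.2.1) (1 / 64 * θ'.2.2 * 2 ^ θ'.2.1) with hle | hle
    · exact hlt θ hθ θ' hθ' hne hx hle
    · exact hlt θ' hθ' θ hθ (Ne.symm hne) hx.symm hle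
  refine ⟨(S.filter (fun θ => θ.2.1 = k)).image Prod.fst, ?_, ?_⟩
  · refine ⟨fun x => if hx : ∃ θ ∈ S, θ.1 = x then
      1 / 64 * (hx.choose.2.2 : ℝ) * 2 ^ hx.choose.2.1 else 0, ?_⟩
    have hval : ∀ θ ∈ S, (if hx : ∃ θ' ∈ S, θ'.1 = θ.1 then
      1 / 64 * (hx.choose.2.2 : ℝ) * 2 ^ hx.choose.2.1 else 0) = 1 / 64 * (θ.2.2 : ℝ) * 2 ^ θ.2.1 := by
      intro θ hθ
      have hx : ∃ θ' ∈ S, θ'.1 = θ.1 := ⟨θ, hθ, rfl⟩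
      rw [dif_pos hx]
      have := hinj _ hx.choose_spec.1 θ hθ hx.choose_spec.2
      rw [this]
    intro τ hτ
    obtain ⟨f, hf, h1, h2⟩ := h (S.filter (fun θ => θ.1 ∈ τ)) (filter_subset _ _)
    refine ⟨f, hf, ?_, ?_⟩
    · intro x hx hxτ
      obtain ⟨θ, hθ, rfl⟩ := mem_image.1 hx
      have hθS := (mem_filter.1 hθ).1
      refine le_of_le_of_eq ?_ (hval θ hθS).symm
      exact h1 θ hθS (fun h' => hxτ (mem_filter.1 h').2)
    · intro x hx
      obtain ⟨θ, hθ, rfl⟩ := mem_image.1 (hτ hx)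
      have hθS := (mem_filter.1 hθ).1
      have hk := (mem_filter.1 hθ).2
      refine le_trans (le_of_eq (congrArg (· + (1 / 64 * 2 ^ k : ℝ)) (hval θ hθS))) ?_
      beta_reduce
      have := h2 θ (mem_filter.2 ⟨hθS, hx⟩)
      unfold hiT at this
      rw [hk] at this ⊢
      linarith
  · rw [card_image_of_injOn]
    intro θ hθ θ' hθ' hx
    exact hinj θ (mem_filter.1 hθ).1 θ' (mem_filter.1 hθ').1 hx

noncomputable def wT {n : ℕ} (θ : Fin n × ℕ × ℤ) : ℝ := 8 ^ θ.2.1 / n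

theorem spoly_upper {n : ℕ} (hn : 0 < n) {A : Finset (Fin n → ℝ)} {D : ℝ} (hD : 0 < D) (K : ℕ)
    (hsh : ∀ (k : ℕ) (σ : Finset (Fin n)), Shatters (A : Set (Fin n → ℝ)) (1 / 64 * 2 ^ k) σ →
      (σ.card : ℝ) < 1 / (32 * Real.log Bc) * (1 / 2) ^ k * D) :
    spoly loT hiT (univ ×ˢ (range K ×ˢ Icc (-3000 : ℤ) 3000)) wT A (D / (2 * (1 / (4 * 10 ^ 9)))) ≤
      Real.exp (D / 4) := by
  set L : ℝ := D / (2 * (1 / (4 * 10 ^ 9))) with hL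
  have hL0 : 0 < L := by positivity
  have hn' : (0 : ℝ) < n := by exact_mod_cast hn
  set U : Finset (Fin n × ℕ × ℤ) := univ ×ˢ (range K ×ˢ Icc (-3000 : ℤ) 3000) with hU
  set y : ℕ → ℝ := fun k => Bc * 16 ^ k with hy
  have hy1 : ∀ k, 1 ≤ y k := by
    intro k
    have := Bc_ge
    have : (1 : ℝ) ≤ 16 ^ k := one_le_pow₀ (by norm_num)
    simp only [hy]; nlinarith
  have hy0 : ∀ k, 0 < y k := fun k => lt_of_lt_of_le one_pos (hy1 k)
  set z : Fin n × ℕ × ℤ → ℝ := fun θ => wT θ * L / y θ.2.1 with hz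
  have hw0 : ∀ θ : Fin n × ℕ × ℤ, 0 ≤ wT θ := fun θ => by unfold wT; positivity
  have hz0 : ∀ θ, 0 ≤ z θ := fun θ => by
    simp only [hz]; exact div_nonneg (mul_nonneg (hw0 θ) hL0.le) (hy0 _).le
  have hlogy : ∀ k, Real.log (y k) ≤ (k + 1) * Real.log Bc := by
    intro k
    have hb : 0 < Bc := by linarith [Bc_ge]
    simp only [hy]
    rw [Real.log_mul hb.ne' (by positivity), Real.log_pow]
    have : Real.log 16 ≤ Real.log Bc := Real.log_le_log (by norm_num) Bc_ge
    have hk : (0 : ℝ) ≤ k := Nat.cast_nonneg k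
    nlinarith
  have hS : ∀ S ∈ U.powerset.filter (Shat loT hiT A),
      (∏ θ ∈ S, wT θ) * L ^ S.card ≤ Real.exp (D / 8) * ∏ θ ∈ S, z θ := by
    intro S hS
    rw [mem_filter, mem_powerset] at hS
    have e1 : (∏ θ ∈ S, wT θ) * L ^ S.card = (∏ θ ∈ S, y θ.2.1) * ∏ θ ∈ S, z θ := by
      rw [← prod_const, ← prod_mul_distrib, ← prod_mul_distrib]
      apply prod_congr rfl
      intro θ _
      simp only [hz]
      rw [mul_div_cancel₀ _ (hy0 _).ne']
    rw [e1]
    apply mul_le_mul_of_nonneg_right _ (prod_nonneg fun θ _ => hz0 θ)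
    rw [← Real.log_le_iff_le_exp (prod_pos fun θ _ => hy0 _), Real.log_prod (fun θ _ => (hy0 _).ne')]
    have hmaps : ∀ θ ∈ S, θ.2.1 ∈ range K := by
      intro θ hθ
      have := hS.1 hθ
      simp only [hU, mem_product] at this
      exact this.2.1
    rw [← sum_fiberwise_of_maps_to hmaps]
    have hk : ∀ k ∈ range K, ∑ θ ∈ S with θ.2.1 = k, Real.log (y θ.2.1) ≤
        (D / 32) * (((k : ℝ) + 1) * (1 / 2) ^ k) := by
      intro k _
      rw [sum_congr rfl (g := fun _ => Real.log (y k)) (by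
        intro θ hθ; rw [(mem_filter.1 hθ).2]), sum_const, nsmul_eq_mul]
      obtain ⟨σ, hσ, hc⟩ := shat_shatters hS.2 k
      rw [hc]
      have h1 := (hsh k σ hσ).le
      have h2 := hlogy k
      have h3 : 0 ≤ Real.log (y k) := Real.log_nonneg (hy1 k)
      have hlb := logBc_pos
      calc (σ.card : ℝ) * Real.log (y k) ≤ (1 / (32 * Real.log Bc) * (1 / 2) ^ k * D) *
            ((k + 1) * Real.log Bc) := by gcongr
        _ = _ := by field_simp
    refine (sum_le_sum hk).trans ?_
    rw [← mul_sum]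
    have := sum_kk K
    nlinarith
  unfold spoly
  refine (sum_le_sum hS).trans ?_
  rw [← mul_sum]
  have h3 : ∑ S ∈ U.powerset.filter (Shat loT hiT A), ∏ θ ∈ S, z θ ≤ Real.exp (D / 8) := by
    calc ∑ S ∈ U.powerset.filter (Shat loT hiT A), ∏ θ ∈ S, z θ 
        ≤ ∑ S ∈ U.powerset, ∏ θ ∈ S, z θ := 
          sum_le_sum_of_subset_of_nonneg (filter_subset _ _)
            (fun S _ _ => prod_nonneg fun θ _ => hz0 θ)
      _ = ∏ θ ∈ U, (1 + z θ) := by rw [prod_one_add]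
      _ ≤ ∏ θ ∈ U, Real.exp (z θ) := by
          apply Finset.prod_le_prod
          · intro θ _; linarith [hz0 θ]
          · intro θ _; linarith [Real.add_one_le_exp (z θ)]
      _ = Real.exp (∑ θ ∈ U, z θ) := by rw [Real.exp_sum]
      _ ≤ Real.exp (D / 8) := by
          apply Real.exp_le_exp.2
          rw [hU, sum_product]
          simp only [sum_product]
          simp only [hz, wT, hy]
          have e : ∀ k : ℕ, (8 : ℝ) ^ k / n * L / (Bc * 16 ^ k) = L / (n * Bc) * (1 / 2) ^ k := by
            intro k
            have : (16 : ℝ) ^ k = 8 ^ k * 2 ^ k := by rw [← mul_pow]; norm_num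
            have hb : 0 < Bc := by linarith [Bc_ge]
            rw [this, one_div, inv_pow]; field_simp
          simp only [e, sum_const, nsmul_eq_mul, card_univ, Fintype.card_fin, ← mul_sum]
          have h2 : ∑ k ∈ range K, (1 / 2 : ℝ) ^ k ≤ 2 := sum_geometric_two_le K
          have hc : ((Icc (-3000 : ℤ) 3000).card : ℝ) = 6001 := by simp
          rw [hc]
          have hb : 0 < Bc := by linarith [Bc_ge]
          calc (n : ℝ) * (6001 * (L / (n * Bc) * ∑ k ∈ range K, (1 / 2 : ℝ) ^ k)) 
              ≤ n * (6001 * (L / (n * Bc) * 2)) := by gcongr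
            _ = 12002 * L / Bc := by field_simp; norm_num
            _ = D / 8 := by rw [hL, Bc]; field_simp; norm_num
  calc Real.exp (D / 8) * ∑ S ∈ U.powerset.filter (Shat loT hiT A), ∏ θ ∈ S, z θ 
      ≤ Real.exp (D / 8) * Real.exp (D / 8) := by gcongr
    _ = Real.exp (D / 4) := by rw [← Real.exp_add]; ring_nf

theorem core {n : ℕ} {A : Finset (Fin n → ℝ)} (hcard : 2 ≤ A.card)
    (hball : ∀ f ∈ A, ∑ i, f i ^ 2 ≤ 4 * n)
    (hsep : ∀ f ∈ A, ∀ g ∈ A, f ≠ g → (n : ℝ) ≤ ∑ i, (f i - g i) ^ 2) :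
    ∃ (k : ℕ) (σ : Finset (Fin n)), Shatters (A : Set (Fin n → ℝ)) (1 / 64 * 2 ^ k) σ ∧
      1 / (32 * Real.log Bc) * (1 / 2) ^ k * Real.log A.card ≤ σ.card := by
  by_contra! hcon
  have hn : 0 < n := by
    rcases Nat.eq_zero_or_pos n with h | h
    · subst h
      have := Finset.card_le_one_of_subsingleton A
      omega
    · exact h
  have hn' : (0 : ℝ) < n := by exact_mod_cast hn
  have hA2 : (2 : ℝ) ≤ A.card := by exact_mod_cast hcard
  set D := Real.log A.card with hDdef
  have hD : 0 < D := Real.log_pos (by linarith)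
  obtain ⟨K, hK⟩ : ∃ K : ℕ, ∀ f ∈ A, ∀ i, 2 * |f i| < 1 / 64 * 2 ^ K := by
    obtain ⟨K, hK⟩ := pow_unbounded_of_one_lt (128 * ∑ f ∈ A, ∑ i, |f i|) (one_lt_two)
    refine ⟨K, fun f hf i => ?_⟩
    have h1 : |f i| ≤ ∑ i, |f i| := single_le_sum (f := fun i => |f i|)
      (fun _ _ => abs_nonneg _) (mem_univ i)
    have h2 : ∑ i, |f i| ≤ ∑ f ∈ A, ∑ i, |f i| := single_le_sum (f := fun f : Fin n → ℝ => ∑ i, |f i|)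
      (fun _ _ => sum_nonneg fun _ _ => abs_nonneg _) hf
    linarith
  have up := spoly_upper hn hD K (A := A) hcon
  have hw0 : ∀ θ : Fin n × ℕ × ℤ, 0 ≤ wT θ := fun θ => by unfold wT; positivity
  have lowb := growth (lo := loT) (hi := hiT) loT_hiT hw0
    (U := univ ×ˢ (range K ×ˢ Icc (-3000 : ℤ) 3000)) (A := A) (δ := 1 / (4 * 10 ^ 9)) (D := D)
    (by norm_num) hD le_rfl (by
      intro B hBA hB2
      have hB : B.Nonempty := card_pos.1 (by omega)
      have hN : (0 : ℝ) < B.card := by exact_mod_cast hB.card_pos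
      have hN2 : (2 : ℝ) ≤ B.card := by exact_mod_cast hB2
      rw [sum_product]
      simp only [sum_product]
      have hx : ∀ x ∈ (univ : Finset (Fin n)), (1 / n : ℝ) * ((1 / 10 ^ 9) *
          ((∑ f ∈ B, ∑ g ∈ B, (f x - g x) ^ 2) / (B.card : ℝ) ^ 2 - 1 / 8 -
            (∑ f ∈ B, f x ^ 2) / B.card / 32)) ≤
          ∑ k ∈ range K, ∑ h ∈ Icc (-3000 : ℤ) 3000, wT (x, k, h) *
            max 0 (√((B.filter (loT (x, k, h))).card / B.card) +
              √((B.filter (hiT (x, k, h))).card / B.card) - 1) := by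
        intro x _
        have := scaled_gain hB (fun f => f x) K (fun f hf => hK f (hBA hf) x)
        refine (mul_le_mul_of_nonneg_left this (by positivity)).trans (le_of_eq ?_)
        rw [mul_sum]
        apply sum_congr rfl; intro k _
        rw [mul_sum]
        apply sum_congr rfl; intro h _
        unfold wT loT hiT pr
        rw [← mul_assoc]
        congr 1
        ring
      refine le_trans ?_ (sum_le_sum hx)
      rw [← mul_sum, ← mul_sum, sum_sub_distrib, sum_sub_distrib, ← sum_div, ← sum_div (f := fun i : Fin n => (∑ f ∈ B, f i ^ 2) / (B.card : ℝ)), ← sum_div (f := fun i : Fin n => (∑ f ∈ B, f i ^ 2))]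
      have s1 : (B.card : ℝ) * (B.card - 1) * n ≤ ∑ x : Fin n, ∑ f ∈ B, ∑ g ∈ B, (f x - g x) ^ 2 := by
        rw [sum_comm]
        have : ∀ f ∈ B, ((B.card : ℝ) - 1) * n ≤ ∑ x : Fin n, ∑ g ∈ B, (f x - g x) ^ 2 := by
          intro f hf
          rw [sum_comm, ← sum_erase_add _ _ hf]
          have : ∑ g ∈ B.erase f, (n : ℝ) ≤ ∑ g ∈ B.erase f, ∑ x, (f x - g x) ^ 2 := by
            apply sum_le_sum
            intro g hg
            exact hsep f (hBA hf) g (hBA (mem_of_mem_erase hg)) (ne_of_mem_erase hg).symm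
          rw [sum_const, nsmul_eq_mul, card_erase_of_mem hf, Nat.cast_sub hB.card_pos] at this
          simp only [sub_self]
          push_cast at this
          simpa using this
        have h' := sum_le_sum this
        rw [sum_const, nsmul_eq_mul] at h'
        linarith
      have s2 : ∑ x : Fin n, ∑ f ∈ B, f x ^ 2 ≤ 4 * n * B.card := by
        rw [sum_comm]
        have := sum_le_sum (fun f hf => hball f (hBA hf))
        rw [sum_const, nsmul_eq_mul] at this
        linarith
      have s3 : (n : ℝ) / 2 ≤ (∑ x : Fin n, ∑ f ∈ B, ∑ g ∈ B, (f x - g x) ^ 2) / (B.card : ℝ) ^ 2 := by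
        rw [le_div_iff₀ (by positivity)]
        refine le_trans ?_ s1
        have : (n : ℝ) * B.card * 2 ≤ n * B.card * B.card := by gcongr
        nlinarith
      have s4 : (∑ x : Fin n, ∑ f ∈ B, f x ^ 2) / B.card ≤ 4 * n := by
        rw [div_le_iff₀ hN]; exact s2
      rw [sum_const, nsmul_eq_mul, card_univ, Fintype.card_fin]
      rw [one_div_mul_eq_div, le_div_iff₀ hn']
      linarith)
    A.card A subset_rfl rfl (card_pos.1 (by omega)) (D / (2 * (1 / (4 * 10 ^ 9)))) (by positivity) le_rfl
  have h1 := lowb.trans up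
  have e : (1 / (4 * 10 ^ 9) : ℝ) * (D / (2 * (1 / (4 * 10 ^ 9)))) / D = 1 / 2 := by
    field_simp
  rw [e, Real.rpow_def_of_pos (by linarith), Real.exp_le_exp] at h1
  have : Real.log A.card = D := rfl
  rw [this] at h1
  linarith

end core

section gaussmax
open ProbabilityTheory

instance gaussPi_prob (n : ℕ) : IsProbabilityMeasure (gaussPi n) := by
  unfold gaussPi; infer_instance

theorem exp_lin_int {n : ℕ} (d : Fin n → ℝ) (t : ℝ) :
    Integrable (fun g : Fin n → ℝ => Real.exp (t * ∑ i, g i * d i)) (gaussPi n) ∧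
    ∫ g, Real.exp (t * ∑ i, g i * d i) ∂(gaussPi n) = Real.exp (t ^ 2 * (∑ i, d i ^ 2) / 2) := by
  have e : (fun g : Fin n → ℝ => Real.exp (t * ∑ i, g i * d i)) =
      fun g => ∏ i, Real.exp ((t * d i) * g i) := by
    ext g
    rw [← Real.exp_sum, Finset.mul_sum]
    congr 1
    exact Finset.sum_congr rfl fun i _ => by ring
  rw [e]
  constructor
  · unfold gaussPi
    exact Integrable.fintype_prod (f := fun i x => Real.exp ((t * d i) * x))
      fun i => integrable_exp_mul_gaussianReal (t * d i)
  · unfold gaussPi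
    rw [integral_fintype_prod_eq_prod (𝕜 := ℝ) (f := fun i x => Real.exp ((t * d i) * x))]
    have : ∀ i, ∫ x, Real.exp ((t * d i) * x) ∂(gaussianReal 0 1) = Real.exp ((t * d i) ^ 2 / 2) := by
      intro i
      have := congrFun (mgf_id_gaussianReal (μ := 0) (v := 1)) (t * d i)
      simp only [mgf, id] at this
      rw [this]; congr 1; simp
    simp only [this]
    rw [← Real.exp_sum]
    congr 1
    rw [Finset.mul_sum, Finset.sum_div]
    exact Finset.sum_congr rfl fun i _ => by ring

theorem coord_int {n : ℕ} (i : Fin n) :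
    Integrable (fun g : Fin n → ℝ => g i) (gaussPi n) ∧ ∫ g, g i ∂(gaussPi n) = 0 := by
  have hp : MeasurePreserving (fun g : Fin n → ℝ => g i) (gaussPi n) (gaussianReal 0 1) := by
    unfold gaussPi; exact measurePreserving_eval _ i
  have h1 : Integrable (fun x : ℝ => x) (gaussianReal 0 1) :=
    (memLp_id_gaussianReal (μ := 0) (v := 1) 1).integrable (by norm_num)
  constructor
  · exact hp.integrable_comp_of_integrable h1
  · have := integral_map hp.measurable.aemeasurable (μ := gaussPi n) (f := fun x : ℝ => x)
      (by rw [hp.map_eq]; exact h1.aestronglyMeasurable)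
    rw [← this, hp.map_eq]
    exact integral_id_gaussianReal

theorem coord_sq_int {n : ℕ} (i : Fin n) :
    Integrable (fun g : Fin n → ℝ => g i ^ 2) (gaussPi n) ∧ ∫ g, g i ^ 2 ∂(gaussPi n) = 1 := by
  have hp : MeasurePreserving (fun g : Fin n → ℝ => g i) (gaussPi n) (gaussianReal 0 1) := by
    unfold gaussPi; exact measurePreserving_eval _ i
  have h1 : Integrable (fun x : ℝ => x ^ 2) (gaussianReal 0 1) :=
    (memLp_id_gaussianReal (μ := 0) (v := 1) 2).integrable_sq
  constructor
  · exact hp.integrable_comp_of_integrable h1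
  · have := integral_map hp.measurable.aemeasurable (μ := gaussPi n) (f := fun x : ℝ => x ^ 2)
      (by rw [hp.map_eq]; exact h1.aestronglyMeasurable)
    rw [← this, hp.map_eq]
    have hv := variance_id_gaussianReal (μ := 0) (v := 1)
    rw [variance_eq_integral aemeasurable_id] at hv
    simpa [integral_id_gaussianReal] using hv

theorem lin_int {n : ℕ} (d : Fin n → ℝ) :
    Integrable (fun g : Fin n → ℝ => ∑ i, g i * d i) (gaussPi n) ∧
      ∫ g, ∑ i, g i * d i ∂(gaussPi n) = 0 := by
  have h : ∀ i ∈ Finset.univ, Integrable (fun g : Fin n → ℝ => g i * d i) (gaussPi n) :=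
    fun i _ => (coord_int i).1.mul_const _
  refine ⟨integrable_finsetSum _ h, ?_⟩
  rw [integral_finsetSum _ h]
  apply Finset.sum_eq_zero
  intro i _
  rw [integral_mul_const, (coord_int i).2, zero_mul]

theorem gmax {n : ℕ} (D : Finset (Fin n → ℝ)) (hD : D.Nonempty) {s a : ℝ} (hs : 0 < s) (ha : 0 ≤ a)
    (hd : ∀ d ∈ D, ∑ i, d i ^ 2 ≤ s ^ 2) (hc : Real.log D.card ≤ a ^ 2) :
    ∃ Φ : (Fin n → ℝ) → ℝ, Integrable Φ (gaussPi n) ∧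
      (∀ g, ∀ d ∈ D, ∑ i, g i * d i ≤ Φ g) ∧ ∫ g, Φ g ∂(gaussPi n) ≤ 2 * s * a := by
  have hcp : (0 : ℝ) < D.card := by exact_mod_cast hD.card_pos
  rcases ha.eq_or_lt with rfl | ha
  · have : D.card = 1 := by
      have h1 : (D.card : ℝ) ≤ 1 := by
        rw [← Real.log_nonpos_iff hcp.le]; simpa using hc
      have h2 : D.card ≤ 1 := by exact_mod_cast h1
      have := hD.card_pos
      omega
    obtain ⟨d, rfl⟩ := Finset.card_eq_one.1 this
    refine ⟨fun g => ∑ i, g i * d i, (lin_int d).1, ?_, ?_⟩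
    · intro g d' hd'
      rw [Finset.mem_singleton.1 hd']
    · rw [(lin_int d).2]; simp
  set t : ℝ := a / s with ht
  have ht0 : 0 < t := div_pos ha hs
  set c : ℝ := t * s ^ 2 / 2 + a ^ 2 / t with hcdef
  have hint : ∀ d ∈ D, Integrable (fun g : Fin n → ℝ => Real.exp (-(t * c)) *
      Real.exp (t * ∑ i, g i * d i)) (gaussPi n) := fun d _ => (exp_lin_int d t).1.const_mul _
  have hints := integrable_finsetSum D hint
  refine ⟨fun g => (c - 1 / t) + 1 / t * ∑ d ∈ D, Real.exp (-(t * c)) *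
      Real.exp (t * ∑ i, g i * d i), (integrable_const _).add (hints.const_mul _), ?_, ?_⟩
  · intro g d hd
    have h1 : Real.exp (-(t * c)) * Real.exp (t * ∑ i, g i * d i) ≤
        ∑ d ∈ D, Real.exp (-(t * c)) * Real.exp (t * ∑ i, g i * d i) :=
      Finset.single_le_sum (f := fun d => Real.exp (-(t * c)) * Real.exp (t * ∑ i, g i * d i))
        (fun d _ => by positivity) hd
    have h2 := Real.add_one_le_exp (-(t * c) + t * ∑ i, g i * d i)
    rw [Real.exp_add] at h2
    have h3 := h2.trans h1
    have h4 := mul_le_mul_of_nonneg_left h3 (one_div_pos.2 ht0).le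
    refine le_trans (le_of_eq ?_) (add_le_add_right h4 (c - 1 / t))
    field_simp
    ring
  · rw [integral_add (integrable_const _) (hints.const_mul _), integral_const_mul,
      integral_finsetSum _ hint]
    simp only [integral_const_mul, (exp_lin_int _ t).2, integral_const, probReal_univ, one_smul]
    have h1 : ∀ d ∈ D, Real.exp (-(t * c)) * Real.exp (t ^ 2 * (∑ i, d i ^ 2) / 2) ≤
        Real.exp (-a ^ 2) := by
      intro d hdD
      rw [← Real.exp_add]
      apply Real.exp_le_exp.2
      have e : t * c = t ^ 2 * s ^ 2 / 2 + a ^ 2 := by rw [hcdef]; field_simp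
      rw [e]
      have := mul_le_mul_of_nonneg_left (hd d hdD) (sq_nonneg t)
      linarith
    have h2 := Finset.sum_le_sum h1
    rw [Finset.sum_const, nsmul_eq_mul] at h2
    have h3 : (D.card : ℝ) * Real.exp (-a ^ 2) ≤ 1 := by
      have : (D.card : ℝ) ≤ Real.exp (a ^ 2) := by
        rw [← Real.exp_log hcp]; exact Real.exp_le_exp.2 hc
      calc (D.card : ℝ) * Real.exp (-a ^ 2) ≤ Real.exp (a ^ 2) * Real.exp (-a ^ 2) := by gcongr
        _ = 1 := by rw [← Real.exp_add]; simp
    have h4 := mul_le_mul_of_nonneg_left (h2.trans h3) (one_div_pos.2 ht0).le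
    have h5 : c = 3 / 2 * (s * a) := by rw [hcdef, ht]; field_simp; ring
    have : 0 < s * a := mul_pos hs ha
    linarith

end gaussmax

section chaining

def Ent {n : ℕ} (F : Set (Fin n → ℝ)) (r l : ℝ) : Prop :=
  ∀ p ∈ F, ∀ Q : Finset (Fin n → ℝ), (∀ f ∈ Q, f ∈ F) →
    (∀ f ∈ Q, ∑ i, (f i - p i) ^ 2 ≤ n * (2 * r) ^ 2) →
    (∀ f ∈ Q, ∀ g ∈ Q, f ≠ g → n * r ^ 2 ≤ ∑ i, (f i - g i) ^ 2) →
    Real.log Q.card ≤ l ^ 2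

theorem local_net {n : ℕ} {F : Set (Fin n → ℝ)} {r l : ℝ} (h : Ent F r l) {p : Fin n → ℝ}
    (hp : p ∈ F) : ∃ Q : Finset (Fin n → ℝ), (∀ f ∈ Q, f ∈ F) ∧
      (∀ f ∈ Q, ∑ i, (f i - p i) ^ 2 ≤ n * (2 * r) ^ 2) ∧ Real.log Q.card ≤ l ^ 2 ∧
      ∀ f ∈ F, ∑ i, (f i - p i) ^ 2 ≤ n * (2 * r) ^ 2 →
        ∃ q ∈ Q, ∑ i, (f i - q i) ^ 2 ≤ n * r ^ 2 := by
  classical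
  set S : Set ℕ := {m | ∃ Q : Finset (Fin n → ℝ), (∀ f ∈ Q, f ∈ F) ∧
    (∀ f ∈ Q, ∑ i, (f i - p i) ^ 2 ≤ n * (2 * r) ^ 2) ∧
    (∀ f ∈ Q, ∀ g ∈ Q, f ≠ g → n * r ^ 2 ≤ ∑ i, (f i - g i) ^ 2) ∧ Q.card = m} with hS
  have hne : S.Nonempty := ⟨0, ∅, by simp⟩
  have hb : BddAbove S := by
    refine ⟨⌈Real.exp (l ^ 2)⌉₊, ?_⟩
    rintro m ⟨Q, h1, h2, h3, rfl⟩
    have h4 := h p hp Q h1 h2 h3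
    rcases Nat.eq_zero_or_pos Q.card with h0 | h0
    · rw [h0]; exact Nat.zero_le _
    have h0' : (0 : ℝ) < Q.card := by exact_mod_cast h0
    have h5 : (Q.card : ℝ) ≤ Real.exp (l ^ 2) := by
      rw [← Real.exp_log h0']; exact Real.exp_le_exp.2 h4
    exact_mod_cast h5.trans (Nat.le_ceil _)
  obtain ⟨Q, h1, h2, h3, h4⟩ := Nat.sSup_mem hne hb
  refine ⟨Q, h1, h2, h p hp Q h1 h2 h3, ?_⟩
  intro f hf hfp
  by_contra! hcon
  have hfQ : f ∉ Q := by
    intro hfQ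
    have := hcon f hfQ
    simp only [sub_self, ne_eq, OfNat.ofNat_ne_zero, not_false_eq_true, zero_pow,
      Finset.sum_const_zero] at this
    have : (0 : ℝ) ≤ n * r ^ 2 := by positivity
    linarith
  have hm : Q.card + 1 ∈ S := by
    refine ⟨insert f Q, ?_, ?_, ?_, Finset.card_insert_of_notMem hfQ⟩
    · intro g hg
      rcases Finset.mem_insert.1 hg with rfl | hg
      · exact hf
      · exact h1 g hg
    · intro g hg
      rcases Finset.mem_insert.1 hg with rfl | hg
      · exact hfp
      · exact h2 g hg
    · intro g hg g' hg' hne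
      rcases Finset.mem_insert.1 hg with rfl | hg1 <;> rcases Finset.mem_insert.1 hg' with rfl | hg2
      · exact absurd rfl hne
      · exact (hcon _ hg2).le
      · have := (hcon _ hg1).le
        refine this.trans (le_of_eq (Finset.sum_congr rfl fun i _ => by ring))
      · exact h3 g hg1 g' hg2 hne
  have := le_csSup hb hm
  omega

theorem chain {n : ℕ} (hn : 0 < n) {F : Set (Fin n → ℝ)} {Δ : ℝ} (hΔ : 0 < Δ) {f0 : Fin n → ℝ}
    (hf0 : f0 ∈ F) (hF : ∀ f ∈ F, ∑ i, (f i - f0 i) ^ 2 ≤ n * Δ ^ 2) (lam : ℕ → ℝ)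
    (hlam : ∀ j, 0 ≤ lam j) (J : ℕ) (hE : ∀ j < J, Ent F (Δ * (1 / 2) ^ (j + 1)) (lam j)) :
    ∃ P : Finset (Fin n → ℝ), P.Nonempty ∧ (∀ p ∈ P, p ∈ F) ∧
      (∀ f ∈ F, ∃ p ∈ P, ∑ i, (f i - p i) ^ 2 ≤ n * (Δ * (1 / 2) ^ J) ^ 2) ∧
      Real.log P.card ≤ (∑ j ∈ Finset.range J, lam j) ^ 2 ∧
      ∃ Φ : (Fin n → ℝ) → ℝ, Integrable Φ (gaussPi n) ∧
      (∀ g, ∀ p ∈ P, ∑ i, g i * p i ≤ Φ g) ∧ ∫ g, Φ g ∂(gaussPi n) ≤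
        2 * √n * ∑ l ∈ Finset.range J, Δ * (1 / 2) ^ l * ∑ j ∈ Finset.range (l + 1), lam j := by
  classical
  have hn' : (0 : ℝ) < n := by exact_mod_cast hn
  induction J with
  | zero =>
    refine ⟨{f0}, by simp, by simpa using hf0, ?_, by simp, fun g => ∑ i, g i * f0 i,
      (lin_int f0).1, by simp, ?_⟩
    · intro f hf
      exact ⟨f0, by simp, by simpa using hF f hf⟩
    · rw [(lin_int f0).2]; simp
  | succ J ih =>
    obtain ⟨P, hPn, hPF, hPc, hPl, Φ, hΦi, hΦ, hΦb⟩ := ih fun j hj => hE j (by omega)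
    have hEJ := hE J (by omega)
    have hr : 2 * (Δ * (1 / 2) ^ (J + 1)) = Δ * (1 / 2) ^ J := by rw [pow_succ]; ring
    have hrp : 0 < Δ * (1 / 2) ^ J := by positivity
    set S := ∑ j ∈ Finset.range J, lam j with hS
    have hS0 : 0 ≤ S := Finset.sum_nonneg fun j _ => hlam j
    have hloc : ∀ p : Fin n → ℝ, ∃ Q : Finset (Fin n → ℝ), p ∈ P → (∀ f ∈ Q, f ∈ F) ∧
      (∀ f ∈ Q, ∑ i, (f i - p i) ^ 2 ≤ n * (Δ * (1 / 2) ^ J) ^ 2) ∧ Real.log Q.card ≤ lam J ^ 2 ∧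
      ∀ f ∈ F, ∑ i, (f i - p i) ^ 2 ≤ n * (Δ * (1 / 2) ^ J) ^ 2 →
        ∃ q ∈ Q, ∑ i, (f i - q i) ^ 2 ≤ n * (Δ * (1 / 2) ^ (J + 1)) ^ 2 := by
      intro p
      by_cases hp : p ∈ P
      · obtain ⟨Q, hQ⟩ := local_net hEJ (hPF p hp)
        rw [hr] at hQ
        exact ⟨Q, fun _ => hQ⟩
      · exact ⟨∅, fun h => absurd h hp⟩
    choose Q hQ using hloc
    set P' := P.biUnion Q with hP'
    have hcov : ∀ f ∈ F, ∃ p ∈ P', ∑ i, (f i - p i) ^ 2 ≤ n * (Δ * (1 / 2) ^ (J + 1)) ^ 2 := by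
      intro f hf
      obtain ⟨p, hp, hfp⟩ := hPc f hf
      obtain ⟨q, hq, hfq⟩ := (hQ p hp).2.2.2 f hf hfp
      exact ⟨q, Finset.mem_biUnion.2 ⟨p, hp, hq⟩, hfq⟩
    have hP'n : P'.Nonempty := by
      obtain ⟨p, hp, _⟩ := hcov f0 hf0
      exact ⟨p, hp⟩
    have hPpos : (0 : ℝ) < P.card := by exact_mod_cast hPn.card_pos
    have hP'pos : (0 : ℝ) < P'.card := by exact_mod_cast hP'n.card_pos
    have hlog : Real.log P'.card ≤ (S + lam J) ^ 2 := by
      have h1 : (P'.card : ℝ) ≤ P.card * Real.exp (lam J ^ 2) := by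
        have h2 : P'.card ≤ ∑ p ∈ P, (Q p).card := Finset.card_biUnion_le
        have h3 : (P'.card : ℝ) ≤ ∑ p ∈ P, ((Q p).card : ℝ) := by exact_mod_cast h2
        refine h3.trans ?_
        rw [← nsmul_eq_mul]
        apply Finset.sum_le_card_nsmul
        intro p hp
        rcases Nat.eq_zero_or_pos (Q p).card with h0 | h0
        · rw [h0]; simp only [Nat.cast_zero]; positivity
        have h0' : (0 : ℝ) < (Q p).card := by exact_mod_cast h0
        rw [← Real.exp_log h0']; exact Real.exp_le_exp.2 (hQ p hp).2.2.1
      have h2 := Real.log_le_log hP'pos h1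
      rw [Real.log_mul hPpos.ne' (Real.exp_ne_zero _), Real.log_exp] at h2
      nlinarith [mul_nonneg hS0 (hlam J)]
    have hpar : ∀ q : Fin n → ℝ, ∃ p, q ∈ P' → p ∈ P ∧
        ∑ i, (q i - p i) ^ 2 ≤ n * (Δ * (1 / 2) ^ J) ^ 2 := by
      intro q
      by_cases hq : q ∈ P'
      · obtain ⟨p, hp, hqp⟩ := Finset.mem_biUnion.1 hq
        exact ⟨p, fun _ => ⟨hp, (hQ p hp).2.1 q hqp⟩⟩
      · exact ⟨q, fun h => absurd h hq⟩
    choose par hpar using hpar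
    set D : Finset (Fin n → ℝ) := P'.image fun q i => q i - par q i with hD
    have hDn : D.Nonempty := hP'n.image _
    have hDc : Real.log D.card ≤ (S + lam J) ^ 2 := by
      refine le_trans (Real.log_le_log (by exact_mod_cast hDn.card_pos) ?_) hlog
      exact_mod_cast Finset.card_image_le
    obtain ⟨Ψ, hΨi, hΨ, hΨb⟩ := gmax D hDn (s := √n * (Δ * (1 / 2) ^ J)) (a := S + lam J)
      (by positivity) (add_nonneg hS0 (hlam J)) (by
        intro d hd
        obtain ⟨q, hq, rfl⟩ := Finset.mem_image.1 hd
        rw [mul_pow, Real.sq_sqrt hn'.le]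
        exact (hpar q hq).2) hDc
    refine ⟨P', hP'n, ?_, hcov, ?_, fun g => Φ g + Ψ g, hΦi.add hΨi, ?_, ?_⟩
    · intro q hq
      obtain ⟨p, hp, hqp⟩ := Finset.mem_biUnion.1 hq
      exact (hQ p hp).1 q hqp
    · rw [Finset.sum_range_succ]; exact hlog
    · intro g q hq
      have h1 := hΦ g (par q) (hpar q hq).1
      have h2 := hΨ g _ (Finset.mem_image_of_mem (fun q i => q i - par q i) hq)
      refine le_trans (le_of_eq ?_) (add_le_add h1 h2)
      rw [← Finset.sum_add_distrib]
      exact Finset.sum_congr rfl fun i _ => by ring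
    · rw [integral_add hΦi hΨi, Finset.sum_range_succ, Finset.sum_range_succ, ← hS]
      refine (add_le_add hΦb hΨb).trans (le_of_eq ?_)
      ring

theorem swap_sum (Δ : ℝ) (lam : ℕ → ℝ) (J : ℕ) :
    ∑ l ∈ Finset.range J, Δ * (1 / 2) ^ l * ∑ j ∈ Finset.range (l + 1), lam j
      + 2 * (Δ * (1 / 2) ^ J) * ∑ j ∈ Finset.range J, lam j =
    4 * ∑ j ∈ Finset.range J, Δ * (1 / 2) ^ (j + 1) * lam j := by
  induction J with
  | zero => simp
  | succ J ih =>
    rw [Finset.sum_range_succ, Finset.sum_range_succ (fun j => Δ * (1 / 2) ^ (j + 1) * lam j),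
      mul_add, ← ih, Finset.sum_range_succ lam, pow_succ]
    ring

theorem gauss_chain {n : ℕ} (hn : 0 < n) {F : Set (Fin n → ℝ)} {Δ : ℝ} (hΔ : 0 < Δ)
    {f0 : Fin n → ℝ}
    (hf0 : f0 ∈ F) (hF : ∀ f ∈ F, ∑ i, (f i - f0 i) ^ 2 ≤ n * Δ ^ 2) (lam : ℕ → ℝ)
    (hlam : ∀ j, 0 ≤ lam j) (J : ℕ) (hE : ∀ j < J, Ent F (Δ * (1 / 2) ^ (j + 1)) (lam j))
    (hpos : 0 < gaussE n F) :
    gaussE n F ≤ 8 * ∑ j ∈ Finset.range J, Δ * (1 / 2) ^ (j + 1) * lam j +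
      Δ * (1 / 2) ^ J * √n := by
  have hn' : (0 : ℝ) < n := by exact_mod_cast hn
  obtain ⟨P, hPn, hPF, hPc, hPl, Φ, hΦi, hΦ, hΦb⟩ := chain hn hΔ hf0 hF lam hlam J hE
  set r : ℝ := Δ * (1 / 2) ^ J with hr
  have hr0 : 0 < r := by positivity
  have hsq : ∀ i ∈ Finset.univ, Integrable (fun g : Fin n → ℝ => g i ^ 2) (gaussPi n) :=
    fun i _ => (coord_sq_int i).1
  have hsqs := integrable_finsetSum _ hsq
  have hsqv : ∫ g : Fin n → ℝ, ∑ i, g i ^ 2 ∂(gaussPi n) = n := by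
    rw [integral_finsetSum _ hsq]
    simp [(coord_sq_int _).2]
  have hpt : ∀ g : Fin n → ℝ, sSup ((fun f : Fin n → ℝ => ∑ i, g i * f i) '' F) ≤
      Φ g + (r / 2 * ∑ i, g i ^ 2 + n * r / 2) := by
    intro g
    apply csSup_le (Set.Nonempty.image _ ⟨f0, hf0⟩)
    rintro _ ⟨f, hf, rfl⟩
    obtain ⟨p, hp, hfp⟩ := hPc f hf
    have h1 := hΦ g p hp
    have h2 : ∑ i, g i * (f i - p i) ≤ r / 2 * ∑ i, g i ^ 2 + 1 / (2 * r) * ∑ i, (f i - p i) ^ 2 := by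
      rw [Finset.mul_sum, Finset.mul_sum, ← Finset.sum_add_distrib]
      apply Finset.sum_le_sum
      intro i _
      have : r / 2 * g i ^ 2 + 1 / (2 * r) * (f i - p i) ^ 2 - g i * (f i - p i) =
          1 / (2 * r) * (r * g i - (f i - p i)) ^ 2 := by field_simp; ring
      have h3 : 0 ≤ 1 / (2 * r) * (r * g i - (f i - p i)) ^ 2 := by positivity
      linarith
    have h3 : 1 / (2 * r) * ∑ i, (f i - p i) ^ 2 ≤ n * r / 2 := by
      refine (mul_le_mul_of_nonneg_left hfp (by positivity)).trans (le_of_eq ?_)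
      field_simp
    have h4 : ∑ i, g i * f i = ∑ i, g i * p i + ∑ i, g i * (f i - p i) := by
      rw [← Finset.sum_add_distrib]
      exact Finset.sum_congr rfl fun i _ => by ring
    change ∑ i, g i * f i ≤ _
    linarith
  have hint : Integrable (fun g : Fin n → ℝ => sSup ((fun f : Fin n → ℝ => ∑ i, g i * f i) '' F))
      (gaussPi n) := by
    by_contra hcon
    unfold gaussE at hpos
    rw [integral_undef hcon] at hpos
    simp at hpos
  have hI2 : Integrable (fun g : Fin n → ℝ => r / 2 * ∑ i, g i ^ 2 + n * r / 2) (gaussPi n) :=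
    (hsqs.const_mul _).add (integrable_const _)
  have h1 := integral_mono hint (hΦi.add hI2) hpt
  have h2 : ∫ g, (Φ + fun g : Fin n → ℝ => r / 2 * ∑ i, g i ^ 2 + n * r / 2) g ∂(gaussPi n) =
      ∫ g, Φ g ∂(gaussPi n) + n * r := by
    simp only [Pi.add_apply]
    rw [integral_add hΦi hI2, integral_add (hsqs.const_mul _) (integrable_const _),
      integral_const_mul, hsqv]
    simp; ring
  rw [h2] at h1
  have hsw := swap_sum Δ lam J
  have hS0 : 0 ≤ ∑ j ∈ Finset.range J, lam j := Finset.sum_nonneg fun j _ => hlam j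
  have hrS := mul_nonneg (mul_nonneg zero_le_two hr0.le) hS0
  set A := ∑ l ∈ Finset.range J, Δ * (1 / 2) ^ l * ∑ j ∈ Finset.range (l + 1), lam j with hA
  set B := ∑ j ∈ Finset.range J, Δ * (1 / 2) ^ (j + 1) * lam j with hB
  have hAB : A ≤ 4 * B := by linarith
  have hrp : (n : ℝ) ^ (-(1 / 2 : ℝ)) = 1 / √n := by
    rw [Real.rpow_neg hn'.le, ← Real.sqrt_eq_rpow, one_div]
  unfold gaussE
  rw [hrp, one_div, inv_mul_le_iff₀ (Real.sqrt_pos.2 hn')]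
  have hs0 := Real.sqrt_nonneg (n : ℝ)
  have hss : √(n : ℝ) * √n = n := Real.mul_self_sqrt hn'.le
  have h3 := mul_le_mul_of_nonneg_left hAB hs0
  calc _ ≤ _ := h1
    _ ≤ 2 * √n * A + n * r := by linarith
    _ ≤ √n * (8 * B) + (√n * √n) * r := by rw [hss]; linarith
    _ = _ := by ring

end chaining

section final

noncomputable def uu {n : ℕ} (F : Set (Fin n → ℝ)) (t : ℝ) : ℝ≥0∞ := (combDim F t) ^ (1/2 : ℝ)

theorem shatters_mono {n : ℕ} {F : Set (Fin n → ℝ)} {s t : ℝ} (hst : s ≤ t) {σ : Finset (Fin n)}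
    (h : Shatters F t σ) : Shatters F s σ := by
  obtain ⟨h, hh⟩ := h
  refine ⟨h, fun τ hτ => ?_⟩
  obtain ⟨f, hf, h1, h2⟩ := hh τ hτ
  exact ⟨f, hf, h1, fun x hx => by linarith [h2 x hx]⟩

theorem uu_anti {n : ℕ} (F : Set (Fin n → ℝ)) : Antitone (uu F) := by
  intro s t hst
  unfold uu
  apply ENNReal.rpow_le_rpow _ (by norm_num)
  unfold combDim
  exact iSup₂_le fun σ hσ => le_iSup₂_of_le σ (shatters_mono hst hσ) le_rfl

noncomputable def KK : ℝ := 16 * √(32 * Real.log Bc)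

noncomputable def MM {n : ℕ} (F : Set (Fin n → ℝ)) (r : ℝ) : ℝ≥0∞ :=
  ∫⁻ s in Set.Ioi (1 / 128 * r), uu F s * ENNReal.ofReal (1 / √s)

theorem local_ent {n : ℕ} {F : Set (Fin n → ℝ)} {r : ℝ} (hr : 0 < r) {p : Fin n → ℝ}
    {Q : Finset (Fin n → ℝ)} (hQF : ∀ f ∈ Q, f ∈ F)
    (hb : ∀ f ∈ Q, ∑ i, (f i - p i) ^ 2 ≤ n * (2 * r) ^ 2)
    (hs : ∀ f ∈ Q, ∀ g ∈ Q, f ≠ g → n * r ^ 2 ≤ ∑ i, (f i - g i) ^ 2) (hc : 2 ≤ Q.card) :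
    ∃ (k : ℕ) (σ : Finset (Fin n)), Shatters F (1 / 64 * 2 ^ k * r) σ ∧
      1 / (32 * Real.log Bc) * (1 / 2) ^ k * Real.log Q.card ≤ σ.card := by
  classical
  set φ : (Fin n → ℝ) → (Fin n → ℝ) := fun f i => (f i - p i) / r with hφ
  have hinj : Function.Injective φ := by
    intro f g hfg
    ext i
    have := congrFun hfg i
    simp only [hφ] at this
    rw [div_left_inj' hr.ne'] at this
    linarith
  have hr2 : 0 < r ^ 2 := by positivity
  have hcard : (Q.image φ).card = Q.card := Finset.card_image_of_injective _ hinj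
  obtain ⟨k, σ, ⟨h, hh⟩, hσ⟩ := core (A := Q.image φ) (by rw [hcard]; exact hc) (by
      intro f' hf'
      obtain ⟨f, hf, rfl⟩ := Finset.mem_image.1 hf'
      simp only [hφ, div_pow]
      rw [← Finset.sum_div, div_le_iff₀ hr2]
      refine (hb f hf).trans (le_of_eq (by ring))) (by
      intro f' hf' g' hg' hne
      obtain ⟨f, hf, rfl⟩ := Finset.mem_image.1 hf'
      obtain ⟨g, hg, rfl⟩ := Finset.mem_image.1 hg'
      simp only [hφ, ← sub_div, div_pow, sub_sub_sub_cancel_right]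
      rw [← Finset.sum_div, le_div_iff₀ hr2]
      exact hs f hf g hg (fun e => hne (by rw [e])))
  rw [hcard] at hσ
  refine ⟨k, σ, ⟨fun i => r * h i + p i, fun τ hτ => ?_⟩, hσ⟩
  obtain ⟨f', hf', h1, h2⟩ := hh τ hτ
  obtain ⟨f, hf, rfl⟩ := Finset.mem_image.1 (Finset.mem_coe.1 hf')
  refine ⟨f, hQF f hf, ?_, ?_⟩
  · intro x hx hxt
    have := h1 x hx hxt
    simp only [hφ] at this
    rw [div_le_iff₀ hr] at this
    linarith
  · intro x hx
    have := h2 x hx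
    simp only [hφ] at this
    rw [le_div_iff₀ hr] at this
    linarith

theorem MM_ge {n : ℕ} (F : Set (Fin n → ℝ)) {r : ℝ} (hr : 0 < r) (k : ℕ) :
    ENNReal.ofReal (√(1 / 64 * 2 ^ k * r) / 2) * uu F (1 / 64 * 2 ^ k * r) ≤ MM F r := by
  set T := 1 / 64 * 2 ^ k * r with hT
  have hT0 : 0 < T := by positivity
  have hk : (1 : ℝ) ≤ 2 ^ k := one_le_pow₀ (by norm_num)
  have hrT : 1 / 128 * r ≤ T / 2 := by rw [hT]; nlinarith
  calc ENNReal.ofReal (√T / 2) * uu F T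
      = ∫⁻ s in Set.Ioc (T / 2) T, uu F T * ENNReal.ofReal (1 / √T) := by
        rw [setLIntegral_const, Real.volume_Ioc, mul_assoc, ← ENNReal.ofReal_mul (by positivity),
          mul_comm]
        congr 2
        have : √T * √T = T := Real.mul_self_sqrt hT0.le
        field_simp
        nlinarith
    _ ≤ ∫⁻ s in Set.Ioc (T / 2) T, uu F s * ENNReal.ofReal (1 / √s) := by
        apply setLIntegral_mono' measurableSet_Ioc
        intro s hs
        have hs0 : 0 < s := lt_trans (by positivity) hs.1
        refine mul_le_mul' (uu_anti F hs.2) (ENNReal.ofReal_le_ofReal ?_)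
        exact one_div_le_one_div_of_le (Real.sqrt_pos.2 hs0) (Real.sqrt_le_sqrt hs.2)
    _ ≤ MM F r := lintegral_mono_set fun s hs => lt_of_le_of_lt hrT hs.1

theorem ent_bound {n : ℕ} {F : Set (Fin n → ℝ)} {r : ℝ} (hr : 0 < r) {p : Fin n → ℝ}
    {Q : Finset (Fin n → ℝ)} (hQF : ∀ f ∈ Q, f ∈ F)
    (hb : ∀ f ∈ Q, ∑ i, (f i - p i) ^ 2 ≤ n * (2 * r) ^ 2)
    (hs : ∀ f ∈ Q, ∀ g ∈ Q, f ≠ g → n * r ^ 2 ≤ ∑ i, (f i - g i) ^ 2) :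
    ENNReal.ofReal (√r * √(Real.log Q.card)) ≤ ENNReal.ofReal KK * MM F r := by
  rcases Nat.lt_or_ge Q.card 2 with hc | hc
  · have : Real.log Q.card = 0 := by
      have : Q.card = 0 ∨ Q.card = 1 := by omega
      rcases this with h | h <;> rw [h] <;> simp
    rw [this]; simp
  obtain ⟨k, σ, hσ, hk⟩ := local_ent hr hQF hb hs hc
  have hL := logBc_pos
  have h1 : Real.log Q.card ≤ 32 * Real.log Bc * 2 ^ k * σ.card := by
    have : (2 : ℝ) ^ k * (1 / 2) ^ k = 1 := by rw [← mul_pow]; norm_num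
    have h2 := mul_le_mul_of_nonneg_left hk (by positivity : 0 ≤ 32 * Real.log Bc * 2 ^ k)
    refine le_trans (le_of_eq ?_) h2
    calc Real.log Q.card = (2 ^ k * (1 / 2) ^ k) * (32 * Real.log Bc / (32 * Real.log Bc)) *
          Real.log Q.card := by rw [this, div_self (by positivity)]; ring
      _ = _ := by ring
  have h2 : ENNReal.ofReal (√(σ.card : ℝ)) ≤ uu F (1 / 64 * 2 ^ k * r) := by
    unfold uu
    have : (σ.card : ℝ≥0∞) ≤ combDim F (1 / 64 * 2 ^ k * r) := by
      unfold combDim; exact le_iSup₂_of_le σ hσ le_rfl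
    refine le_trans (le_of_eq ?_) (ENNReal.rpow_le_rpow this (by norm_num))
    rw [Real.sqrt_eq_rpow, ← ENNReal.ofReal_rpow_of_nonneg (Nat.cast_nonneg _) (by norm_num),
      ENNReal.ofReal_natCast]
  have h3 : √r * √(Real.log Q.card) ≤ KK * ((√(1 / 64 * 2 ^ k * r) / 2) * √(σ.card : ℝ)) := by
    have h4 := Real.sqrt_le_sqrt h1
    have e1 : √(32 * Real.log Bc * 2 ^ k * σ.card) = √(32 * Real.log Bc) * √(2 ^ k) * √(σ.card) := by
      rw [Real.sqrt_mul (by positivity), Real.sqrt_mul (by positivity)]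
    have e2 : √(1 / 64 * 2 ^ k * r) = 1 / 8 * √(2 ^ k) * √r := by
      rw [Real.sqrt_mul (by positivity), Real.sqrt_mul (by positivity)]
      congr 2
      rw [show (1 / 64 : ℝ) = (1 / 8) ^ 2 by norm_num, Real.sqrt_sq (by norm_num)]
    rw [e1] at h4
    rw [e2]; unfold KK
    refine (mul_le_mul_of_nonneg_left h4 (Real.sqrt_nonneg r)).trans (le_of_eq ?_)
    ring
  have hKK : 0 ≤ KK := by unfold KK; positivity
  calc _ ≤ _ := ENNReal.ofReal_le_ofReal h3
    _ = ENNReal.ofReal KK * (ENNReal.ofReal (√(1 / 64 * 2 ^ k * r) / 2) *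
        ENNReal.ofReal (√(σ.card : ℝ))) := by
      rw [ENNReal.ofReal_mul hKK, ENNReal.ofReal_mul (by positivity)]
    _ ≤ _ := by
      gcongr
      exact le_trans (by gcongr) (MM_ge F hr k)

theorem geo_sum (Δ x : ℝ) (hΔ : 0 < Δ) (hx : 0 ≤ x) (J : ℕ) :
    ∑ j ∈ Finset.range J, (if Δ * (1 / 2) ^ (j + 1) < x then √(Δ * (1 / 2) ^ (j + 1)) else 0) ≤
      4 * √x := by
  have key : ∀ j : ℕ, (if Δ * (1 / 2) ^ (j + 1) < x then √(Δ * (1 / 2) ^ (j + 1)) else 0) ≤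
      4 * (min (√x) (√(Δ * (1 / 2) ^ (j + 1))) - min (√x) (√(Δ * (1 / 2) ^ (j + 1 + 1)))) := by
    intro j
    have hy : 0 < Δ * (1 / 2) ^ (j + 1) := by positivity
    rw [show Δ * (1 / 2) ^ (j + 1 + 1) = (Δ * (1 / 2) ^ (j + 1)) * (1 / 2) by rw [pow_succ]; ring]
    set y := Δ * (1 / 2) ^ (j + 1) with hy'
    have h1 : √(y * (1 / 2)) ≤ √y * (3 / 4) := by
      rw [Real.sqrt_le_left (by positivity), mul_pow, Real.sq_sqrt hy.le]
      nlinarith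
    split_ifs with h
    · have h2 := min_le_right (√x) (√(y * (1 / 2)))
      rw [min_eq_right (Real.sqrt_le_sqrt h.le)]
      linarith
    · have h2 := Real.sqrt_nonneg y
      have : min (√x) (√(y * (1 / 2))) ≤ min (√x) (√y) := min_le_min_left _ (by linarith)
      linarith
  refine (Finset.sum_le_sum fun j _ => key j).trans ?_
  rw [← Finset.mul_sum, Finset.sum_range_sub' (fun j => min (√x) (√(Δ * (1 / 2) ^ (j + 1))))]
  have h1 := min_le_left (√x) (√(Δ * (1 / 2) ^ (0 + 1)))
  have h2 : 0 ≤ min (√x) (√(Δ * (1 / 2) ^ (J + 1))) := le_min (Real.sqrt_nonneg _) (Real.sqrt_nonneg _)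
  linarith

theorem sum_MM {n : ℕ} (F : Set (Fin n → ℝ)) {Δ a : ℝ} (hΔ : 0 < Δ) (ha : 0 ≤ a) (J : ℕ)
    (haJ : ∀ j < J, a ≤ 1 / 128 * (Δ * (1 / 2) ^ (j + 1))) :
    ∑ j ∈ Finset.range J, ENNReal.ofReal (√(Δ * (1 / 2) ^ (j + 1))) * MM F (Δ * (1 / 2) ^ (j + 1)) ≤
      ENNReal.ofReal 48 * ∫⁻ s in Set.Ioi a, uu F s := by
  have hum : Measurable (uu F) := (uu_anti F).measurable
  have hm : Measurable fun s : ℝ => uu F s * ENNReal.ofReal (1 / √s) := by fun_prop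
  have e1 : ∀ j ∈ Finset.range J, ENNReal.ofReal (√(Δ * (1 / 2) ^ (j + 1))) *
      MM F (Δ * (1 / 2) ^ (j + 1)) =
      ∫⁻ s in Set.Ioi a, (if Δ * (1 / 2) ^ (j + 1) < 128 * s then
        ENNReal.ofReal (√(Δ * (1 / 2) ^ (j + 1))) else 0) * (uu F s * ENNReal.ofReal (1 / √s)) := by
    intro j hj
    have haj := haJ j (Finset.mem_range.1 hj)
    unfold MM
    rw [← lintegral_const_mul _ hm, ← lintegral_indicator measurableSet_Ioi,
      ← lintegral_indicator measurableSet_Ioi]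
    congr 1
    ext s
    simp only [Set.indicator_apply, Set.mem_Ioi]
    by_cases h : 1 / 128 * (Δ * (1 / 2) ^ (j + 1)) < s
    · rw [if_pos h, if_pos (by linarith), if_pos (by linarith)]
    · rw [if_neg h]
      split_ifs with h1 h2
      · exact absurd (by linarith) h
      · simp
      · rfl
  rw [Finset.sum_congr rfl e1, ← lintegral_finsetSum, ← lintegral_const_mul _ hum]
  · apply setLIntegral_mono' measurableSet_Ioi
    intro s hs
    have hs0 : 0 < s := lt_of_le_of_lt ha hs
    have hss := Real.sqrt_pos.2 hs0
    rw [← Finset.sum_mul, mul_left_comm, mul_comm (ENNReal.ofReal 48)]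
    gcongr
    have h1 := geo_sum Δ (128 * s) hΔ (by positivity) J
    have h2 : ∑ j ∈ Finset.range J, (if Δ * (1 / 2) ^ (j + 1) < 128 * s then
        ENNReal.ofReal (√(Δ * (1 / 2) ^ (j + 1))) else 0) ≤ ENNReal.ofReal (48 * √s) := by
      refine le_trans (le_of_eq ?_) (ENNReal.ofReal_le_ofReal (h1.trans ?_))
      · rw [ENNReal.ofReal_sum_of_nonneg]
        · apply Finset.sum_congr rfl
          intro j _
          split_ifs <;> simp
        · intro j _
          split_ifs
          · exact Real.sqrt_nonneg _
          · exact le_rfl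
      · rw [Real.sqrt_mul (by norm_num)]
        have : √(128 : ℝ) ≤ 12 := by rw [Real.sqrt_le_left (by norm_num)]; norm_num
        nlinarith
    refine (mul_le_mul_left h2 _).trans ?_
    rw [← ENNReal.ofReal_mul (by positivity)]
    apply ENNReal.ofReal_le_ofReal
    apply le_of_eq
    field_simp
  · intro j _
    refine Measurable.mul ?_ hm
    exact Measurable.ite (measurableSet_lt measurable_const (by fun_prop)) measurable_const
      measurable_const

theorem MM_fin {n : ℕ} (F : Set (Fin n → ℝ)) {r a : ℝ} (hr : 0 < r) (har : a ≤ 1 / 128 * r)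
    (hfin : ∫⁻ s in Set.Ioi a, uu F s ≠ ⊤) : MM F r ≠ ⊤ := by
  have hum : Measurable (uu F) := (uu_anti F).measurable
  apply ne_top_of_le_ne_top (ENNReal.mul_ne_top hfin
    (ENNReal.ofReal_ne_top (r := 1 / √(1 / 128 * r))))
  rw [← lintegral_mul_const _ hum]
  refine le_trans ?_ (lintegral_mono_set (Set.Ioi_subset_Ioi har))
  apply setLIntegral_mono' measurableSet_Ioi
  intro s hs
  gcongr
  exact (Set.mem_Ioi.1 hs).le

theorem bounded_main {n : ℕ} (hn : 0 < n) {F : Set (Fin n → ℝ)} {f0 : Fin n → ℝ} (hf0 : f0 ∈ F)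
    {B : ℝ} (hB : ∀ f ∈ F, ∀ i, |f i| ≤ B) (hpos : 0 < gaussE n F) :
    ENNReal.ofReal (gaussE n F) ≤ ENNReal.ofReal (16 * KK * 48) *
      ∫⁻ t in Set.Ioi (1 / 512 * (n : ℝ) ^ (-(1 / 2 : ℝ)) * gaussE n F), uu F t := by
  have hn' : (0 : ℝ) < n := by exact_mod_cast hn
  have hsn : 0 < √(n : ℝ) := Real.sqrt_pos.2 hn'
  have hL := logBc_pos
  have hKK : 0 < KK := by unfold KK; positivity
  have hrp : (n : ℝ) ^ (-(1 / 2 : ℝ)) = 1 / √n := by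
    rw [Real.rpow_neg hn'.le, ← Real.sqrt_eq_rpow, one_div]
  rw [hrp]
  set E := gaussE n F with hE
  set a := 1 / 512 * (1 / √n) * E with ha
  have ha0 : 0 < a := by positivity
  by_cases hfin : ∫⁻ s in Set.Ioi a, uu F s = ⊤
  · rw [hfin, ENNReal.mul_top (by rw [ne_eq, ENNReal.ofReal_eq_zero, not_le]; positivity)]
    exact le_top
  have hB0 : 0 ≤ B := (abs_nonneg _).trans (hB f0 hf0 ⟨0, hn⟩)
  set Δ := 2 * B + E / √n with hΔ
  have hEn : 0 < E / √n := by positivity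
  have hΔ0 : 0 < Δ := by positivity
  have hF : ∀ f ∈ F, ∑ i, (f i - f0 i) ^ 2 ≤ n * Δ ^ 2 := by
    intro f hf
    calc ∑ i, (f i - f0 i) ^ 2 ≤ ∑ i : Fin n, Δ ^ 2 := by
          apply Finset.sum_le_sum
          intro i _
          rw [sq_le_sq, abs_of_pos hΔ0]
          have := abs_sub (f i) (f0 i)
          linarith [hB f hf i, hB f0 hf0 i]
      _ = n * Δ ^ 2 := by simp
  have hx1 : 1 ≤ 2 * Δ / (E / √n) := by
    rw [le_div_iff₀ hEn]; linarith
  obtain ⟨m, hm1, hm2⟩ := exists_nat_pow_near hx1 (by norm_num : (1 : ℝ) < 2)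
  rw [le_div_iff₀ hEn] at hm1
  rw [div_lt_iff₀ hEn] at hm2
  set J := m + 1 with hJ
  have h2J : (0 : ℝ) < 2 ^ J := by positivity
  have hrJ : Δ * (1 / 2) ^ J = Δ / 2 ^ J := by rw [one_div, inv_pow]; rfl
  have hJ1 : Δ * (1 / 2) ^ J ≤ (E / √n) / 2 := by
    rw [hrJ, div_le_iff₀ h2J]; linarith
  have hJ2 : (E / √n) / 4 ≤ Δ * (1 / 2) ^ J := by
    rw [hrJ, le_div_iff₀ h2J, hJ, pow_succ]; linarith
  have haJ : ∀ j < J, a ≤ 1 / 128 * (Δ * (1 / 2) ^ (j + 1)) := by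
    intro j hj
    have h1 : ((1 : ℝ) / 2) ^ J ≤ (1 / 2) ^ (j + 1) :=
      pow_le_pow_of_le_one (by norm_num) (by norm_num) hj
    have h2 := mul_le_mul_of_nonneg_left h1 hΔ0.le
    have h3 : a = 1 / 128 * ((E / √n) / 4) := by rw [ha]; ring
    linarith
  set lam : ℕ → ℝ := fun j => if j < J then
    (ENNReal.ofReal KK * MM F (Δ * (1 / 2) ^ (j + 1))).toReal / √(Δ * (1 / 2) ^ (j + 1)) else 0
    with hlam
  have hlam0 : ∀ j, 0 ≤ lam j := by
    intro j; simp only [hlam]; split_ifs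
    · positivity
    · exact le_rfl
  have hMf : ∀ j < J, ENNReal.ofReal KK * MM F (Δ * (1 / 2) ^ (j + 1)) ≠ ⊤ := fun j hj =>
    ENNReal.mul_ne_top ENNReal.ofReal_ne_top (MM_fin F (by positivity) (haJ j hj) hfin)
  have hEnt : ∀ j < J, Ent F (Δ * (1 / 2) ^ (j + 1)) (lam j) := by
    intro j hj p hp Q h1 h2 h3
    have hrj : 0 < Δ * (1 / 2) ^ (j + 1) := by positivity
    have h4 := ent_bound hrj h1 h2 h3
    have h5 := (ENNReal.ofReal_le_iff_le_toReal (hMf j hj)).1 h4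
    have h6 : √(Real.log Q.card) ≤ lam j := by
      simp only [hlam]
      rw [if_pos hj, le_div_iff₀ (Real.sqrt_pos.2 hrj)]
      linarith
    have h7 : 0 ≤ Real.log (Q.card : ℝ) := Real.log_natCast_nonneg _
    rw [← Real.sq_sqrt h7]
    exact pow_le_pow_left₀ (Real.sqrt_nonneg _) h6 2
  have hch := gauss_chain hn hΔ0 hf0 hF lam hlam0 J hEnt hpos
  rw [← hE] at hch
  have hJ3 : Δ * (1 / 2) ^ J * √n ≤ E / 2 := by
    refine (mul_le_mul_of_nonneg_right hJ1 hsn.le).trans (le_of_eq ?_)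
    field_simp
  have hE2 : E ≤ 16 * ∑ j ∈ Finset.range J, Δ * (1 / 2) ^ (j + 1) * lam j := by linarith
  have hterm : ∀ j ∈ Finset.range J, ENNReal.ofReal (Δ * (1 / 2) ^ (j + 1) * lam j) =
      ENNReal.ofReal KK * (ENNReal.ofReal (√(Δ * (1 / 2) ^ (j + 1))) *
        MM F (Δ * (1 / 2) ^ (j + 1))) := by
    intro j hj
    have hj' := Finset.mem_range.1 hj
    have hrj : 0 < Δ * (1 / 2) ^ (j + 1) := by positivity
    simp only [hlam]
    rw [if_pos hj']
    set r := Δ * (1 / 2) ^ (j + 1) with hr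
    have hsr := Real.sqrt_pos.2 hrj
    have e : r * ((ENNReal.ofReal KK * MM F r).toReal / √r) =
        √r * (ENNReal.ofReal KK * MM F r).toReal := by
      have : √r * √r = r := Real.mul_self_sqrt hrj.le
      rw [← mul_div_assoc, div_eq_iff hsr.ne']
      nth_rewrite 1 [← this]; ring
    rw [e, ENNReal.ofReal_mul hsr.le, ENNReal.ofReal_toReal (hMf j hj')]
    ring
  calc ENNReal.ofReal E ≤ ENNReal.ofReal (16 * ∑ j ∈ Finset.range J, Δ * (1 / 2) ^ (j + 1) * lam j) :=
        ENNReal.ofReal_le_ofReal hE2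
    _ = ENNReal.ofReal 16 * (ENNReal.ofReal KK * ∑ j ∈ Finset.range J,
        (ENNReal.ofReal (√(Δ * (1 / 2) ^ (j + 1))) * MM F (Δ * (1 / 2) ^ (j + 1)))) := by
        rw [ENNReal.ofReal_mul (by norm_num), ENNReal.ofReal_sum_of_nonneg,
          Finset.sum_congr rfl hterm, ← Finset.mul_sum]
        intro j _
        exact mul_nonneg (by positivity) (hlam0 j)
    _ ≤ ENNReal.ofReal 16 * (ENNReal.ofReal KK * (ENNReal.ofReal 48 * ∫⁻ s in Set.Ioi a, uu F s)) := by
        gcongr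
        exact sum_MM F hΔ0 ha0.le J haJ
    _ = _ := by
        rw [ENNReal.ofReal_mul (by positivity), ENNReal.ofReal_mul (by norm_num)]
        ring

theorem unbounded_main {n : ℕ} {F : Set (Fin n → ℝ)} {f0 : Fin n → ℝ} (hf0 : f0 ∈ F)
    (hB : ¬ ∃ B : ℝ, ∀ f ∈ F, ∀ i, |f i| ≤ B) (a : ℝ) :
    ∫⁻ t in Set.Ioi a, uu F t = ⊤ := by
  have : ∃ i, ∀ B : ℝ, ∃ f ∈ F, B < |f i| := by
    by_contra! hcon
    choose b hb using hcon
    refine hB ⟨∑ i, |b i|, fun f hf i => ?_⟩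
    exact ((hb i f hf).trans (le_abs_self _)).trans
      (Finset.single_le_sum (f := fun i => |b i|) (fun i _ => abs_nonneg _) (Finset.mem_univ i))
  obtain ⟨i, hi⟩ := this
  have hsh : ∀ t : ℝ, Shatters F t {i} := by
    intro t
    have : ∃ f1 ∈ F, ∃ f2 ∈ F, f1 i + t ≤ f2 i := by
      obtain ⟨f, hf, hfi⟩ := hi (|f0 i| + |t|)
      have h1 := le_abs_self t
      have h2 := neg_abs_le (f0 i)
      have h3 := le_abs_self (f0 i)
      rcases le_total 0 (f i) with h | h
      · rw [abs_of_nonneg h] at hfi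
        exact ⟨f0, hf0, f, hf, by linarith⟩
      · rw [abs_of_nonpos h] at hfi
        exact ⟨f, hf, f0, hf0, by linarith⟩
    obtain ⟨f1, hf1, f2, hf2, h12⟩ := this
    refine ⟨f1, fun τ hτ => ?_⟩
    by_cases hiτ : i ∈ τ
    · refine ⟨f2, hf2, ?_, ?_⟩
      · intro x hx hxt
        rw [Finset.mem_singleton.1 hx] at hxt
        exact absurd hiτ hxt
      · intro x hx
        rw [Finset.mem_singleton.1 (hτ hx)]; exact h12
    · refine ⟨f1, hf1, fun x _ _ => le_rfl, ?_⟩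
      intro x hx
      rw [← Finset.mem_singleton.1 (hτ hx)] at hiτ
      exact absurd hx hiτ
  have hone : ∀ t, 1 ≤ uu F t := by
    intro t
    unfold uu
    apply ENNReal.one_le_rpow _ (by norm_num)
    unfold combDim
    exact le_iSup₂_of_le {i} (hsh t) (by simp)
  rw [eq_top_iff]
  calc (⊤ : ℝ≥0∞) = ∫⁻ t in Set.Ioi a, 1 := by simp
    _ ≤ _ := lintegral_mono hone

end final

/-- For every class `F` of functions on `{1,…,n}`,
`E(F) ≤ C·∫₀^∞ √(v(F,t)) dt`; moreover, the lower limit `0` of the integral can be replaced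
by `c·n^{-1/2}·E(F)`. -/
theorem gaussE_le_dimension_integral :
    ∃ C > (0 : ℝ), ∃ c > (0 : ℝ), ∀ (n : ℕ) (F : Set (Fin n → ℝ)),
      ENNReal.ofReal (gaussE n F) ≤
          ENNReal.ofReal C * ∫⁻ t in Set.Ioi (0 : ℝ), (combDim F t) ^ (1/2 : ℝ) ∧
      ENNReal.ofReal (gaussE n F) ≤
          ENNReal.ofReal C *
            ∫⁻ t in Set.Ioi (c * (n : ℝ) ^ (-(1 / 2 : ℝ)) * gaussE n F),
              (combDim F t) ^ (1/2 : ℝ) := by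
  have hL := logBc_pos
  have hKK : 0 < KK := by unfold KK; positivity
  have key : ∀ (n : ℕ) (F : Set (Fin n → ℝ)),
      ENNReal.ofReal (gaussE n F) ≤ ENNReal.ofReal (16 * KK * 48) *
        ∫⁻ t in Set.Ioi (1 / 512 * (n : ℝ) ^ (-(1 / 2 : ℝ)) * gaussE n F), uu F t := by
    intro n F
    rcases le_or_gt (gaussE n F) 0 with h0 | hpos
    · rw [ENNReal.ofReal_of_nonpos h0]; exact bot_le
    rcases F.eq_empty_or_nonempty with rfl | ⟨f0, hf0⟩
    · simp [gaussE] at hpos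
    rcases Nat.eq_zero_or_pos n with rfl | hn
    · simp [gaussE] at hpos
    by_cases hB : ∃ B : ℝ, ∀ f ∈ F, ∀ i, |f i| ≤ B
    · obtain ⟨B, hB⟩ := hB
      exact bounded_main hn hf0 hB hpos
    · rw [unbounded_main hf0 hB,
        ENNReal.mul_top (by rw [ne_eq, ENNReal.ofReal_eq_zero, not_le]; positivity)]
      exact le_top
  refine ⟨16 * KK * 48, by positivity, 1 / 512, by norm_num, fun n F => ⟨?_, key n F⟩⟩
  rcases le_or_gt (gaussE n F) 0 with h0 | hpos
  · rw [ENNReal.ofReal_of_nonpos h0]; exact bot_le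
  refine (key n F).trans ?_
  refine mul_le_mul_right ?_ _
  have : (0 : ℝ) ≤ 1 / 512 * (n : ℝ) ^ (-(1 / 2 : ℝ)) * gaussE n F := by positivity
  exact lintegral_mono_set (Set.Ioi_subset_Ioi this)
end

section
/- Let K be a symmetric convex body in ℝ^n containing the unit Euclidean ball B₂^n, and let M = c·M_K·(log(2/M_K))^{−3/2} for a suitable absolute constant c > 0. Then there exists a subset σ of {1,…,n} with |σ| ≥ M²·n such that M·(K ∩ ℝ^σ) ⊆ √|σ|·B₁^σ. -/
open MeasureTheory
open scoped ENNReal NNReal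

lemma csb_tail (k : ℕ) : ∑ j ∈ Finset.range k, (2 * (j:ℝ) + 1) / 2 ^ j ≤ 6 - (4 * k + 6) / 2 ^ k := by
  induction k with
  | zero => simp
  | succ k ih =>
    rw [Finset.sum_range_succ]
    have h2 : (0:ℝ) < 2 ^ k := by positivity
    have : (6 - (4 * ((k+1 : ℕ):ℝ) + 6) / 2 ^ (k+1)) - (6 - (4 * (k:ℝ) + 6) / 2 ^ k) = (2 * (k:ℝ) + 1) / 2 ^ k := by
      push_cast; field_simp; ring
    linarith

lemma csb_sqrt_split (N B p q : ℝ) (hN : 0 ≤ N) (hB : 0 ≤ B) (hBN : B ≤ N / 2) (hq : N - B ≤ q) (hp : B / 2 ≤ p) :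
    √N ≤ √p + √q := by
  apply Real.sqrt_le_iff.2 ⟨by positivity, ?_⟩
  have hp0 : 0 ≤ p := by linarith
  have hq0 : 0 ≤ q := by linarith
  have h1 := Real.sq_sqrt hp0
  have h2 := Real.sq_sqrt hq0
  have h3 : B / 2 ≤ √p * √q := by
    rw [← Real.sqrt_mul hp0]
    apply Real.le_sqrt_of_sq_le
    nlinarith
  nlinarith

lemma csb_oneside {α : Type*} (A : Finset α) (f : α → ℝ) (m : ℤ)
    (hm : ((A.filter (fun x => (m:ℝ) + 1 ≤ f x)).card : ℝ) ≤ (A.card : ℝ) / 2)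
    (hns : ∀ h : ℤ, (A.filter (fun x => (h:ℝ) + 1 ≤ f x)).Nonempty → (A.filter (fun x => f x ≤ h)).Nonempty →
      √((A.filter (fun x => (h:ℝ) + 1 ≤ f x)).card : ℝ) + √((A.filter (fun x => f x ≤ h)).card : ℝ) < √(A.card : ℝ)) :
    ∑ x ∈ A, (max (f x - m) 0) ^ 2 ≤ 6 * A.card := by
  classical
  -- tail bound
  have tail : ∀ j : ℕ, ((A.filter (fun x => (m:ℝ) + 1 + j ≤ f x)).card : ℝ) ≤ (A.card : ℝ) / 2 ^ (j+1) := by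
    intro j
    induction j with
    | zero => simpa using hm
    | succ j ih =>
      set h : ℤ := m + 1 + j with hh
      have hcast : (h:ℝ) = m + 1 + j := by push_cast [hh]; ring
      have e1 : A.filter (fun x => (m:ℝ) + 1 + ((j+1:ℕ):ℝ) ≤ f x) = A.filter (fun x => (h:ℝ) + 1 ≤ f x) := by
        apply Finset.filter_congr; intro x _; rw [hcast]; push_cast; constructor <;> intro h <;> linarith
      rw [e1]
      set P := A.filter (fun x => (h:ℝ) + 1 ≤ f x)
      set Q := A.filter (fun x => f x ≤ h)
      set Bs := A.filter (fun x => ¬ f x ≤ h)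
      have hQB : (Q.card : ℝ) + Bs.card = A.card := by
        exact_mod_cast Finset.card_filter_add_card_filter_not (s := A) (fun x => f x ≤ h)
      have hBle : (Bs.card : ℝ) ≤ (A.card : ℝ) / 2 ^ (j+1) := by
        refine le_trans ?_ ih
        exact Nat.cast_le.2 <| Finset.card_le_card (by
          intro x hx
          simp only [Bs, Finset.mem_filter] at hx ⊢
          refine ⟨hx.1, ?_⟩
          rw [← hcast]; linarith [hx.2])
      have hpow : (A.card : ℝ) / 2 ^ (j+1) ≤ A.card / 2 := by
        apply div_le_div_of_nonneg_left (by positivity) (by norm_num)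
        have : (1:ℝ) ≤ 2 ^ j := one_le_pow₀ (by norm_num)
        rw [pow_succ]; linarith
      by_contra hcon
      push Not at hcon
      have hPB : (Bs.card : ℝ) / 2 ≤ P.card := by
        have : (A.card : ℝ) / 2 ^ (j+1+1) = (A.card : ℝ) / 2 ^ (j+1) / 2 := by
          rw [pow_succ _ (j+1)]; field_simp
        linarith
      have hPpos : 0 < (P.card : ℝ) := lt_of_le_of_lt (by positivity) hcon
      have hPne : P.Nonempty := Finset.card_pos.1 (by exact_mod_cast hPpos)
      have hApos : 0 < (A.card : ℝ) := by
        have : (P.card : ℝ) ≤ A.card := by exact_mod_cast Finset.card_le_card (Finset.filter_subset _ _)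
        linarith
      have hQne : Q.Nonempty := Finset.card_pos.1 (by
        have : 0 < (Q.card : ℝ) := by linarith
        exact_mod_cast this)
      have := hns h hPne hQne
      have := csb_sqrt_split A.card Bs.card P.card Q.card (by positivity) (by positivity) (by linarith) (by linarith) hPB
      linarith
  have tail' : ∀ j : ℕ, ((A.filter (fun x => (j:ℝ) ≤ f x - m ∧ 0 ≤ f x - m)).card : ℝ) ≤ (A.card : ℝ) / 2 ^ j := by
    intro j
    cases j with
    | zero => simp only [pow_zero, div_one]; exact_mod_cast Finset.card_le_card (Finset.filter_subset _ _)
    | succ j =>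
      refine le_trans ?_ (tail j)
      exact Nat.cast_le.2 <| Finset.card_le_card (by
        intro x hx
        simp only [Finset.mem_filter] at hx ⊢
        refine ⟨hx.1, ?_⟩
        have := hx.2.1; push_cast at this; linarith)
  obtain ⟨J, hJ⟩ : ∃ J : ℕ, ∀ x ∈ A, ⌊f x - m⌋₊ < J := by
    refine ⟨A.sup (fun x => ⌊f x - m⌋₊) + 1, fun x hx => ?_⟩
    have := Finset.le_sup (f := fun x => ⌊f x - m⌋₊) hx
    exact Nat.lt_succ_of_le this
  have pt : ∀ x ∈ A, (max (f x - m) 0) ^ 2 ≤ ∑ j ∈ Finset.range J, if ((j:ℝ) ≤ f x - m ∧ 0 ≤ f x - m) then (2 * (j:ℝ) + 1) else 0 := by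
    intro x hx
    by_cases h0 : 0 ≤ f x - m
    · rw [max_eq_left h0]
      set k := ⌊f x - m⌋₊
      have hk : f x - m < k + 1 := Nat.lt_floor_add_one _
      have hs : ∀ k : ℕ, ∑ j ∈ Finset.range k, (2 * (j:ℝ) + 1) = (k:ℝ)^2 := by
        intro k
        induction k with
        | zero => simp
        | succ k ih => rw [Finset.sum_range_succ, ih]; push_cast; ring
      calc (f x - m)^2 ≤ ((k+1 : ℕ):ℝ)^2 := by push_cast; gcongr
        _ = ∑ j ∈ Finset.range (k+1), (2 * (j:ℝ) + 1) := (hs _).symm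
        _ = ∑ j ∈ Finset.range (k+1), if ((j:ℝ) ≤ f x - m ∧ 0 ≤ f x - m) then (2 * (j:ℝ) + 1) else 0 := by
          apply Finset.sum_congr rfl
          intro j hj
          rw [if_pos]
          refine ⟨?_, h0⟩
          have : j ≤ k := by simpa [Nat.lt_succ_iff] using hj
          exact le_trans (by exact_mod_cast this) (Nat.floor_le h0)
        _ ≤ _ := by
          apply Finset.sum_le_sum_of_subset_of_nonneg
          · apply Finset.range_mono; exact hJ x hx
          · intros; split_ifs <;> positivity
    · rw [max_eq_right (by linarith)]
      simp only [ne_eq, OfNat.ofNat_ne_zero, not_false_eq_true, zero_pow]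
      apply Finset.sum_nonneg; intros; split_ifs <;> positivity
  calc ∑ x ∈ A, (max (f x - m) 0) ^ 2 ≤ ∑ x ∈ A, ∑ j ∈ Finset.range J, (if ((j:ℝ) ≤ f x - m ∧ 0 ≤ f x - m) then (2 * (j:ℝ) + 1) else 0) := Finset.sum_le_sum pt
    _ = ∑ j ∈ Finset.range J, (2 * (j:ℝ) + 1) * ((A.filter (fun x => (j:ℝ) ≤ f x - m ∧ 0 ≤ f x - m)).card : ℝ) := by
      rw [Finset.sum_comm]
      apply Finset.sum_congr rfl
      intro j _
      rw [← Finset.sum_filter, Finset.sum_const, nsmul_eq_mul, mul_comm]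
    _ ≤ ∑ j ∈ Finset.range J, (2 * (j:ℝ) + 1) * ((A.card : ℝ) / 2 ^ j) := by
      apply Finset.sum_le_sum; intro j _
      exact mul_le_mul_of_nonneg_left (tail' j) (by positivity)
    _ = A.card * ∑ j ∈ Finset.range J, (2 * (j:ℝ) + 1) / 2 ^ j := by
      rw [Finset.mul_sum]; apply Finset.sum_congr rfl; intro j _; ring
    _ ≤ A.card * 6 := by
      apply mul_le_mul_of_nonneg_left _ (by positivity)
      have := csb_tail J
      have h : (0:ℝ) ≤ (4 * J + 6) / 2 ^ J := by positivity
      linarith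
    _ = _ := by ring

lemma csb_split {α : Type*} (A : Finset α) (hA : A.Nonempty) (f : α → ℝ)
    (hns : ∀ h : ℤ, (A.filter (fun x => (h:ℝ) + 1 ≤ f x)).Nonempty → (A.filter (fun x => f x ≤ h)).Nonempty →
      √((A.filter (fun x => (h:ℝ) + 1 ≤ f x)).card : ℝ) + √((A.filter (fun x => f x ≤ h)).card : ℝ) < √(A.card : ℝ)) :
    ∑ x ∈ A, ∑ y ∈ A, (f x - f y) ^ 2 ≤ 48 * (A.card : ℝ) ^ 2 := by
  classical
  have hApos : 0 < (A.card : ℝ) := by exact_mod_cast hA.card_pos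
  obtain ⟨m, hm1, hm2⟩ := Int.exists_greatest_of_bdd
    (P := fun m : ℤ => (A.card : ℝ) / 2 < ((A.filter (fun x => (m:ℝ) ≤ f x)).card : ℝ))
    (by
      refine ⟨⌈A.sup' hA f⌉ , fun z hz => ?_⟩
      by_contra hlt
      push Not at hlt
      have : A.filter (fun x => (z:ℝ) ≤ f x) = ∅ := by
        apply Finset.filter_eq_empty_iff.2
        intro x hx
        have h1 := Finset.le_sup' f hx
        have h2 := Int.le_ceil (A.sup' hA f)
        have h3 : ((⌈A.sup' hA f⌉ : ℤ) : ℝ) < z := by exact_mod_cast hlt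
        linarith
      rw [this] at hz
      simp at hz; linarith)
    (by
      refine ⟨⌊A.inf' hA f⌋, ?_⟩
      have : A.filter (fun x => ((⌊A.inf' hA f⌋ : ℤ) : ℝ) ≤ f x) = A := by
        apply Finset.filter_true_of_mem
        intro x hx
        exact (Int.floor_le _).trans (Finset.inf'_le f hx)
      rw [this]; linarith)
  have u1 := csb_oneside A f m (by
    by_contra hcon
    push Not at hcon
    have := hm2 (m+1) (by push_cast; exact hcon)
    omega) hns
  have u2 := csb_oneside A (fun x => - f x) (-m) (by
    have h1 : ((A.filter (fun x => (m:ℝ) ≤ f x)).card : ℝ) + (A.filter (fun x => ¬ (m:ℝ) ≤ f x)).card = A.card := by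
      exact_mod_cast Finset.card_filter_add_card_filter_not (s := A) (fun x => (m:ℝ) ≤ f x)
    have h2 : ((A.filter (fun x => ((-m:ℤ):ℝ) + 1 ≤ - f x)).card : ℝ) ≤ (A.filter (fun x => ¬ (m:ℝ) ≤ f x)).card := by
      exact Nat.cast_le.2 <| Finset.card_le_card (by
        intro x hx
        simp only [Finset.mem_filter] at hx ⊢
        refine ⟨hx.1, ?_⟩
        have := hx.2; push_cast at this; linarith)
    linarith) (by
    intro h
    have e1 : A.filter (fun x => (h:ℝ) + 1 ≤ - f x) = A.filter (fun x => f x ≤ ((-h-1 : ℤ):ℝ)) := by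
      apply Finset.filter_congr; intro x _; push_cast; constructor <;> intro h <;> linarith
    have e2 : A.filter (fun x => - f x ≤ h) = A.filter (fun x => ((-h-1 : ℤ):ℝ) + 1 ≤ f x) := by
      apply Finset.filter_congr; intro x _; push_cast; constructor <;> intro h <;> linarith
    rw [e1, e2]
    intro a b
    rw [add_comm]
    exact hns _ b a)
  have hsum : ∑ x ∈ A, (f x - m) ^ 2 ≤ 12 * A.card := by
    have : ∑ x ∈ A, (f x - m) ^ 2 ≤ ∑ x ∈ A, ((max (f x - m) 0) ^ 2 + (max (- f x - ((-m:ℤ):ℝ)) 0) ^ 2) := by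
      apply Finset.sum_le_sum
      intro x _
      push_cast
      rcases le_total 0 (f x - m) with h | h
      · rw [max_eq_left h]; nlinarith [sq_nonneg (max (- f x - -(m:ℝ)) 0)]
      · rw [max_eq_left (a := - f x - -(m:ℝ)) (by linarith)]; nlinarith [sq_nonneg (max (f x - (m:ℝ)) 0)]
    rw [Finset.sum_add_distrib] at this
    linarith
  calc ∑ x ∈ A, ∑ y ∈ A, (f x - f y) ^ 2 ≤ ∑ x ∈ A, ∑ y ∈ A, (2 * (f x - m)^2 + 2 * (f y - m)^2) := by
        apply Finset.sum_le_sum; intro x _; apply Finset.sum_le_sum; intro y _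
        nlinarith [sq_nonneg ((f x - m) + (f y - m))]
    _ = 4 * A.card * ∑ x ∈ A, (f x - m) ^ 2 := by
        simp only [Finset.sum_add_distrib, Finset.sum_const, nsmul_eq_mul, ← Finset.mul_sum]
        ring
    _ ≤ 4 * A.card * (12 * A.card) := by gcongr
    _ = _ := by ring

def csbSh {n : ℕ} (δ : ℝ) (A : Finset (EuclideanSpace ℝ (Fin n))) (φ : Fin n → Option ℤ) : Prop :=
  ∀ ω : Fin n → Bool, ∃ x ∈ A, ∀ i h, φ i = some h →
    (ω i = true → (h:ℝ) + 1 ≤ x i / δ) ∧ (ω i = false → x i / δ ≤ h)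

open Classical in
noncomputable def csbS {n : ℕ} (R : ℕ) (δ : ℝ) (A : Finset (EuclideanSpace ℝ (Fin n))) :
    Finset (Fin n → Option ℤ) :=
  (Fintype.piFinset (fun _ => Finset.insertNone (Finset.Icc (-(R:ℤ)) R))).filter (csbSh δ A)

lemma csbS_mem {n : ℕ} {R : ℕ} {δ : ℝ} {A : Finset (EuclideanSpace ℝ (Fin n))} {φ : Fin n → Option ℤ} :
    φ ∈ csbS R δ A ↔ (∀ i, φ i ∈ Finset.insertNone (Finset.Icc (-(R:ℤ)) R)) ∧ csbSh δ A φ := by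
  classical
  simp only [csbS, Finset.mem_filter, Fintype.mem_piFinset]

lemma csbSh_mono {n : ℕ} {δ : ℝ} {A B : Finset (EuclideanSpace ℝ (Fin n))} (h : A ⊆ B) {φ : Fin n → Option ℤ}
    (hA : csbSh δ A φ) : csbSh δ B φ := by
  intro ω
  obtain ⟨x, hx, h'⟩ := hA ω
  exact ⟨x, h hx, h'⟩

lemma csb_step {n : ℕ} (R : ℕ) (δ : ℝ) (A P Q : Finset (EuclideanSpace ℝ (Fin n))) (i₀ : Fin n) (h : ℤ)
    (hR : h ∈ Finset.Icc (-(R:ℤ)) R)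
    (hPA : P ⊆ A) (hQA : Q ⊆ A) (hP : ∀ x ∈ P, (h:ℝ) + 1 ≤ x i₀ / δ) (hQ : ∀ x ∈ Q, x i₀ / δ ≤ h) :
    (csbS R δ P).card + (csbS R δ Q).card ≤ (csbS R δ A).card := by
  classical
  have hnone : ∀ φ ∈ csbS R δ P ∩ csbS R δ Q, φ i₀ = none := by
    intro φ hφ
    rw [Finset.mem_inter, csbS_mem, csbS_mem] at hφ
    by_contra hne
    obtain ⟨h', hh'⟩ := Option.ne_none_iff_exists'.1 hne
    obtain ⟨x, hx, hx'⟩ := hφ.1.2 (fun _ => false)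
    obtain ⟨y, hy, hy'⟩ := hφ.2.2 (fun _ => true)
    have h1 := (hx' i₀ h' hh').2 rfl
    have h2 := (hy' i₀ h' hh').1 rfl
    have h3 := hP x hx
    have h4 := hQ y hy
    linarith
  let g : (Fin n → Option ℤ) → (Fin n → Option ℤ) := fun φ => Function.update φ i₀ (some h)
  have hinj : Set.InjOn g (csbS R δ P ∩ csbS R δ Q : Finset _) := by
    intro φ hφ ψ hψ e
    have h1 := hnone φ hφ
    have h2 := hnone ψ hψ
    funext i
    by_cases hi : i = i₀
    · rw [hi, h1, h2]
    · have := congrFun e i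
      simpa [g, hi] using this
  have hdisj : Disjoint (csbS R δ P ∪ csbS R δ Q) ((csbS R δ P ∩ csbS R δ Q).image g) := by
    rw [Finset.disjoint_left]
    intro φ hφ hφ'
    rw [Finset.mem_image] at hφ'
    obtain ⟨ψ, _, rfl⟩ := hφ'
    have hs : g ψ i₀ = some h := by simp [g]
    rw [Finset.mem_union, csbS_mem, csbS_mem] at hφ
    rcases hφ with hφ | hφ
    · obtain ⟨x, hx, hx'⟩ := hφ.2 (fun _ => false)
      have h1 := (hx' i₀ h hs).2 rfl
      have h3 := hP x hx
      linarith
    · obtain ⟨x, hx, hx'⟩ := hφ.2 (fun _ => true)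
      have h1 := (hx' i₀ h hs).1 rfl
      have h3 := hQ x hx
      linarith
  have hsub : (csbS R δ P ∪ csbS R δ Q) ∪ ((csbS R δ P ∩ csbS R δ Q).image g) ⊆ csbS R δ A := by
    intro φ hφ
    rw [Finset.mem_union, Finset.mem_union] at hφ
    rcases hφ with (hφ | hφ) | hφ
    · rw [csbS_mem] at hφ ⊢; exact ⟨hφ.1, csbSh_mono hPA hφ.2⟩
    · rw [csbS_mem] at hφ ⊢; exact ⟨hφ.1, csbSh_mono hQA hφ.2⟩
    · rw [Finset.mem_image] at hφ
      obtain ⟨ψ, hψ, rfl⟩ := hφ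
      rw [Finset.mem_inter, csbS_mem, csbS_mem] at hψ
      rw [csbS_mem]
      constructor
      · intro i
        by_cases hi : i = i₀
        · subst hi; simp only [g, Function.update_self]; exact Finset.some_mem_insertNone.2 hR
        · simp only [g, Function.update_of_ne hi]; exact hψ.1.1 i
      · intro ω
        cases hω : ω i₀ with
        | true =>
          obtain ⟨x, hx, hx'⟩ := hψ.1.2 ω
          refine ⟨x, hPA hx, fun i k hk => ?_⟩
          by_cases hi : i = i₀
          · subst hi
            simp only [g, Function.update_self, Option.some.injEq] at hk
            subst hk
            exact ⟨fun _ => hP x hx, fun hh => by simp [hω] at hh⟩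
          · simp only [g, Function.update_of_ne hi] at hk
            exact hx' i k hk
        | false =>
          obtain ⟨x, hx, hx'⟩ := hψ.2.2 ω
          refine ⟨x, hQA hx, fun i k hk => ?_⟩
          by_cases hi : i = i₀
          · subst hi
            simp only [g, Function.update_self, Option.some.injEq] at hk
            subst hk
            exact ⟨fun hh => by simp [hω] at hh, fun _ => hQ x hx⟩
          · simp only [g, Function.update_of_ne hi] at hk
            exact hx' i k hk
  have := Finset.card_le_card hsub
  rw [Finset.card_union_of_disjoint hdisj, Finset.card_image_of_injOn hinj, Finset.card_union_add_card_inter] at this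
  exact this

lemma csb_lower {n : ℕ} (R : ℕ) (δ η : ℝ) (hδ : 0 < δ) (hη : 0 < η) (hδη : 96 * n * δ ^ 2 < η ^ 2) :
    ∀ (N : ℕ) (A : Finset (EuclideanSpace ℝ (Fin n))), A.card = N → A.Nonempty →
    (∀ x ∈ A, ∀ i, |x i / δ| ≤ R) → (∀ x ∈ A, ∀ y ∈ A, x ≠ y → η ≤ ‖x - y‖) →
    √(A.card : ℝ) ≤ (csbS R δ A).card := by
  classical
  intro N
  induction N using Nat.strong_induction_on with
  | _ N ih =>
  intro A hAN hA hR hsep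
  by_cases h1 : A.card = 1
  · obtain ⟨x, hx⟩ := hA
    have : 1 ≤ (csbS R δ A).card := by
      apply Finset.card_pos.2
      refine ⟨fun _ => none, ?_⟩
      rw [csbS_mem]
      refine ⟨fun i => Finset.none_mem_insertNone, fun ω => ⟨x, hx, fun i k hk => by simp at hk⟩⟩
    rw [h1]; simp only [Nat.cast_one, Real.sqrt_one]; exact_mod_cast this
  have h2 : 2 ≤ A.card := by have := hA.card_pos; omega
  have h2' : (2:ℝ) ≤ A.card := by exact_mod_cast h2
  -- find split
  have hex : ∃ (i : Fin n) (h : ℤ), (A.filter (fun x => (h:ℝ) + 1 ≤ x i / δ)).Nonempty ∧ (A.filter (fun x => x i / δ ≤ h)).Nonempty ∧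
      √(A.card : ℝ) ≤ √((A.filter (fun x => (h:ℝ) + 1 ≤ x i / δ)).card : ℝ) + √((A.filter (fun x => x i / δ ≤ h)).card : ℝ) := by
    by_contra hcon
    push Not at hcon
    have hc : ∀ i : Fin n, ∑ x ∈ A, ∑ y ∈ A, (x i / δ - y i / δ) ^ 2 ≤ 48 * (A.card : ℝ) ^ 2 := by
      intro i
      exact csb_split A hA (fun x => x i / δ) (fun h a b => hcon i h a b)
    have hup : ∑ x ∈ A, ∑ y ∈ A, ‖x - y‖ ^ 2 ≤ n * δ ^ 2 * (48 * (A.card : ℝ) ^ 2) := by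
      calc ∑ x ∈ A, ∑ y ∈ A, ‖x - y‖ ^ 2 = ∑ x ∈ A, ∑ y ∈ A, ∑ i, δ ^ 2 * (x i / δ - y i / δ) ^ 2 := by
            apply Finset.sum_congr rfl; intro x _; apply Finset.sum_congr rfl; intro y _
            rw [EuclideanSpace.real_norm_sq_eq]
            apply Finset.sum_congr rfl; intro i _
            simp only [PiLp.sub_apply]; field_simp
        _ = ∑ i, δ ^ 2 * ∑ x ∈ A, ∑ y ∈ A, (x i / δ - y i / δ) ^ 2 := by
            simp only [Finset.mul_sum]
            rw [Finset.sum_comm]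
            rw [Finset.sum_congr rfl (fun y _ => Finset.sum_comm)]
            rw [Finset.sum_comm]
            apply Finset.sum_congr rfl; intro i _
            rw [Finset.sum_comm]
        _ ≤ ∑ i : Fin n, δ ^ 2 * (48 * (A.card : ℝ) ^ 2) := by
            apply Finset.sum_le_sum; intro i _
            exact mul_le_mul_of_nonneg_left (hc i) (by positivity)
        _ = _ := by simp; ring
    have hlo : η ^ 2 * (A.card * (A.card - 1)) ≤ ∑ x ∈ A, ∑ y ∈ A, ‖x - y‖ ^ 2 := by
      have : ∀ x ∈ A, η ^ 2 * ((A.card : ℝ) - 1) ≤ ∑ y ∈ A, ‖x - y‖ ^ 2 := by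
        intro x hx
        rw [← Finset.add_sum_erase A _ hx]
        have hle : ∑ y ∈ A.erase x, η ^ 2 ≤ ∑ y ∈ A.erase x, ‖x - y‖ ^ 2 := by
          apply Finset.sum_le_sum
          intro y hy
          have := hsep x hx y (Finset.mem_of_mem_erase hy) (Finset.ne_of_mem_erase hy).symm
          gcongr
        rw [Finset.sum_const, Finset.card_erase_of_mem hx, nsmul_eq_mul, Nat.cast_sub (by omega)] at hle
        have := sq_nonneg ‖x - x‖
        push_cast at hle
        linarith
      have := Finset.sum_le_sum this
      rw [Finset.sum_const, nsmul_eq_mul] at this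
      linarith
    have h3 : η ^ 2 * ((A.card : ℝ) ^ 2 / 2) ≤ η ^ 2 * (A.card * (A.card - 1)) := by
      gcongr; nlinarith
    have h4 : 0 < (A.card : ℝ) ^ 2 := by positivity
    nlinarith
  obtain ⟨i, h, hPne, hQne, hle⟩ := hex
  set P := A.filter (fun x => (h:ℝ) + 1 ≤ x i / δ) with hPdef
  set Q := A.filter (fun x => x i / δ ≤ h) with hQdef
  have hPA : P ⊆ A := Finset.filter_subset _ _
  have hQA : Q ⊆ A := Finset.filter_subset _ _
  have hP : ∀ x ∈ P, (h:ℝ) + 1 ≤ x i / δ := fun x hx => (Finset.mem_filter.1 hx).2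
  have hQ : ∀ x ∈ Q, x i / δ ≤ h := fun x hx => (Finset.mem_filter.1 hx).2
  obtain ⟨p, hp⟩ := hPne
  obtain ⟨q, hq⟩ := hQne
  have hPlt : P.card < A.card := by
    apply Finset.card_lt_card
    refine ⟨hPA, fun hs => ?_⟩
    have := hP q (hs (hQA hq)); have := hQ q hq; linarith
  have hQlt : Q.card < A.card := by
    apply Finset.card_lt_card
    refine ⟨hQA, fun hs => ?_⟩
    have := hQ p (hs (hPA hp)); have := hP p hp; linarith
  have hRI : h ∈ Finset.Icc (-(R:ℤ)) R := by
    rw [Finset.mem_Icc]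
    have a1 := abs_le.1 (hR p (hPA hp) i)
    have a2 := abs_le.1 (hR q (hQA hq) i)
    have a3 := hP p hp
    have a4 := hQ q hq
    constructor
    · have : (-(R:ℝ)) ≤ h := by linarith
      exact_mod_cast this
    · have : (h:ℝ) ≤ R := by linarith
      exact_mod_cast this
  have e1 := ih P.card (by omega) P rfl ⟨p, hp⟩ (fun x hx => hR x (hPA hx)) (fun x hx y hy => hsep x (hPA hx) y (hPA hy))
  have e2 := ih Q.card (by omega) Q rfl ⟨q, hq⟩ (fun x hx => hR x (hQA hx)) (fun x hx y hy => hsep x (hQA hx) y (hQA hy))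
  have e3 : ((csbS R δ P).card : ℝ) + (csbS R δ Q).card ≤ (csbS R δ A).card := by
    exact_mod_cast csb_step R δ A P Q i h hRI hPA hQA hP hQ
  linarith

lemma csb_geom (R : ℕ) (a : ℝ) (ha : 0 < a) (ha1 : a ≤ 1) :
    ∑ h ∈ Finset.Icc (-(R:ℤ)) R, Real.exp (-a * |(h:ℝ)|) ≤ 4 / a := by
  classical
  set r := Real.exp (-a) with hr
  have hr0 : 0 ≤ r := (Real.exp_pos _).le
  have hr1 : r ≤ 1 - a / 2 := by
    have h1 := Real.abs_exp_sub_one_sub_id_le (x := -a) (by rw [abs_neg, abs_of_pos ha]; exact ha1)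
    have h2 := (abs_le.1 h1).2
    -- use the bound exp(-a) ≤ 1/(1+a)
    have h3 : (1 + a) * r ≤ 1 := by
      have := Real.add_one_le_exp a
      calc (1 + a) * r ≤ Real.exp a * r := by gcongr; linarith
        _ = 1 := by rw [hr, ← Real.exp_add]; simp
    nlinarith
  have hg : ∑ k ∈ Finset.range (R+1), r ^ k ≤ 2 / a := by
    have h1 : (∑ k ∈ Finset.range (R+1), r ^ k) * (1 - r) = 1 - r ^ (R+1) := by
      have := geom_sum_mul r (R+1); linarith
    have h2 : 0 ≤ r ^ (R+1) := by positivity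
    have h0 : 0 ≤ ∑ k ∈ Finset.range (R+1), r ^ k := Finset.sum_nonneg (fun _ _ => by positivity)
    rw [le_div_iff₀ ha]
    nlinarith
  have hsub : Finset.Icc (-(R:ℤ)) R ⊆ (Finset.range (R+1)).image (fun k : ℕ => (k:ℤ)) ∪ (Finset.range (R+1)).image (fun k : ℕ => -(k:ℤ)) := by
    intro h hh
    rw [Finset.mem_Icc] at hh
    simp only [Finset.mem_union, Finset.mem_image, Finset.mem_range]
    rcases le_total 0 h with h0 | h0
    · left; exact ⟨h.toNat, by omega, by omega⟩
    · right; exact ⟨(-h).toNat, by omega, by omega⟩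
  have hpow : ∀ k : ℕ, Real.exp (-a * (k:ℝ)) = r ^ k := by
    intro k; rw [hr, ← Real.exp_nat_mul]; ring_nf
  calc ∑ h ∈ Finset.Icc (-(R:ℤ)) R, Real.exp (-a * |(h:ℝ)|)
      ≤ ∑ h ∈ (Finset.range (R+1)).image (fun k : ℕ => (k:ℤ)) ∪ (Finset.range (R+1)).image (fun k : ℕ => -(k:ℤ)), Real.exp (-a * |(h:ℝ)|) :=
        Finset.sum_le_sum_of_subset_of_nonneg hsub (fun _ _ _ => (Real.exp_pos _).le)
    _ ≤ ∑ h ∈ (Finset.range (R+1)).image (fun k : ℕ => (k:ℤ)), Real.exp (-a * |(h:ℝ)|) + ∑ h ∈ (Finset.range (R+1)).image (fun k : ℕ => -(k:ℤ)), Real.exp (-a * |(h:ℝ)|) := by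
        rw [← Finset.sum_union_inter]
        have : 0 ≤ ∑ h ∈ (Finset.range (R+1)).image (fun k : ℕ => (k:ℤ)) ∩ (Finset.range (R+1)).image (fun k : ℕ => -(k:ℤ)), Real.exp (-a * |(h:ℝ)|) := Finset.sum_nonneg (fun _ _ => (Real.exp_pos _).le)
        linarith
    _ = ∑ k ∈ Finset.range (R+1), r ^ k + ∑ k ∈ Finset.range (R+1), r ^ k := by
        rw [Finset.sum_image (by intro x _ y _ h; simpa using h), Finset.sum_image (by intro x _ y _ h; simpa using h)]
        simp only [Int.cast_neg, abs_neg, Int.cast_natCast, Nat.abs_cast, hpow]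
    _ ≤ 2 / a + 2 / a := by gcongr
    _ = 4 / a := by ring

lemma csb_upper {n : ℕ} (R : ℕ) (δ a b u D : ℝ) (A : Finset (EuclideanSpace ℝ (Fin n)))
    (ha : 0 < a) (ha1 : a ≤ 1) (hb : 0 < b) (hb1 : b ≤ 1)
    (hu : ∀ φ, csbSh δ A φ → ∑ i, (φ i).elim (0:ℝ) (fun _ => 1) ≤ u)
    (hD : ∀ φ, csbSh δ A φ → ∑ i, (φ i).elim (0:ℝ) (fun h => |(h:ℝ)|) ≤ D) :
    ((csbS R δ A).card : ℝ) ≤ Real.exp (-Real.log b * u + a * D + 4 * b / a * n) := by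
  classical
  let w : Option ℤ → ℝ := fun o => Real.exp (Real.log b * o.elim (0:ℝ) (fun _ => 1) - a * o.elim (0:ℝ) (fun h => |(h:ℝ)|))
  have hlb : Real.log b ≤ 0 := Real.log_nonpos hb.le hb1
  have h1 : ∀ φ ∈ csbS R δ A, Real.exp (Real.log b * u - a * D) ≤ ∏ i, w (φ i) := by
    intro φ hφ
    rw [csbS_mem] at hφ
    simp only [w]
    rw [← Real.exp_sum, Finset.sum_sub_distrib, ← Finset.mul_sum, ← Finset.mul_sum]
    apply Real.exp_le_exp.2
    have h1 := hu φ hφ.2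
    have h2 := hD φ hφ.2
    nlinarith
  have h2 : ∑ φ ∈ csbS R δ A, ∏ i, w (φ i) ≤ ∏ i : Fin n, ∑ o ∈ Finset.insertNone (Finset.Icc (-(R:ℤ)) R), w o := by
    rw [Finset.prod_univ_sum]
    apply Finset.sum_le_sum_of_subset_of_nonneg
    · exact Finset.filter_subset _ _
    · intros; exact Finset.prod_nonneg (fun _ _ => (Real.exp_pos _).le)
  have h3 : ∑ o ∈ Finset.insertNone (Finset.Icc (-(R:ℤ)) R), w o ≤ Real.exp (4 * b / a) := by
    rw [Finset.sum_insertNone]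
    have e : ∀ h : ℤ, w (some h) = b * Real.exp (-a * |(h:ℝ)|) := by
      intro h
      simp only [w, Option.elim_some, mul_one, sub_eq_add_neg, Real.exp_add, Real.exp_log hb]
      ring_nf
    simp only [e, ← Finset.mul_sum]
    have e0 : w none = 1 := by simp [w]
    rw [e0]
    have := csb_geom R a ha ha1
    have h4 := Real.add_one_le_exp (4 * b / a)
    have : b * ∑ h ∈ Finset.Icc (-(R:ℤ)) R, Real.exp (-a * |(h:ℝ)|) ≤ b * (4 / a) := by gcongr
    have e5 : b * (4 / a) = 4 * b / a := by ring
    linarith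
  have h4 : ∏ i : Fin n, ∑ o ∈ Finset.insertNone (Finset.Icc (-(R:ℤ)) R), w o ≤ Real.exp (4 * b / a * n) := by
    rw [Finset.prod_const, Finset.card_univ, Fintype.card_fin, mul_comm _ (n:ℝ), Real.exp_nat_mul]
    apply pow_le_pow_left₀ _ h3
    exact Finset.sum_nonneg (fun _ _ => (Real.exp_pos _).le)
  have h5 := Finset.card_nsmul_le_sum _ _ _ h1
  rw [nsmul_eq_mul] at h5
  have h6 : ((csbS R δ A).card : ℝ) * Real.exp (Real.log b * u - a * D) ≤ Real.exp (4 * b / a * n) := by linarith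
  have h7 : Real.exp (-Real.log b * u + a * D + 4 * b / a * n) = Real.exp (4 * b / a * n) / Real.exp (Real.log b * u - a * D) := by
    rw [← Real.exp_sub]; ring_nf
  rw [h7, le_div_iff₀ (Real.exp_pos _)]
  exact h6

set_option maxHeartbeats 1000000 in
/-- Entropy bound. -/
lemma csb_entropy {n : ℕ} (hn : 0 < n) (M η : ℝ) (hM : 0 < M) (hMη : M ≤ η) (hη1 : η ≤ 1)
    (lower : ∀ (R : ℕ) (δ η : ℝ) (hδ : 0 < δ) (hη : 0 < η) (hδη : 96 * n * δ ^ 2 < η ^ 2),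
    ∀ (N : ℕ) (A : Finset (EuclideanSpace ℝ (Fin n))), A.card = N → A.Nonempty →
    (∀ x ∈ A, ∀ i, |x i / δ| ≤ R) → (∀ x ∈ A, ∀ y ∈ A, x ≠ y → η ≤ ‖x - y‖) →
    √(A.card : ℝ) ≤ (csbS R δ A).card)
    (K T : Set (EuclideanSpace ℝ (Fin n)))
    (hT1 : ∀ y ∈ T, ‖y‖ ≤ 1)
    (hTK : ∀ y ∈ T, ∀ x ∈ K, |∑ i, x i * y i| ≤ 1)
    (hfail : ∀ s : Finset (Fin n), M ^ 2 * n ≤ s.card → ∃ x ∈ K, (∀ i ∉ s, x i = 0) ∧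
          Real.sqrt s.card < M * ∑ i ∈ s, |x i|)
    (A : Finset (EuclideanSpace ℝ (Fin n))) (hAT : ∀ y ∈ A, y ∈ T)
    (hsep : ∀ x ∈ A, ∀ y ∈ A, x ≠ y → η ≤ ‖x - y‖) :
    (A.card : ℝ) ≤ Real.exp (3200 * M ^ 2 * n * Real.log (2 / M) / η ^ 2) := by
  classical
  rcases A.eq_empty_or_nonempty with rfl | hA
  · simp; positivity
  have hη : 0 < η := hM.trans_le hMη
  have hn' : (0:ℝ) < n := by exact_mod_cast hn
  have hsn : 0 < √(n:ℝ) := Real.sqrt_pos.2 hn'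
  have hsn2 : √(n:ℝ) ^ 2 = n := Real.sq_sqrt hn'.le
  set δ := η / (10 * √(n:ℝ)) with hδdef
  have hδ : 0 < δ := by positivity
  have hδ2 : δ ^ 2 = η ^ 2 / (100 * n) := by rw [hδdef, div_pow, mul_pow, hsn2]; norm_num
  obtain ⟨R, hR⟩ := exists_nat_ge (1 / δ)
  have low := lower R δ η hδ hη (by rw [hδ2]; field_simp; norm_num) A.card A rfl hA (by
    intro x hx i
    refine le_trans ?_ hR
    rw [abs_div, abs_of_pos hδ]
    gcongr
    have := PiLp.norm_apply_le x i
    rw [Real.norm_eq_abs] at this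
    exact this.trans (hT1 x (hAT x hx))) hsep
  set u := 400 * M ^ 2 * n / η ^ 2 with hu
  have hu0 : 0 < u := by positivity
  have hM1 : M ≤ 1 := hMη.trans hη1
  have up := csb_upper R δ (M^2) (M^4/η^2) u (100 * n / η ^ 2) A (by positivity) (by nlinarith) (by positivity)
    (by
      rw [div_le_one (by positivity)]
      have : M ^ 2 ≤ η := by nlinarith
      nlinarith [sq_nonneg M])
    (by
      intro φ hφ
      set s : Finset (Fin n) := Finset.univ.filter (fun i => φ i ≠ none) with hs
      have hsum : ∑ i, (φ i).elim (0:ℝ) (fun _ => 1) = s.card := by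
        rw [hs, Finset.card_filter]
        push_cast
        apply Finset.sum_congr rfl
        intro i _
        cases h : φ i <;> simp
      rw [hsum]
      by_cases hc : M ^ 2 * n ≤ s.card
      · obtain ⟨x, hxK, hx0, hlt⟩ := hfail s hc
        obtain ⟨y, hy, hy'⟩ := hφ (fun i => decide (0 ≤ x i))
        obtain ⟨z, hz, hz'⟩ := hφ (fun i => ! decide (0 ≤ x i))
        have h1 := (abs_le.1 (hTK y (hAT y hy) x hxK)).2
        have h2 := (abs_le.1 (hTK z (hAT z hz) x hxK)).1
        have h3 : δ * ∑ i ∈ s, |x i| ≤ ∑ i, x i * y i - ∑ i, x i * z i := by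
          rw [← Finset.sum_sub_distrib, Finset.mul_sum]
          rw [← Finset.sum_subset (Finset.subset_univ s) (f := fun i => x i * y i - x i * z i) (by
            intro i _ hi; simp [hx0 i hi])]
          apply Finset.sum_le_sum
          intro i hi
          have hne : φ i ≠ none := by simpa [hs] using hi
          obtain ⟨h, hh⟩ := Option.ne_none_iff_exists'.1 hne
          have a1 := hy' i h hh
          have a2 := hz' i h hh
          simp only [le_div_iff₀ hδ, div_le_iff₀ hδ, decide_eq_true_eq, decide_eq_false_iff_not, Bool.not_eq_true', Bool.not_eq_false'] at a1 a2
          rcases le_or_gt 0 (x i) with h0 | h0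
          · rw [abs_of_nonneg h0]
            have b1 := a1.1 h0
            have b2 := a2.2 h0
            nlinarith
          · rw [abs_of_neg h0]
            have b1 := a1.2 (not_le.2 h0)
            have b2 := a2.1 (not_le.2 h0)
            nlinarith
        have h4 : √(s.card : ℝ) * δ ≤ 2 * M := by nlinarith
        have h5 : (√(s.card : ℝ) * δ)^2 ≤ (2 * M)^2 := by gcongr
        rw [mul_pow, Real.sq_sqrt (by positivity), hδ2] at h5
        rw [hu, le_div_iff₀ (by positivity)]
        have : (s.card : ℝ) * (η ^ 2 / (100 * n)) = s.card * η ^ 2 / (100 * n) := by ring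
        rw [this, div_le_iff₀ (by positivity)] at h5
        linarith
      · push Not at hc
        refine hc.le.trans ?_
        rw [hu, le_div_iff₀ (by positivity)]
        have : η ^ 2 ≤ 400 := by nlinarith
        nlinarith [mul_le_mul_of_nonneg_left this (by positivity : 0 ≤ M ^ 2 * n)])
    (by
      intro φ hφ
      obtain ⟨y, hy, hy'⟩ := hφ (fun i => (φ i).elim false (fun h => decide (0 ≤ h)))
      have h1 : ∑ i, (y i) ^ 2 ≤ 1 := by
        rw [← EuclideanSpace.real_norm_sq_eq]
        have := hT1 y (hAT y hy)
        have := norm_nonneg y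
        nlinarith
      have h2 : ∑ i, (φ i).elim (0:ℝ) (fun h => |(h:ℝ)|) ≤ ∑ i, (y i / δ)^2 := by
        apply Finset.sum_le_sum
        intro i _
        cases hh : φ i with
        | none => simp; positivity
        | some h =>
          simp only [Option.elim_some]
          have a1 := hy' i h hh
          simp only [hh, Option.elim_some, decide_eq_true_eq, decide_eq_false_iff_not] at a1
          rcases le_or_gt 0 h with h0 | h0
          · have b1 := a1.1 h0
            have h0' : (0:ℝ) ≤ h := by exact_mod_cast h0
            rw [abs_of_nonneg h0']
            nlinarith
          · have b1 := a1.2 (not_le.2 h0)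
            have h0' : (h:ℝ) ≤ -1 := by exact_mod_cast (by omega : h ≤ -1)
            rw [abs_of_nonpos (by linarith)]
            nlinarith
      refine h2.trans ?_
      simp only [div_pow, ← Finset.sum_div]
      rw [hδ2, div_div_eq_mul_div]
      apply div_le_div_of_nonneg_right _ (by positivity)
      exact mul_le_of_le_one_left (by positivity) h1)
  have hlog : Real.log (M ^ 4 / η ^ 2) = 4 * Real.log M - 2 * Real.log η := by
    rw [Real.log_div (by positivity) (by positivity), Real.log_pow, Real.log_pow]; norm_num
  have hl2 : Real.log (2 / M) = Real.log 2 - Real.log M := Real.log_div (by norm_num) (by positivity)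
  have hlη : Real.log η ≤ 0 := Real.log_nonpos hη.le hη1
  have hl2' := Real.log_two_gt_d9
  have hexp : -Real.log (M ^ 4 / η ^ 2) * u + M ^ 2 * (100 * n / η ^ 2) + 4 * (M ^ 4 / η ^ 2) / M ^ 2 * n ≤ 4 * u * Real.log (2 / M) := by
    have e1 : M ^ 2 * (100 * n / η ^ 2) = u / 4 := by rw [hu]; ring
    have e2 : 4 * (M ^ 4 / η ^ 2) / M ^ 2 * n = u / 100 := by rw [hu]; field_simp; norm_num
    rw [e1, e2, hlog, hl2]
    have h7 : 0 ≤ u * (4 * Real.log 2 - 2 * Real.log η - 26 / 100) := mul_nonneg hu0.le (by linarith)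
    linarith
  have h8 : √(A.card : ℝ) ≤ Real.exp (4 * u * Real.log (2 / M)) :=
    low.trans (up.trans (Real.exp_le_exp.2 hexp))
  have h9 : (A.card : ℝ) ≤ Real.exp (4 * u * Real.log (2 / M)) ^ 2 := by
    rw [← Real.sq_sqrt (Nat.cast_nonneg A.card : (0:ℝ) ≤ A.card)]
    gcongr
  refine h9.trans (le_of_eq ?_)
  rw [← Real.exp_nat_mul, hu]
  congr 1
  push_cast; ring

lemma csb_net {E : Type*} [NormedAddCommGroup E] (T : Set E) (η B : ℝ) (hη : 0 < η)
    (hB : ∀ A : Finset E, (∀ y ∈ A, y ∈ T) → (∀ x ∈ A, ∀ y ∈ A, x ≠ y → η ≤ ‖x - y‖) → (A.card : ℝ) ≤ B) :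
    ∃ A : Finset E, (∀ y ∈ A, y ∈ T) ∧ (A.card : ℝ) ≤ B ∧ ∀ y ∈ T, ∃ q ∈ A, ‖y - q‖ ≤ η := by
  classical
  let P : ℕ → Prop := fun k => ∃ A : Finset E, A.card = k ∧ (∀ y ∈ A, y ∈ T) ∧ (∀ x ∈ A, ∀ y ∈ A, x ≠ y → η ≤ ‖x - y‖)
  have hP0 : P 0 := ⟨∅, by simp⟩
  have hbd : ∀ k, P k → k ≤ ⌊B⌋₊ := by
    rintro k ⟨A, rfl, h1, h2⟩
    exact Nat.le_floor (hB A h1 h2)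
  obtain ⟨A, hA, h1, h2⟩ := Nat.findGreatest_spec (P := P) (n := ⌊B⌋₊) (Nat.zero_le _) hP0
  refine ⟨A, h1, hB A h1 h2, fun y hy => ?_⟩
  by_contra hcon
  push Not at hcon
  have hyA : y ∉ A := fun h => by have := hcon y h; simp at this; linarith
  have : P (A.card + 1) := by
    refine ⟨insert y A, Finset.card_insert_of_notMem hyA, ?_, ?_⟩
    · intro z hz
      rcases Finset.mem_insert.1 hz with rfl | hz
      · exact hy
      · exact h1 z hz
    · intro x hx z hz hne
      rcases Finset.mem_insert.1 hx with hx1 | hx1 <;> rcases Finset.mem_insert.1 hz with hz1 | hz1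
      · exact absurd (hx1.trans hz1.symm) hne
      · rw [hx1]; exact (hcon z hz1).le
      · rw [norm_sub_rev, hz1]; exact (hcon x hx1).le
      · exact h2 x hx1 z hz1 hne
  have h3 := Nat.le_findGreatest (hbd _ this) this
  rw [hA] at h3
  omega

lemma csb_integrable {n : ℕ} (μ : Measure (EuclideanSpace ℝ (Fin n))) [IsProbabilityMeasure μ]
    (hμ : μ ((Metric.sphere (0 : EuclideanSpace ℝ (Fin n)) 1)ᶜ) = 0) (y : EuclideanSpace ℝ (Fin n)) :
    Integrable (fun x => Real.exp (inner ℝ x y)) μ := by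
  apply Integrable.of_bound (C := Real.exp ‖y‖)
  · exact (by fun_prop : Continuous (fun x : EuclideanSpace ℝ (Fin n) => Real.exp (inner ℝ x y))).aestronglyMeasurable
  · have : ∀ᵐ x ∂μ, x ∈ Metric.sphere (0 : EuclideanSpace ℝ (Fin n)) 1 := hμ
    filter_upwards [this] with x hx
    rw [Real.norm_eq_abs, abs_of_pos (Real.exp_pos _)]
    apply Real.exp_le_exp.2
    have h := real_inner_le_norm x y
    have hx' : ‖x‖ = 1 := by simpa using hx
    rw [hx', one_mul] at h
    exact h

lemma csb_mgf {n : ℕ} (hn : 0 < n) (μ : Measure (EuclideanSpace ℝ (Fin n))) [IsProbabilityMeasure μ]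
    (hμ : μ ((Metric.sphere (0 : EuclideanSpace ℝ (Fin n)) 1)ᶜ) = 0)
    (hinv : ∀ e : EuclideanSpace ℝ (Fin n) ≃ₗᵢ[ℝ] EuclideanSpace ℝ (Fin n), Measure.map (⇑e) μ = μ)
    (y : EuclideanSpace ℝ (Fin n)) :
    ∫ x, Real.exp (inner ℝ x y) ∂μ ≤ Real.exp (‖y‖ ^ 2 / (2 * n)) := by
  classical
  have hn' : (0:ℝ) < n := by exact_mod_cast hn
  have hsame : ∀ z : EuclideanSpace ℝ (Fin n), ‖y‖ = ‖z‖ →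
      ∫ x, Real.exp (inner ℝ x y) ∂μ = ∫ x, Real.exp (inner ℝ x z) ∂μ := by
    intro z hz
    let e := (Submodule.span ℝ {y - z})ᗮ.reflection
    have he : e y = z := Submodule.reflection_sub hz
    have hm := hinv e
    conv_rhs => rw [← hm]
    rw [integral_map e.continuous.aemeasurable
      ((by fun_prop : Continuous (fun x : EuclideanSpace ℝ (Fin n) => Real.exp (inner ℝ x z))).aestronglyMeasurable)]
    congr 1
    funext x
    rw [← he, LinearIsometryEquiv.inner_map_map]
  let t : ℝ := ‖y‖ / √(n:ℝ)
  have ht : t ^ 2 * n = ‖y‖ ^ 2 := by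
    simp only [t]; rw [div_pow, Real.sq_sqrt hn'.le]; field_simp
  let sg : Bool → ℝ := fun b => if b then 1 else -1
  let z : (Fin n → Bool) → EuclideanSpace ℝ (Fin n) := fun ω => WithLp.toLp 2 (fun i => t * sg (ω i))
  have hz : ∀ ω, ‖y‖ = ‖z ω‖ := by
    intro ω
    have : ‖z ω‖ ^ 2 = ‖y‖ ^ 2 := by
      rw [EuclideanSpace.real_norm_sq_eq, ← ht]
      have : ∀ i, (z ω i) ^ 2 = t ^ 2 := by
        intro i; simp only [z, sg]; split_ifs <;> ring
      simp [this]; ring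
    exact ((sq_eq_sq₀ (norm_nonneg _) (norm_nonneg _)).1 this).symm
  have hprod : ∀ x : EuclideanSpace ℝ (Fin n), ∑ ω, Real.exp (inner ℝ x (z ω)) = ∏ i, (2 * Real.cosh (t * x i)) := by
    intro x
    have : ∀ i, 2 * Real.cosh (t * x i) = ∑ b : Bool, Real.exp (t * sg b * x i) := by
      intro i
      rw [Real.cosh_eq, Fintype.sum_bool]; simp [sg]; ring
    simp only [this]
    rw [Finset.prod_univ_sum, Fintype.piFinset_univ]
    apply Finset.sum_congr rfl
    intro ω _
    rw [← Real.exp_sum]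
    congr 1
  have hle : ∀ᵐ x ∂μ, ∑ ω, Real.exp (inner ℝ x (z ω)) ≤ 2 ^ n * Real.exp (t ^ 2 / 2) := by
    have : ∀ᵐ x ∂μ, x ∈ Metric.sphere (0 : EuclideanSpace ℝ (Fin n)) 1 := hμ
    filter_upwards [this] with x hx
    have hx' : ‖x‖ = 1 := by simpa using hx
    rw [hprod, Finset.prod_mul_distrib]
    simp only [Finset.prod_const, Finset.card_univ, Fintype.card_fin]
    gcongr
    calc ∏ i, Real.cosh (t * x i) ≤ ∏ i, Real.exp ((t * x i)^2/2) :=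
          Finset.prod_le_prod (fun i _ => (Real.cosh_pos _).le) (fun i _ => Real.cosh_le_exp_half_sq _)
      _ = Real.exp (t ^ 2 / 2) := by
          rw [← Real.exp_sum]
          congr 1
          have : ∑ i, (x i)^2 = 1 := by rw [← EuclideanSpace.real_norm_sq_eq, hx']; norm_num
          calc ∑ i, (t * x i)^2/2 = t^2/2 * ∑ i, (x i)^2 := by rw [Finset.mul_sum]; apply Finset.sum_congr rfl; intro i _; ring
            _ = _ := by rw [this, mul_one]
  have hint : ∫ x, ∑ ω, Real.exp (inner ℝ x (z ω)) ∂μ ≤ ∫ _x, 2 ^ n * Real.exp (t ^ 2 / 2) ∂μ := by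
    apply integral_mono_ae _ (integrable_const _) hle
    exact integrable_finsetSum _ (fun ω _ => csb_integrable μ hμ (z ω))
  rw [integral_finsetSum _ (fun ω _ => csb_integrable μ hμ (z ω))] at hint
  simp only [← hsame _ (hz _)] at hint
  simp only [Finset.sum_const, Finset.card_univ, Fintype.card_fun, Fintype.card_bool, Fintype.card_fin, nsmul_eq_mul, Nat.cast_pow, Nat.cast_ofNat, integral_const, probReal_univ, one_smul, smul_eq_mul, one_mul] at hint
  have h := le_of_mul_le_mul_left hint (by positivity)
  refine h.trans (le_of_eq ?_)
  congr 1
  rw [← ht]; field_simp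

/-- maximal inequality -/
lemma csb_max {n : ℕ} (hn : 0 < n) (μ : Measure (EuclideanSpace ℝ (Fin n))) [IsProbabilityMeasure μ]
    (hμ : μ ((Metric.sphere (0 : EuclideanSpace ℝ (Fin n)) 1)ᶜ) = 0)
    (hinv : ∀ e : EuclideanSpace ℝ (Fin n) ≃ₗᵢ[ℝ] EuclideanSpace ℝ (Fin n), Measure.map (⇑e) μ = μ)
    (P : Finset (EuclideanSpace ℝ (Fin n))) (H r l : ℝ) (hl : 0 < l)
    (hP : (P.card : ℝ) ≤ Real.exp H) (hr : ∀ p ∈ P, ‖p‖ ≤ r) :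
    ∃ g : EuclideanSpace ℝ (Fin n) → ℝ, Integrable g μ ∧ (∀ x, ∀ p ∈ P, inner ℝ x p ≤ g x) ∧
      ∫ x, g x ∂μ ≤ (H + l ^ 2 * r ^ 2 / (2 * n)) / l := by
  set L := H + l ^ 2 * r ^ 2 / (2 * n) with hL
  have hint : Integrable (fun x => ∑ p ∈ P, Real.exp (inner ℝ x (l • p)) * Real.exp (-L)) μ :=
    integrable_finsetSum _ (fun p _ => (csb_integrable μ hμ (l • p)).mul_const _)
  refine ⟨fun x => (L - 1 + ∑ p ∈ P, Real.exp (inner ℝ x (l • p)) * Real.exp (-L)) / l, ?_, ?_, ?_⟩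
  · exact ((integrable_const _).add hint).div_const _
  · intro x p hp
    rw [le_div_iff₀ hl]
    have h1 : Real.exp (inner ℝ x (l • p)) * Real.exp (-L) ≤ ∑ p ∈ P, Real.exp (inner ℝ x (l • p)) * Real.exp (-L) :=
      Finset.single_le_sum (f := fun p => Real.exp (inner ℝ x (l • p)) * Real.exp (-L)) (fun _ _ => by positivity) hp
    rw [← Real.exp_add] at h1
    have h2 := Real.add_one_le_exp (inner ℝ x (l • p) + -L)
    have h3 : inner ℝ x (l • p) = inner ℝ x p * l := by rw [real_inner_smul_right]; ring
    linarith
  · rw [integral_div, integral_add (integrable_const _) hint]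
    gcongr
    rw [integral_finsetSum _ (fun p _ => (csb_integrable μ hμ (l • p)).mul_const _)]
    simp only [integral_mul_const, integral_const, probReal_univ, one_smul]
    have h1 : ∑ p ∈ P, (∫ x, Real.exp (inner ℝ x (l • p)) ∂μ) * Real.exp (-L) ≤ ∑ p ∈ P, Real.exp (l ^ 2 * r ^ 2 / (2 * n)) * Real.exp (-L) := by
      apply Finset.sum_le_sum
      intro p hp
      gcongr
      refine (csb_mgf hn μ hμ hinv (l • p)).trans (Real.exp_le_exp.2 ?_)
      rw [norm_smul, mul_pow, Real.norm_eq_abs, sq_abs]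
      have := hr p hp
      gcongr
    rw [Finset.sum_const, nsmul_eq_mul, ← Real.exp_add] at h1
    have h2 : (P.card : ℝ) * Real.exp (l ^ 2 * r ^ 2 / (2 * n) + -L) ≤ Real.exp H * Real.exp (l ^ 2 * r ^ 2 / (2 * n) + -L) := by gcongr
    rw [← Real.exp_add, hL] at h2
    have h3 : H + (l ^ 2 * r ^ 2 / (2 * n) + -(H + l ^ 2 * r ^ 2 / (2 * n))) = 0 := by ring
    rw [h3, Real.exp_zero] at h2
    rw [← hL] at h2
    linarith

lemma csb_dual {n : ℕ} (K : Set (EuclideanSpace ℝ (Fin n))) (hK : Convex ℝ K) (hKc : IsClosed K) (h0 : (0 : EuclideanSpace ℝ (Fin n)) ∈ K)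
    (x : EuclideanSpace ℝ (Fin n)) (B : ℝ)
    (hB : ∀ y : EuclideanSpace ℝ (Fin n), (∀ z ∈ K, inner ℝ z y ≤ 1) → inner ℝ x y ≤ B) : gauge K x ≤ B := by
  have hB0 : 0 ≤ B := by simpa using hB 0 (by simp)
  apply le_of_forall_gt_imp_ge_of_dense
  intro r hr
  have hr0 : 0 < r := hB0.trans_lt hr
  apply gauge_le_of_mem hr0.le
  rw [Set.mem_smul_set_iff_inv_smul_mem₀ hr0.ne']
  by_contra hx
  obtain ⟨f, u, hf, hu⟩ := geometric_hahn_banach_closed_point hK hKc hx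
  have hu0 : 0 < u := by simpa using hf 0 h0
  let w := (InnerProductSpace.toDual ℝ (EuclideanSpace ℝ (Fin n))).symm f
  have hw : ∀ z, inner ℝ z w = f z := by
    intro z; rw [real_inner_comm]; exact InnerProductSpace.toDual_symm_apply
  have h1 := hB (u⁻¹ • w) (by
    intro z hz
    rw [real_inner_smul_right, hw]
    rw [inv_mul_le_iff₀ hu0]; linarith [hf z hz])
  rw [real_inner_smul_right, hw, inv_mul_le_iff₀ hu0] at h1
  rw [map_smul, smul_eq_mul, lt_inv_mul_iff₀ hr0] at hu
  nlinarith

lemma csb_chain {n : ℕ} (hn : 0 < n) (μ : Measure (EuclideanSpace ℝ (Fin n))) [IsProbabilityMeasure μ]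
    (hμ : μ ((Metric.sphere (0 : EuclideanSpace ℝ (Fin n)) 1)ᶜ) = 0)
    (hinv : ∀ e : EuclideanSpace ℝ (Fin n) ≃ₗᵢ[ℝ] EuclideanSpace ℝ (Fin n), Measure.map (⇑e) μ = μ)
    (T : Set (EuclideanSpace ℝ (Fin n))) (M l : ℝ) (hM : 0 < M) (hl : 0 < l)
    (h0 : (0 : EuclideanSpace ℝ (Fin n)) ∈ T) (hT1 : ∀ y ∈ T, ‖y‖ ≤ 1)
    (hent : ∀ η : ℝ, M ≤ η → η ≤ 1 → ∀ A : Finset (EuclideanSpace ℝ (Fin n)), (∀ y ∈ A, y ∈ T) →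
      (∀ x ∈ A, ∀ y ∈ A, x ≠ y → η ≤ ‖x - y‖) → (A.card : ℝ) ≤ Real.exp (3200 * M ^ 2 * n * l / η ^ 2))
    (j : ℕ) (hj : M ≤ (1/2:ℝ) ^ j) :
    ∃ (N : Finset (EuclideanSpace ℝ (Fin n))) (G : EuclideanSpace ℝ (Fin n) → ℝ),
      (∀ y ∈ N, y ∈ T) ∧ (N.card : ℝ) ≤ Real.exp (3200 * M ^ 2 * n * l / ((1/2:ℝ) ^ j) ^ 2) ∧
      (∀ y ∈ T, ∃ q ∈ N, ‖y - q‖ ≤ (1/2:ℝ) ^ j) ∧ Integrable G μ ∧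
      (∀ x, ∀ p ∈ N, inner ℝ x p ≤ G x) ∧ ∫ x, G x ∂μ ≤ j * (4002 * M * √l) := by
  classical
  have hn' : (0:ℝ) < n := by exact_mod_cast hn
  induction j with
  | zero =>
    refine ⟨{0}, fun _ => 0, by simpa using h0, ?_, ?_, integrable_const _, by simp, by simp⟩
    · simp only [Finset.card_singleton, Nat.cast_one]
      apply Real.one_le_exp; positivity
    · intro y hy; exact ⟨0, by simp, by simpa using hT1 y hy⟩
  | succ j ih =>
    have hpow : (1/2:ℝ) ^ j = 2 * (1/2:ℝ) ^ (j+1) := by rw [pow_succ]; ring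
    set η := (1/2:ℝ) ^ (j+1) with hη
    have hη0 : 0 < η := by positivity
    obtain ⟨N, G, hNT, hNc, hNn, hGi, hGb, hG⟩ := ih (by rw [hpow]; linarith)
    obtain ⟨N', hN'T, hN'c, hN'n⟩ := csb_net T η _ hη0 (hent η hj (pow_le_one₀ (by norm_num) (by norm_num)))
    let P := ((N' ×ˢ N).filter (fun pq => ‖pq.1 - pq.2‖ ≤ 2 * η)).image (fun pq => pq.1 - pq.2)
    have hPc : (P.card : ℝ) ≤ Real.exp (4000 * M ^ 2 * n * l / η ^ 2) := by
      have h1 : P.card ≤ N'.card * N.card := by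
        refine Finset.card_image_le.trans ((Finset.card_filter_le _ _).trans ?_)
        rw [Finset.card_product]
      have h2 : (P.card : ℝ) ≤ N'.card * N.card := by exact_mod_cast h1
      refine h2.trans ((mul_le_mul hN'c hNc (by positivity) (by positivity)).trans (le_of_eq ?_))
      rw [← Real.exp_add, hpow]
      congr 1
      field_simp; ring
    have hPr : ∀ p ∈ P, ‖p‖ ≤ 2 * η := by
      intro p hp
      simp only [P, Finset.mem_image, Finset.mem_filter] at hp
      obtain ⟨pq, h, rfl⟩ := hp
      exact h.2
    have hsl : 0 < √l := Real.sqrt_pos.2 hl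
    obtain ⟨g, hgi, hgb, hg⟩ := csb_max hn μ hμ hinv P _ _ (n * M * √l / η ^ 2) (by positivity) hPc hPr
    refine ⟨N', fun x => G x + g x, hN'T, hN'c, hN'n, hGi.add hgi, ?_, ?_⟩
    · intro x p hp
      obtain ⟨q, hq, hpq⟩ := hNn p (hN'T p hp)
      have h1 := hGb x q hq
      have h2 := hgb x (p - q) (by
        simp only [P, Finset.mem_image, Finset.mem_filter, Finset.mem_product]
        exact ⟨(p, q), ⟨⟨hp, hq⟩, by rw [← hpow]; exact hpq⟩, rfl⟩)
      rw [inner_sub_right] at h2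
      linarith
    · rw [integral_add hGi hgi]
      have e : (4000 * M ^ 2 * n * l / η ^ 2 + (n * M * √l / η ^ 2) ^ 2 * (2 * η) ^ 2 / (2 * n)) / (n * M * √l / η ^ 2) = 4002 * M * √l := by
        have hs : √l ^ 2 = l := Real.sq_sqrt hl.le
        have : 4000 * M ^ 2 * n * l / η ^ 2 = 4000 * M ^ 2 * n * √l ^ 2 / η ^ 2 := by rw [hs]
        rw [this]
        field_simp; ring
      rw [e] at hg
      push_cast
      linarith

lemma csb_main {n : ℕ} (hn : 0 < n) (μ : Measure (EuclideanSpace ℝ (Fin n))) [IsProbabilityMeasure μ]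
    (hμ : μ ((Metric.sphere (0 : EuclideanSpace ℝ (Fin n)) 1)ᶜ) = 0)
    (hinv : ∀ e : EuclideanSpace ℝ (Fin n) ≃ₗᵢ[ℝ] EuclideanSpace ℝ (Fin n), Measure.map (⇑e) μ = μ)
    (K : Set (EuclideanSpace ℝ (Fin n))) (hK : Convex ℝ K) (hKc : IsClosed K) (hKs : ∀ x ∈ K, -x ∈ K)
    (hKb : Metric.closedBall (0 : EuclideanSpace ℝ (Fin n)) 1 ⊆ K)
    (M : ℝ) (hM : 0 < M) (hM1 : M ≤ 1)
    (hfail : ∀ s : Finset (Fin n), M ^ 2 * n ≤ s.card → ∃ x ∈ K, (∀ i ∉ s, x i = 0) ∧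
          Real.sqrt s.card < M * ∑ i ∈ s, |x i|) :
    ∫ x, gauge K x ∂μ ≤ 7000 * M * (Real.log (2 / M) * √(Real.log (2 / M))) := by
  set l := Real.log (2 / M) with hl
  have hl2 : l = Real.log 2 - Real.log M := Real.log_div (by norm_num) (by positivity)
  have hlM : Real.log M ≤ 0 := Real.log_nonpos hM.le hM1
  have hlog2 := Real.log_two_gt_d9
  have hl0 : 0.69 < l := by norm_num at hlog2 ⊢; linarith
  have hlpos : 0 < l := by linarith
  let T : Set (EuclideanSpace ℝ (Fin n)) := {y | ∀ z ∈ K, inner ℝ z y ≤ 1}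
  have hin : ∀ x y : EuclideanSpace ℝ (Fin n), inner ℝ x y = ∑ i, x i * y i := by
    intro x y
    rw [PiLp.inner_apply]
    apply Finset.sum_congr rfl
    intro i _
    simp [mul_comm]
  have hT1 : ∀ y ∈ T, ‖y‖ ≤ 1 := by
    intro y hy
    by_cases h : y = 0
    · simp [h]
    have hy0 : 0 < ‖y‖ := norm_pos_iff.2 h
    have := hy (‖y‖⁻¹ • y) (hKb (by
      rw [mem_closedBall_zero_iff, norm_smul, norm_inv, norm_norm, inv_mul_cancel₀ hy0.ne']))
    rw [real_inner_smul_left, real_inner_self_eq_norm_sq] at this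
    have e : ‖y‖⁻¹ * ‖y‖ ^ 2 = ‖y‖ := by field_simp
    linarith
  have hTK : ∀ y ∈ T, ∀ x ∈ K, |∑ i, x i * y i| ≤ 1 := by
    intro y hy x hx
    rw [← hin, abs_le]
    have h1 := hy x hx
    have h2 := hy (-x) (hKs x hx)
    rw [inner_neg_left] at h2
    constructor <;> linarith
  have hK0 : (0 : EuclideanSpace ℝ (Fin n)) ∈ K := hKb (by simp)
  have h0T : (0 : EuclideanSpace ℝ (Fin n)) ∈ T := by intro z _; simp
  obtain ⟨J, hJ1, hJ2⟩ := exists_nat_pow_near_of_lt_one hM hM1 (by norm_num : (0:ℝ) < 1/2) (by norm_num)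
  obtain ⟨N, G, hNT, -, hNn, hGi, hGb, hG⟩ := csb_chain hn μ hμ hinv T M l hM hlpos h0T hT1
    (fun η h1 h2 A hA hs => csb_entropy hn M η hM h1 h2 (fun R δ η => csb_lower R δ η) K T hT1 hTK hfail A hA hs) J hJ2
  have hle : ∀ᵐ x ∂μ, gauge K x ≤ G x + (1/2:ℝ) ^ J := by
    have : ∀ᵐ x ∂μ, x ∈ Metric.sphere (0 : EuclideanSpace ℝ (Fin n)) 1 := hμ
    filter_upwards [this] with x hx
    have hx' : ‖x‖ = 1 := by simpa using hx
    apply csb_dual K hK hKc hK0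
    intro y hy
    obtain ⟨q, hq, hyq⟩ := hNn y hy
    have h1 := hGb x q hq
    have h2 := real_inner_le_norm x (y - q)
    rw [hx', one_mul, inner_sub_right] at h2
    linarith
  have hadd : Integrable (fun x => G x + (1/2:ℝ) ^ J) μ := hGi.add (integrable_const _)
  have hint := integral_mono_of_nonneg (Filter.Eventually.of_forall (fun x => gauge_nonneg x)) hadd hle
  have e : ∫ x, (G x + (1/2:ℝ)^J) ∂μ = ∫ x, G x ∂μ + (1/2:ℝ)^J := by
    rw [integral_add hGi (integrable_const _)]; simp
  have hint' : ∫ x, gauge K x ∂μ ≤ J * (4002 * M * √l) + (1/2:ℝ)^J := by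
    refine hint.trans ?_
    rw [e]; linarith
  have hJ3 : (1/2:ℝ)^J ≤ 2 * M := by rw [pow_succ] at hJ1; linarith
  have hJ4 : (J:ℝ) * 0.69 ≤ l := by
    have := Real.log_le_log hM hJ2
    rw [Real.log_pow, one_div, Real.log_inv] at this
    have hJ0 : (0:ℝ) ≤ J := Nat.cast_nonneg J
    norm_num at hlog2 ⊢
    nlinarith
  have hsl : 0.8 ≤ √l := Real.le_sqrt_of_sq_le (by norm_num at hl0 ⊢; linarith)
  norm_num at hsl hl0 hJ4
  have h1 : (J:ℝ) * (4002 * M * √l) ≤ (100 / 69 * l) * (4002 * M * √l) := by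
    apply mul_le_mul_of_nonneg_right _ (by positivity); linarith
  have h2 : 1/2 ≤ l * √l := by nlinarith
  have h3 : M * (1/2) ≤ M * (l * √l) := by gcongr
  nlinarith

/-- Let `K` be a symmetric convex body in `ℝ^n` containing the unit
Euclidean ball, let `σm` be the normalized rotation-invariant (Lebesgue) probability measure
on the unit Euclidean sphere, let `M_K = ∫_{S^{n-1}} ‖x‖_K dσ` (with `‖·‖_K` the Minkowski
functional, i.e. gauge, of `K`) and `M = c·M_K·(log(2/M_K))^{-3/2}`. Then there exists
`σ ⊆ {1,…,n}` with `|σ| ≥ M²·n` such that `M·(K ∩ ℝ^σ) ⊆ √|σ|·B₁^σ`. -/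
theorem coordinate_section_in_ball_l1 :
    ∃ c > (0 : ℝ), ∀ (n : ℕ) (K : Set (EuclideanSpace ℝ (Fin n)))
      (σm : Measure (EuclideanSpace ℝ (Fin n))),
      0 < n → Convex ℝ K → IsCompact K → (∀ x ∈ K, -x ∈ K) →
      Metric.closedBall (0 : EuclideanSpace ℝ (Fin n)) 1 ⊆ K →
      IsProbabilityMeasure σm →
      σm ((Metric.sphere (0 : EuclideanSpace ℝ (Fin n)) 1)ᶜ) = 0 →
      (∀ e : EuclideanSpace ℝ (Fin n) ≃ₗᵢ[ℝ] EuclideanSpace ℝ (Fin n),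
        Measure.map (⇑e) σm = σm) →
      ∀ MK M : ℝ, MK = ∫ x, gauge K x ∂σm →
        M = c * MK * (Real.log (2 / MK)) ^ (-(3 / 2) : ℝ) →
      ∃ s : Finset (Fin n), M ^ 2 * n ≤ s.card ∧
        ∀ x ∈ K, (∀ i ∉ s, x i = 0) →
          M * ∑ i ∈ s, |x i| ≤ Real.sqrt s.card := by
  refine ⟨1 / 2 ^ 30, by positivity, ?_⟩
  intro n K μ hn hK hKc hKs hKb hp hμ hinv MK M hMK hM
  by_contra hcon
  push Not at hcon
  have hMK0 : 0 ≤ MK := by rw [hMK]; exact integral_nonneg (fun x => gauge_nonneg x)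
  have hMK1 : MK ≤ 1 := by
    have h1 : ∀ᵐ x ∂μ, gauge K x ≤ 1 := by
      have : ∀ᵐ x ∂μ, x ∈ Metric.sphere (0 : EuclideanSpace ℝ (Fin n)) 1 := hμ
      filter_upwards [this] with x hx
      exact gauge_le_one_of_mem (hKb (Metric.sphere_subset_closedBall hx))
    have := integral_mono_of_nonneg (Filter.Eventually.of_forall (fun x => gauge_nonneg x)) (integrable_const (1:ℝ)) h1
    rw [hMK]; simpa using this
  rcases hMK0.eq_or_lt with h0 | hMKpos
  · have hM0 : M = 0 := by rw [hM, ← h0]; simp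
    obtain ⟨x, -, -, hx⟩ := hcon ∅ (by rw [hM0]; simp)
    simp at hx
  set L := Real.log (2 / MK) with hL
  have hlog2 := Real.log_two_gt_d9
  have hL2 : L = Real.log 2 - Real.log MK := Real.log_div (by norm_num) (by positivity)
  have hlMK : Real.log MK ≤ 0 := Real.log_nonpos hMK0 hMK1
  norm_num at hlog2
  have hL0 : 69 / 100 < L := by linarith
  have hLpos : 0 < L := by linarith
  have hsL : 4 / 5 ≤ √L := Real.le_sqrt_of_sq_le (by norm_num; linarith)
  have hrp : L ^ (-(3 / 2) : ℝ) = (L * √L)⁻¹ := by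
    rw [Real.rpow_neg hLpos.le, Real.sqrt_eq_rpow, ← Real.rpow_one_add' hLpos.le (by norm_num)]
    norm_num
  have hLL : 1 / 2 ≤ L * √L := by nlinarith
  have hLLpos : 0 < L * √L := by linarith
  have hMeq : M * (L * √L) = 1 / 2 ^ 30 * MK := by
    rw [hM, hrp]; field_simp
  have hMpos : 0 < M := by rw [hM, hrp]; positivity
  have hM1 : M ≤ 1 := by
    by_contra h
    push Not at h
    nlinarith
  have hmain := csb_main hn μ hμ hinv K hK hKc.isClosed hKs hKb M hMpos hM1 hcon
  rw [← hMK] at hmain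
  set l := Real.log (2 / M) with hl
  have hl2 : l = Real.log 2 - Real.log M := Real.log_div (by norm_num) (by positivity)
  have hlL : l ≤ 36 * L := by
    have h1 : Real.log M + (Real.log L + Real.log L / 2) = Real.log MK - 30 * Real.log 2 := by
      have := congrArg Real.log hMeq
      rw [Real.log_mul hMpos.ne' hLLpos.ne', Real.log_mul hLpos.ne' (by positivity), Real.log_sqrt hLpos.le,
        Real.log_mul (by positivity) hMKpos.ne', one_div, Real.log_inv, Real.log_pow] at this
      push_cast at this
      linarith
    have h2 := Real.log_le_sub_one_of_pos hLpos
    linarith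
  have hl0 : 0 ≤ l := by
    have : Real.log M ≤ 0 := Real.log_nonpos hMpos.le hM1
    linarith
  have hsl : √l ≤ 6 * √L := by
    have : √(36 * L) = 6 * √L := by
      rw [Real.sqrt_mul (by norm_num), show (36:ℝ) = 6 ^ 2 by norm_num, Real.sqrt_sq (by norm_num)]
    rw [← this]; exact Real.sqrt_le_sqrt hlL
  have h3 : l * √l ≤ 36 * L * (6 * √L) := mul_le_mul hlL hsl (Real.sqrt_nonneg _) (by positivity)
  have h4 : 7000 * M * (l * √l) ≤ 7000 * M * (36 * L * (6 * √L)) := by gcongr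
  have h5 : 7000 * M * (36 * L * (6 * √L)) = 1512000 * (M * (L * √L)) := by ring
  rw [h5, hMeq] at h4
  have h6 : 1512000 * (1 / 2 ^ 30 * MK) < MK := by norm_num; linarith
  linarith
end
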